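/- There is an absolute constant c > 0 with the following property. Let F = (f_1, …, f_k) with each f_i ∈ ℤ[x_1, …, x_n] nonzero, let D = max_i deg(f_i) ≥ 1, let σ(F) denote the bit-size of F, and let Z_F ⊆ ℂ^n be the common zero set of f_1, …, f_k, regarded with the Zariski topology induced from ℂ^n. Then there exist univariate polynomials u_1, …, u_n, U_F ∈ ℤ[t] and positive integers r_1, …, r_n such that: (1) the number of irreducible components of Z_F is at most deg U_F, and deg(u_i) ≤ deg(U_F) ≤ D^n for all 1 ≤ i ≤ n; (2) for every complex root θ of U_F, the point (u_1(θ)/r_1, …, u_n(θ)/r_n) is a common zero of f_1, …, f_k, and every irreducible component of Z_F contains at least one point of this form; (3) every coefficient of U_F has absolute value at most 2^{c·D^n·(σ(F) + n·log D)}. -/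

import Mathlib

set_option linter.all false


section
open scoped Classical

noncomputable section

/-- The bit-size of an integer multivariate polynomial: the total number of bits of the
binary expansions of all coefficients and exponents in its monomial expansion. -/
def bitSize {n : ℕ} (f : MvPolynomial (Fin n) ℤ) : ℕ :=
  ∑ m ∈ f.support, (Nat.size (f.coeff m).natAbs + ∑ i, Nat.size (m i))

/-- The bit-size of a polynomial system. -/
def sysBitSize {n k : ℕ} (F : Fin k → MvPolynomial (Fin n) ℤ) : ℕ :=
  ∑ i, bitSize (F i)

/-- The Zariski topology on `ℂⁿ`: closed sets are common zero sets of families of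
polynomials. -/
def zariskiTop (n : ℕ) : TopologicalSpace (Fin n → ℂ) :=
  TopologicalSpace.generateFrom
    {U | ∃ f : MvPolynomial (Fin n) ℂ, U = {x | MvPolynomial.eval x f ≠ 0}}

/-- The subspace (Zariski) topology on a subset of `ℂⁿ`. -/
def zariskiSub (n : ℕ) (Z : Set (Fin n → ℂ)) : TopologicalSpace Z :=
  TopologicalSpace.induced Subtype.val (zariskiTop n)

/-- The set of common complex zeros of a polynomial system. -/
def zeroSet {n k : ℕ} (F : Fin k → MvPolynomial (Fin n) ℤ) : Set (Fin n → ℂ) :=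
  {x | ∀ i, MvPolynomial.aeval x (F i) = 0}

end
end

local notation "MP" => MvPolynomial

section M1
open MvPolynomial
open Int (castRingHom)

lemma poly_factor_X {S : Type*} [CommRing S] (F : Polynomial S) (hF : F ≠ 0) :
    ∃ k Q, F = Polynomial.X ^ k * Q ∧ Q.coeff 0 ≠ 0 := by
  induction h : F.natDegree using Nat.strong_induction_on generalizing F with
  | _ d ih =>
    by_cases h0 : F.coeff 0 = 0
    · have hX : F = Polynomial.X * F.divX := by
        conv_lhs => rw [← Polynomial.divX_mul_X_add F, h0]
        simp [mul_comm]
      have hd : F.divX ≠ 0 := by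
        rintro h'
        rw [h'] at hX; simp at hX; exact hF hX
      have hlt : F.divX.natDegree < d := by
        rw [← h, Polynomial.natDegree_divX_eq_natDegree_tsub_one]
        have : F.natDegree ≠ 0 := by
          intro h1
          rw [Polynomial.eq_C_of_natDegree_eq_zero h1, h0] at hF
          simp at hF
        omega
      obtain ⟨k, Q, hQ, hQ0⟩ := ih _ hlt _ hd rfl
      exact ⟨k + 1, Q, by rw [hX, hQ]; ring, hQ0⟩
    · exact ⟨0, F, by simp, h0⟩

lemma max_mod (f : ℂ → ℂ) (hf : Differentiable ℂ f) (C : ℝ)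
    (h : ∀ z : ℂ, ‖z‖ = 1 → ‖f z‖ ≤ C) : ‖f 0‖ ≤ C := by
  have := Complex.norm_le_of_forall_mem_frontier_norm_le (f := f) (U := Metric.ball 0 1) (C := C)
    Metric.isBounded_ball hf.diffContOnCl (z := 0)
  refine this ?_ ?_
  · intro z hz
    rw [frontier_ball _ one_ne_zero] at hz
    exact h z (by simpa using hz)
  · exact subset_closure (by simp)

lemma int_poly_unit (p : Polynomial ℤ) (hp : p ≠ 0) :
    ∃ z : ℂ, ‖z‖ = 1 ∧ 1 ≤ ‖Polynomial.aeval z p‖ := by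
  obtain ⟨k, Q, rfl, hQ⟩ := poly_factor_X p hp
  by_contra! hcon
  have hs : IsCompact (Metric.sphere (0:ℂ) 1) := isCompact_sphere _ _
  have hc : ContinuousOn (fun z : ℂ => ‖Polynomial.aeval z Q‖) (Metric.sphere (0:ℂ) 1) :=
    (Polynomial.continuous_aeval Q).norm.continuousOn
  obtain ⟨w, hw, hmax⟩ := hs.exists_isMaxOn ⟨1, by simp⟩ hc
  have h1 := max_mod (fun z : ℂ => Polynomial.aeval z Q) (Polynomial.differentiable_aeval Q)
    (‖Polynomial.aeval w Q‖) (fun z hz => hmax (by simpa using hz))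
  have hw1 : ‖w‖ = 1 := by simpa using hw
  have h2 := hcon w hw1
  simp only [map_mul, map_pow, Polynomial.aeval_X, norm_mul, norm_pow, hw1, one_pow, one_mul] at h2
  have h3 : Polynomial.aeval (0:ℂ) Q = ((Q.coeff 0 : ℤ) : ℂ) := by
    simp [Polynomial.aeval_def, Polynomial.eval₂_at_zero]
  rw [h3, Complex.norm_intCast] at h1
  have : (1:ℝ) ≤ |(Q.coeff 0 : ℝ)| := by exact_mod_cast Int.one_le_abs hQ
  linarith

noncomputable abbrev ev {V : Type} {B : Type*} [CommRing B] (u : V → B) : MP V ℤ →+* B :=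
  eval₂Hom (castRingHom B) u

lemma hom_ev {V : Type} {B B' : Type*} [CommRing B] [CommRing B'] (h : B →+* B') (u : V → B)
    (P : MP V ℤ) : h (ev u P) = ev (fun v => h (u v)) P := by
  rw [← RingHom.comp_apply]
  congr 1
  apply MvPolynomial.ringHom_ext
  · intro r; simp
  · intro v; simp

lemma hom_eq_ev {V : Type} {B : Type*} [CommRing B] (h : MP V ℤ →+* B) :
    h = ev (fun v => h (X v)) := by
  apply MvPolynomial.ringHom_ext
  · intro r; simp
  · intro v; simp

lemma ev_X {V : Type} (P : MP V ℤ) : ev (fun v => (X v : MP V ℤ)) P = P := by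
  have := hom_eq_ev (RingHom.id (MP V ℤ))
  exact (congrArg (fun f => f P) this).symm

lemma ev_rename {V W : Type} {B : Type*} [CommRing B] (f : V → W) (u : W → B)
    (P : MP V ℤ) : ev u (rename f P) = ev (fun v => u (f v)) P := by
  simp only [ev, coe_eval₂Hom, eval₂_rename]; rfl

lemma ev_ev {V W : Type} {B : Type*} [CommRing B] (f : V → MP W ℤ) (u : W → B)
    (P : MP V ℤ) : ev u (ev f P) = ev (fun v => ev u (f v)) P := hom_ev _ _ _

variable {V : Type} [Fintype V]

lemma int_mv_unit (P : MP V ℤ) (hP : P ≠ 0) :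
    ∃ u : V → ℂ, (∀ v, ‖u v‖ ≤ 1) ∧ 1 ≤ ‖ev u P‖ := by
  classical
  have hinf : ∀ i : V, (Set.range (fun k : ℕ => (Polynomial.X : Polynomial ℤ) ^ k)).Infinite := by
    intro i
    apply Set.infinite_range_of_injective
    intro a b hab
    have := congrArg Polynomial.natDegree hab
    simpa using this
  have : ∃ k : V → ℕ, ev (fun v => (Polynomial.X : Polynomial ℤ) ^ (k v)) P ≠ 0 := by
    by_contra! hcon
    have h0 : MvPolynomial.map (Polynomial.C : ℤ →+* Polynomial ℤ) P = 0 := by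
      refine MvPolynomial.funext_set _ hinf ?_
      intro x hx
      choose k hk using fun v => hx v (Set.mem_univ v)
      rw [map_zero, eval_map]
      have := hcon k
      have hx' : x = (fun v => (Polynomial.X : Polynomial ℤ) ^ (k v)) := by
        funext v; exact (hk v).symm
      rw [hx', ← this]
      simp only [ev, coe_eval₂Hom]
      congr 1
    exact hP (MvPolynomial.map_injective _ (Polynomial.C_injective) (by rw [h0, map_zero]))
  obtain ⟨k, hk⟩ := this
  obtain ⟨z, hz, h1⟩ := int_poly_unit _ hk
  refine ⟨fun v => z ^ k v, fun v => by simp [hz], ?_⟩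
  have : ev (fun v => z ^ k v) P
      = Polynomial.aeval z (ev (fun v => (Polynomial.X : Polynomial ℤ) ^ (k v)) P) := by
    have := hom_ev (Polynomial.aeval (R := ℤ) z : Polynomial ℤ →+* ℂ)
      (fun v => (Polynomial.X : Polynomial ℤ) ^ (k v)) P
    simpa using this.symm
  rw [this]; exact h1

noncomputable def supS (P : MP V ℤ) : ℝ :=
  sSup ((fun u : V → ℂ => ‖ev u P‖) '' Metric.closedBall 0 1)

lemma cont_aeval (P : MP V ℤ) : Continuous (fun u : V → ℂ => ev u P) := by
  have : (fun u : V → ℂ => ev u P) = fun u => eval u (MvPolynomial.map (castRingHom ℂ) P) := by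
    funext u
    rw [eval_map]; rfl
  rw [this]
  exact MvPolynomial.continuous_eval _

lemma mem_cb (u : V → ℂ) : u ∈ Metric.closedBall (0 : V → ℂ) 1 ↔ ∀ v, ‖u v‖ ≤ 1 := by
  rw [mem_closedBall_zero_iff, pi_norm_le_iff_of_nonneg zero_le_one]

lemma supS_attained (P : MP V ℤ) :
    ∃ u : V → ℂ, (∀ v, ‖u v‖ ≤ 1) ∧ ‖ev u P‖ = supS P := by
  have hc : IsCompact (Metric.closedBall (0 : V → ℂ) 1) := isCompact_closedBall _ _
  obtain ⟨u, hu, h⟩ := hc.exists_sSup_image_eq ⟨0, by simp⟩ (cont_aeval P).norm.continuousOn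
  exact ⟨u, (mem_cb u).1 hu, h.symm⟩

lemma le_supS (P : MP V ℤ) (u : V → ℂ) (hu : ∀ v, ‖u v‖ ≤ 1) :
    ‖ev u P‖ ≤ supS P := by
  have hc : IsCompact (Metric.closedBall (0 : V → ℂ) 1) := isCompact_closedBall _ _
  exact le_csSup (hc.bddAbove_image (cont_aeval P).norm.continuousOn)
    ⟨u, (mem_cb u).2 hu, rfl⟩

lemma one_le_supS (P : MP V ℤ) (hP : P ≠ 0) : 1 ≤ supS P := by
  obtain ⟨u, hu, h⟩ := int_mv_unit P hP
  exact h.trans (le_supS P u hu)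

def IsBH {κ : Type} [Fintype κ] (g : V → κ) (δ : κ → ℕ) (P : MP V ℤ) : Prop :=
  ∀ (B : Type) [CommRing B] (c : κ → B) (u : V → B),
    ev (fun v => c (g v) * u v) P = (∏ b, c b ^ δ b) * ev u P

def IsHom (d : ℕ) (P : MP V ℤ) : Prop :=
  ∀ (B : Type) [CommRing B] (c : B) (u : V → B),
    ev (fun v => c * u v) P = c ^ d * ev u P

lemma IsBH.isHom {κ : Type} [Fintype κ] {g : V → κ} {δ : κ → ℕ} {P : MP V ℤ}
    (h : IsBH g δ P) : IsHom (∑ b, δ b) P := by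
  intro B _ c u
  rw [h B (fun _ => c) u, Finset.prod_pow_eq_pow_sum]

lemma IsBH.mul {κ : Type} [Fintype κ] {g : V → κ} {δ δ' : κ → ℕ} {P Q : MP V ℤ}
    (h : IsBH g δ P) (h' : IsBH g δ' Q) : IsBH g (δ + δ') (P * Q) := by
  intro B _ c u
  simp only [map_mul, h B c u, h' B c u, Pi.add_apply, pow_add, Finset.prod_mul_distrib]
  ring

lemma IsBH.prod {κ : Type} [Fintype κ] {g : V → κ} {I : Type} (s : Finset I) {δ : I → κ → ℕ}
    {P : I → MP V ℤ}
    (h : ∀ i ∈ s, IsBH g (δ i) (P i)) : IsBH g (∑ i ∈ s, δ i) (∏ i ∈ s, P i) := by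
  classical
  induction s using Finset.induction_on with
  | empty => intro B _ c u; simp
  | insert a s ha ih =>
    rw [Finset.sum_insert ha, Finset.prod_insert ha]
    exact (h a (by simp)).mul (ih fun i hi => h i (by simp [hi]))

lemma exists_int_ne_zero (Q : MP V ℤ) (hQ : Q ≠ 0) : ∃ u : V → ℤ, ev u Q ≠ 0 := by
  by_contra! h
  exact hQ (MvPolynomial.funext fun x => by simpa [aeval_def, eval₂_id] using h x)

lemma IsBH.le_of_dvd {κ : Type} [Fintype κ] {g : V → κ} {δ δ' : κ → ℕ} {P Q : MP V ℤ}
    (h : IsBH g δ P) (h' : IsBH g δ' Q) (hQ : Q ≠ 0) (hd : P ∣ Q) (b : κ) : δ b ≤ δ' b := by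
  classical
  obtain ⟨C', rfl⟩ := hd
  obtain ⟨u, hu⟩ := exists_int_ne_zero _ hQ
  set c : κ → Polynomial ℤ := fun b' => if b' = b then Polynomial.X else 1
  have hc : ∀ δ : κ → ℕ, ∏ b, c b ^ δ b = Polynomial.X ^ δ b := by
    intro δ
    rw [Finset.prod_eq_single b]
    · simp [c]
    · intro b' _ hb; simp [c, hb]
    · simp
  have e1 := h (Polynomial ℤ) c (fun v => Polynomial.C (u v))
  have e2 := h' (Polynomial ℤ) c (fun v => Polynomial.C (u v))
  rw [hc] at e1 e2
  rw [map_mul, e1] at e2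
  have e3 : ev (fun v => Polynomial.C (u v)) (P * C') = Polynomial.C (ev u (P * C')) := by
    have := (MvPolynomial.aeval_algebraMap_apply (A := ℤ) (Polynomial ℤ) u (P * C'))
    exact this
  rw [e3] at e2
  have e4 : (Polynomial.X : Polynomial ℤ) ^ δ b ∣ Polynomial.X ^ δ' b * Polynomial.C (ev u (P * C')) :=
    ⟨_, by rw [← e2, mul_assoc]⟩
  by_contra! hlt
  rw [Polynomial.X_pow_dvd_iff] at e4
  have := e4 (δ' b) hlt
  rw [mul_comm, Polynomial.coeff_C_mul_X_pow] at this
  simp at this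
  exact hu (by rw [map_mul]; exact mul_eq_zero.2 this)

lemma conj_aeval (P : MP V ℤ) (u : V → ℂ) :
    ev (fun v => (starRingEnd ℂ) (u v)) P = (starRingEnd ℂ) (ev u P) := by
  exact (hom_ev _ _ _).symm

lemma diff_line (P : MP V ℤ) (a b : V → ℂ) :
    Differentiable ℂ (fun z : ℂ => ev (fun v => a v + z * b v) P) := by
  induction P using MvPolynomial.induction_on with
  | C n => simp only [ev, eval₂Hom_C]; fun_prop
  | add p q hp hq => simp only [map_add]; exact hp.add hq
  | mul_X p v hp =>
    simp only [map_mul, ev, eval₂Hom_X']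
    exact hp.mul (by fun_prop)

lemma hom_bound {P : MP V ℤ} {d : ℕ} (h : IsHom d P) (R : ℝ) (hR : 0 < R)
    (u : V → ℂ) (hu : ∀ v, ‖u v‖ ≤ R) : ‖ev u P‖ ≤ R ^ d * supS P := by
  have hR' : (R : ℂ) ≠ 0 := by exact_mod_cast hR.ne'
  have e := h ℂ (R : ℂ) (fun v => (R : ℂ)⁻¹ * u v)
  have : (fun v => (R : ℂ) * ((R : ℂ)⁻¹ * u v)) = u := by
    funext v; rw [mul_inv_cancel_left₀ hR']
  rw [this] at e
  rw [e, norm_mul, norm_pow, Complex.norm_real, Real.norm_of_nonneg hR.le]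
  gcongr
  apply le_supS
  intro v
  rw [norm_mul, norm_inv, Complex.norm_real, Real.norm_of_nonneg hR.le]
  rw [inv_mul_le_iff₀ hR]; simpa using hu v

lemma bh_bound {κ : Type} [Fintype κ] {g : V → κ} {δ : κ → ℕ} {P : MP V ℤ}
    (h : IsBH g δ P) (R : κ → ℝ) (hR : ∀ b, 0 < R b)
    (u : V → ℂ) (hu : ∀ v, ‖u v‖ ≤ R (g v)) : ‖ev u P‖ ≤ (∏ b, R b ^ δ b) * supS P := by
  have hR' : ∀ b, (R b : ℂ) ≠ 0 := fun b => by exact_mod_cast (hR b).ne'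
  have e := h ℂ (fun b => (R b : ℂ)) (fun v => (R (g v) : ℂ)⁻¹ * u v)
  have : (fun v => (R (g v) : ℂ) * ((R (g v) : ℂ)⁻¹ * u v)) = u := by
    funext v; rw [mul_inv_cancel_left₀ (hR' _)]
  rw [this] at e
  rw [e, norm_mul, norm_prod]
  have e2 : ∏ b, ‖(R b : ℂ) ^ δ b‖ = ∏ b, R b ^ δ b := by
    refine Finset.prod_congr rfl fun b _ => ?_
    rw [norm_pow, Complex.norm_real, Real.norm_of_nonneg (hR b).le]
  rw [e2]
  have : 0 ≤ ∏ b, R b ^ δ b := Finset.prod_nonneg fun b _ => pow_nonneg (hR b).le _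
  gcongr
  apply le_supS
  intro v
  rw [norm_mul, norm_inv, Complex.norm_real, Real.norm_of_nonneg (hR _).le]
  rw [inv_mul_le_iff₀ (hR _)]; simpa using hu v

lemma gelfond {P C' : MP V ℤ} {p g : ℕ} (hP : IsHom p P) (hQ : IsHom g (P * C'))
    (hC : C' ≠ 0) : supS P ≤ 2 ^ g * supS (P * C') := by
  obtain ⟨w, hw, hwS⟩ := supS_attained P
  obtain ⟨u, hu, hu1⟩ := int_mv_unit C' hC
  have hb := max_mod (fun z : ℂ => ev (fun v => u v + z * (starRingEnd ℂ) (w v)) C' *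
    ev (fun v => w v + z * (starRingEnd ℂ) (u v)) P)
    ((diff_line C' _ _).mul (diff_line P _ _)) (2 ^ g * supS (P * C')) ?_
  · simp only [zero_mul, add_zero, norm_mul] at hb
    rw [← hwS]
    calc ‖ev w P‖ = 1 * ‖ev w P‖ := (one_mul _).symm
      _ ≤ ‖ev u C'‖ * ‖ev w P‖ := by gcongr
      _ ≤ _ := hb
  · intro z hz
    have e1 : ‖ev (fun v => w v + z * (starRingEnd ℂ) (u v)) P‖
        = ‖ev (fun v => u v + z * (starRingEnd ℂ) (w v)) P‖ := by
      have hzz : z * (starRingEnd ℂ) z = 1 := by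
        rw [Complex.mul_conj, Complex.normSq_eq_norm_sq, hz]; simp
      have : (fun v => w v + z * (starRingEnd ℂ) (u v))
          = (fun v => z * (starRingEnd ℂ) (u v + z * (starRingEnd ℂ) (w v))) := by
        funext v
        simp only [map_add, map_mul, Complex.conj_conj]
        linear_combination (-w v) * hzz
      rw [this, hP ℂ z (fun v => (starRingEnd ℂ) (u v + z * (starRingEnd ℂ) (w v))), conj_aeval]
      simp [hz]
    rw [norm_mul, e1, mul_comm, ← norm_mul, ← map_mul]
    apply hom_bound hQ 2 two_pos
    intro v
    calc _ ≤ ‖u v‖ + ‖z * (starRingEnd ℂ) (w v)‖ := norm_add_le _ _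
      _ ≤ 1 + 1 := by
        rw [norm_mul, hz, one_mul, Complex.norm_conj]; exact add_le_add (hu v) (hw v)
      _ = 2 := by norm_num

end M1

section M2
open MvPolynomial
open Finset (add_sum_erase mem_univ ne_of_mem_erase sum_congr univ)

lemma exists_prime_in_ker {R D : Type*} [CommRing R] [IsDomain R] [UniqueFactorizationMonoid R]
    [CommRing D] [IsDomain D] (h : R →+* D) (q : R) (hq : q ≠ 0) (hh : h q = 0) :
    ∃ p, Prime p ∧ h p = 0 ∧ p ∣ q := by
  obtain ⟨f, hf, u, hu⟩ := UniqueFactorizationMonoid.exists_prime_factors q hq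
  have h1 : h f.prod = 0 := by
    rw [← hu, map_mul] at hh
    exact (mul_eq_zero.1 hh).resolve_right (u.isUnit.map h).ne_zero
  rw [map_multiset_prod, Multiset.prod_eq_zero_iff, Multiset.mem_map] at h1
  obtain ⟨p, hp, hp0⟩ := h1
  exact ⟨p, hf p hp, hp0, (Multiset.dvd_prod hp).trans ⟨u, hu.symm⟩⟩

lemma principal_abs {R1 D : Type*} [CommRing R1] [IsDomain R1] [UniqueFactorizationMonoid R1]
    [CommRing D] [IsDomain D] (h : Polynomial R1 →+* D)
    (hinj : ∀ r, h (Polynomial.C r) = 0 → r = 0) (q0 : Polynomial R1) (hq0 : q0 ≠ 0)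
    (hh : h q0 = 0) : ∃ p, Prime p ∧ p.natDegree ≠ 0 ∧ ∀ q, h q = 0 ↔ p ∣ q := by
  classical
  letI : StrongNormalizationMonoid R1 := UniqueFactorizationMonoid.normalizationMonoid
  letI : NormalizedGCDMonoid R1 := UniqueFactorizationMonoid.toNormalizedGCDMonoid R1
  obtain ⟨p, hp, hp0, -⟩ := exists_prime_in_ker h q0 hq0 hh
  have hdeg : p.natDegree ≠ 0 := by
    intro hd
    rw [Polynomial.eq_C_of_natDegree_eq_zero hd] at hp0 hp
    rw [hinj _ hp0] at hp
    exact hp.ne_zero (by simp)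
  refine ⟨p, hp, hdeg, fun q => ⟨fun hq => ?_, fun ⟨c, hc⟩ => by rw [hc, map_mul, hp0, zero_mul]⟩⟩
  by_cases hq' : q = 0
  · rw [hq']; exact dvd_zero _
  have hprim : p.IsPrimitive := hp.irreducible.isPrimitive hdeg
  let K := FractionRing R1
  have hirr := (hprim.irreducible_iff_irreducible_map_fraction_map (K := K)).1 hp.irreducible
  let F := FractionRing D
  let j : R1 →+* F := (algebraMap D F).comp (h.comp Polynomial.C)
  have hj : Function.Injective j := by
    rw [injective_iff_map_eq_zero]
    intro r hr
    apply hinj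
    apply IsFractionRing.injective D F
    rw [map_zero]; exact hr
  let jK : K →+* F := IsFractionRing.lift hj
  let H : Polynomial K →+* F := Polynomial.eval₂RingHom jK (algebraMap D F (h Polynomial.X))
  have hH : ∀ r : Polynomial R1, H (r.map (algebraMap R1 K)) = algebraMap D F (h r) := by
    intro r
    have : H.comp (Polynomial.mapRingHom (algebraMap R1 K)) = (algebraMap D F).comp h := by
      apply Polynomial.ringHom_ext
      · intro a
        simp [H, jK, j]
      · simp [H]
    exact congrArg (fun f => f r) this
  have hdvd : p.map (algebraMap R1 K) ∣ q.map (algebraMap R1 K) := by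
    by_contra hnd
    have hcop := (hirr.coprime_iff_not_dvd).2 hnd
    obtain ⟨a, b, hab⟩ := hcop
    have := congrArg H hab
    simp [hH, hp0, hq] at this
  exact hprim.dvd_of_fraction_map_dvd_fraction_map hdvd

noncomputable def splitVar {V : Type} [DecidableEq V] (v0 : V) :
    MP V ℤ ≃+* Polynomial (MP {v : V // v ≠ v0} ℤ) :=
  ((renameEquiv ℤ (Equiv.optionSubtypeNe v0).symm).trans
    (optionEquivLeft ℤ {v : V // v ≠ v0})).toRingEquiv

lemma splitVar_rename {V : Type} [DecidableEq V] (v0 : V) (P : MP {v : V // v ≠ v0} ℤ) :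
    splitVar v0 (rename Subtype.val P) = Polynomial.C P := by
  have : ((splitVar v0 : MP V ℤ →+* _).comp
      (rename (R := ℤ) (Subtype.val : {v : V // v ≠ v0} → V)).toRingHom) = Polynomial.C := by
    apply MvPolynomial.ringHom_ext
    · intro r; simp [splitVar]
    · intro v
      simp [splitVar, Equiv.optionSubtypeNe_symm_of_ne v.2]
  exact congrArg (fun f => f P) this

lemma splitVar_symm_C {V : Type} [DecidableEq V] (v0 : V) (P : MP {v : V // v ≠ v0} ℤ) :
    (splitVar v0).symm (Polynomial.C P) = rename Subtype.val P := by
  rw [← splitVar_rename, RingEquiv.symm_apply_apply]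

lemma principal_mv {V D : Type} [DecidableEq V] [CommRing D] [IsDomain D] (v0 : V)
    (h : MP V ℤ →+* D)
    (hinj : ∀ P : MP {v : V // v ≠ v0} ℤ, h (rename Subtype.val P) = 0 → P = 0)
    (q0 : MP V ℤ) (hq0 : q0 ≠ 0) (hh : h q0 = 0) :
    ∃ p, Prime p ∧ ∀ q, h q = 0 ↔ p ∣ q := by
  obtain ⟨p, hp, -, hd⟩ := principal_abs (h.comp (splitVar v0).symm.toRingHom) (by
    intro r hr
    apply hinj
    rw [← splitVar_symm_C]; exact hr) (splitVar v0 q0) (by simpa using hq0) (by simpa using hh)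
  refine ⟨(splitVar v0).symm p, (MulEquiv.prime_iff (splitVar v0).symm).2 hp, fun q => ?_⟩
  have := hd (splitVar v0 q)
  simp at this
  rw [this]
  constructor
  · intro h'
    have := map_dvd (splitVar v0).symm h'
    simpa using this
  · intro h'
    have := map_dvd (splitVar v0) h'
    simpa using this

variable {ι τ : Type} [Fintype ι] [Fintype τ] [DecidableEq ι] [DecidableEq τ]
  {A : Type} [CommRing A] [IsDomain A] [CharZero A]

def InK (a : ι → τ → A) (P : MP (ι × τ) ℤ) : Prop :=
  ∀ (B : Type) [CommRing B] (h : A →+* B) (u : ι × τ → B),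
    (∀ b, ∑ s, h (a b s) * u (b, s) = 0) → ev u P = 0

noncomputable def gen (a : ι → τ → A) (s0 : τ) : ι × τ → MP (ι × τ) A := fun v =>
  if v.2 = s0 then - ∑ s ∈ univ.erase s0, C (a v.1 s) * X (v.1, s) else X v

lemma gen_rel (a : ι → τ → A) (s0 : τ) (ha : ∀ b, a b s0 = 1) (b : ι) :
    ∑ s, C (a b s) * gen a s0 (b, s) = 0 := by
  rw [← add_sum_erase _ _ (mem_univ s0), ha]
  have : ∑ s ∈ univ.erase s0, C (a b s) * gen a s0 (b, s)
      = ∑ s ∈ univ.erase s0, C (a b s) * X (b, s) :=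
    sum_congr rfl fun s hs => by
      simp [gen, ne_of_mem_erase hs]
  rw [this]
  simp [gen]

lemma inK_iff (a : ι → τ → A) (s0 : τ) (ha : ∀ b, a b s0 = 1) (P : MP (ι × τ) ℤ) :
    InK a P ↔ ev (gen a s0) P = 0 := by
  constructor
  · intro h
    exact h _ C _ (gen_rel a s0 ha)
  · intro h B _ f u hu
    have := hom_ev (eval₂Hom f u) (gen a s0) P
    rw [h, map_zero] at this
    rw [this]
    congr 2
    funext v
    obtain ⟨b, s⟩ := v
    by_cases hs : s = s0
    · subst hs
      have h2 := hu b
      rw [← add_sum_erase _ _ (mem_univ s), ha, map_one, one_mul] at h2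
      simp only [gen, if_true, map_neg, map_sum, map_mul, eval₂Hom_C, eval₂Hom_X']
      exact eq_neg_of_add_eq_zero_left h2
    · simp [gen, hs]

lemma inK_ind (a : ι → τ → A) (s0 : τ) (ha : ∀ b, a b s0 = 1) (i0 : ι) (J : ι → τ)
    (hJ : ∀ b, b ≠ i0 → J b ≠ s0)
    (hind : AlgebraicIndependent ℤ (fun b : {b : ι // b ≠ i0} => a b (J b)))
    (P : MP {v : ι × τ // v ≠ (i0, s0)} ℤ) (hP : InK a (rename Subtype.val P)) :
    P = 0 := by
  classical
  by_contra hP0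
  let V' := {v : ι × τ // v ≠ (i0, s0)}
  let e : ι × τ → ℤ := fun v => if v.1 ≠ i0 ∧ v.2 = J v.1 then -1 else 0
  let T : MP V' ℤ →+* Polynomial (MP V' ℤ) := ev fun v =>
    if v.1.2 = s0 then Polynomial.C (X v) else
      Polynomial.C (C (e v.1)) + Polynomial.X * Polynomial.C (X v)
  let back : Polynomial (MP V' ℤ) →+* MP V' ℤ :=
    Polynomial.eval₂RingHom (ev fun v => if v.1.2 = s0 then X v else X v - C (e v.1)) 1
  have hback : back (T P) = P := by
    have : back (T P) = ev (fun v => (X v : MP V' ℤ)) P := by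
      rw [hom_ev]
      congr 2
      funext v
      by_cases hv : v.1.2 = s0
      · simp [hv, back]
      · simp [hv, back]
    rw [this, ev_X]
  have hTP : T P ≠ 0 := by
    intro h
    rw [h, map_zero] at hback
    exact hP0 hback.symm
  obtain ⟨k, Q, hQ, hQ0⟩ := poly_factor_X _ hTP
  let sm : ι → MP (ι × τ) A := fun b =>
    ∑ s ∈ univ.erase s0, C (a b s) * X (b, s)
  let H0 : MP V' ℤ →+* Polynomial (MP (ι × τ) A) := ev fun v =>
    if v.1.2 = s0 then Polynomial.C (C (a v.1.1 (J v.1.1))) - Polynomial.X * Polynomial.C (sm v.1.1)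
    else Polynomial.C (X v.1)
  let H : Polynomial (MP V' ℤ) →+* Polynomial (MP (ι × τ) A) :=
    Polynomial.eval₂RingHom H0 Polynomial.X
  let u0 : ι × τ → Polynomial (MP (ι × τ) A) := fun v =>
    if v.2 = s0 then Polynomial.C (C (a v.1 (J v.1))) - Polynomial.X * Polynomial.C (sm v.1)
    else (e v : Polynomial (MP (ι × τ) A)) + Polynomial.X * Polynomial.C (X v)
  let hC : A →+* Polynomial (MP (ι × τ) A) := Polynomial.C.comp C
  let u : ι × τ → Polynomial (MP (ι × τ) A) := fun v =>
    if v = (i0, s0) then - ∑ s ∈ univ.erase s0, hC (a i0 s) * u0 (i0, s) else u0 v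
  have hrel : ∀ b, ∑ s, hC (a b s) * u (b, s) = 0 := by
    intro b
    rw [← add_sum_erase _ _ (mem_univ s0), ha, map_one, one_mul]
    have e1 : ∑ s ∈ univ.erase s0, hC (a b s) * u (b, s)
        = ∑ s ∈ univ.erase s0, hC (a b s) * u0 (b, s) :=
      sum_congr rfl fun s hs => by
        simp [u, ne_of_mem_erase hs]
    rw [e1]
    by_cases hb : b = i0
    · subst hb; simp [u]
    · have e2 : ∑ s ∈ univ.erase s0, hC (a b s) * u0 (b, s)
        = ∑ s ∈ univ.erase s0, hC (a b s) * (e (b, s) : Polynomial (MP (ι × τ) A))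
          + Polynomial.X * Polynomial.C (sm b) := by
        simp only [sm, map_sum, Finset.mul_sum, ← Finset.sum_add_distrib]
        refine sum_congr rfl fun s hs => ?_
        simp only [u0, ne_of_mem_erase hs, if_false, hC, RingHom.comp_apply, map_mul]
        ring
      rw [e2, Finset.sum_eq_single (J b)]
      · simp [u, hb, u0, e, hC]
        try ring
      · intro s _ hs; simp [e, hs]
      · intro h; exact absurd (Finset.mem_erase.2 ⟨hJ b hb, mem_univ _⟩) h
  have h1 := hP _ hC u hrel
  have h2 : H (T P) = 0 := by
    rw [ev_rename] at h1
    rw [← h1, hom_ev]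
    congr 2
    funext v
    by_cases hv : v.1.2 = s0
    · simp [hv, H, H0, u, u0, v.2]
    · have he : H (e v.1 : Polynomial (MP V' ℤ)) = e v.1 := map_intCast H _
      simp only [H, Polynomial.coe_eval₂RingHom] at he
      simp [hv, H, u, u0, v.2, he]
      simp [H0, hv]
  rw [hQ, map_mul, map_pow] at h2
  have h3 : H Q = 0 := by
    have : H Polynomial.X = Polynomial.X := by simp [H]
    rw [this] at h2
    exact (mul_eq_zero.1 h2).resolve_left (pow_ne_zero _ Polynomial.X_ne_zero)
  let g : V' → MP (ι × τ) A := fun v =>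
    if v.1.2 = s0 then C (a v.1.1 (J v.1.1)) else X v.1
  have h4 : ev g (Q.coeff 0) = 0 := by
    have hcomp : (Polynomial.constantCoeff : Polynomial (MP (ι × τ) A) →+* _).comp H
        = (ev g).comp Polynomial.constantCoeff := by
      apply Polynomial.ringHom_ext
      · intro r
        simp only [RingHom.comp_apply, H, Polynomial.coe_eval₂RingHom, Polynomial.eval₂_C, H0,
          Polynomial.constantCoeff_apply, Polynomial.coeff_C_zero]
        rw [← Polynomial.constantCoeff_apply, hom_ev]
        congr 2
        funext v
        by_cases hv : v.1.2 = s0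
        · simp [hv, g]
        · simp [hv, g]
      · simp [H]
    have := congrArg (fun f => f Q) hcomp
    simp only [RingHom.comp_apply, h3, map_zero] at this
    exact this.symm
  let Pv := {v : V' // v.1.2 = s0}
  let Nv := {v : V' // ¬ v.1.2 = s0}
  have hx : AlgebraicIndependent ℤ (fun v : Pv => a v.1.1.1 (J v.1.1.1)) := by
    refine hind.comp (fun v : Pv => (⟨v.1.1.1, fun h => v.1.2 (Prod.ext h v.2)⟩ : {b // b ≠ i0})) ?_
    intro v w hvw
    apply Subtype.ext; apply Subtype.ext
    exact Prod.ext (by simpa using hvw) (v.2.trans w.2.symm)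
  have hy : AlgebraicIndependent A (fun v : Nv => (X v.1.1 : MP (ι × τ) A)) :=
    (MvPolynomial.algebraicIndependent_X (ι × τ) A).comp (fun v : Nv => v.1.1)
      (fun v w h => Subtype.ext (Subtype.ext h))
  have hs := hx.sumElim_comp hy
  have hg : AlgebraicIndependent ℤ g := by
    have h5 := hs.comp ((Equiv.sumComm _ _).trans (Equiv.sumCompl (fun v : V' => v.1.2 = s0))).symm
      (Equiv.injective _)
    convert h5 using 1
    funext v
    by_cases hv : v.1.2 = s0
    · simp [hv, g, Equiv.sumCompl_symm_apply_of_pos]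
    · simp [hv, g, Equiv.sumCompl_symm_apply_of_neg]
  apply hQ0
  apply (injective_iff_map_eq_zero (aeval g : MP V' ℤ →ₐ[ℤ] _)).1 hg
  rw [← h4, aeval_def]
  congr 1

end M2

section M3
open MvPolynomial
open Finset (mul_sum sum_congr univ)
open Function (Injective)
variable {ι τ : Type} [Fintype ι] [Fintype τ] [DecidableEq ι] [DecidableEq τ]
  {A : Type} [CommRing A] [IsDomain A] [CharZero A]

noncomputable def spec (i0 : ι) (w : τ → ℤ) (v : ι × τ) : MP {v : ι × τ // v.1 ≠ i0} ℤ :=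
  if h : v.1 = i0 then C (w v.2) else X ⟨v, h⟩

lemma gen_inj (a : ι → τ → A) (s0 : τ) (ha : ∀ b, a b s0 = 1) (i0 : ι) (J : ι → τ)
    (hJ : ∀ b, b ≠ i0 → J b ≠ s0)
    (hind : AlgebraicIndependent ℤ (fun b : {b : ι // b ≠ i0} => a b (J b)))
    (P : MP {v : ι × τ // v.1 ≠ i0} ℤ)
    (hP : ev (fun v => gen a s0 v.1) P = 0) : P = 0 := by
  have h1 : rename (fun v : {v : ι × τ // v.1 ≠ i0} =>
      (⟨v.1, fun h => v.2 (by rw [h])⟩ : {v : ι × τ // v ≠ (i0, s0)})) P = 0 := by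
    apply inK_ind a s0 ha i0 J hJ hind
    rw [rename_rename, inK_iff a s0 ha, ev_rename]
    exact hP
  refine (rename_injective (fun v : {v : ι × τ // v.1 ≠ i0} =>
      (⟨v.1, fun h => v.2 (by rw [h])⟩ : {v : ι × τ // v ≠ (i0, s0)})) (fun v w h => ?_))
      (by rw [h1, map_zero])
  apply Subtype.ext; simpa using h

lemma gen_alg (a : ι → τ → A) (s0 : τ) (ha : ∀ b, a b s0 = 1) (i0 : ι) (J : ι → τ)
    (hJ : ∀ b, b ≠ i0 → J b ≠ s0)
    (hind : IsTranscendenceBasis ℤ (fun b : {b : ι // b ≠ i0} => a b (J b))) (y : A) :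
    ∃ q : Polynomial (MP {v : ι × τ // v.1 ≠ i0} ℤ), q ≠ 0 ∧
      q.eval₂ (ev (fun v => gen a s0 v.1)) (C y) = 0 := by
  classical
  let V1 := {v : ι × τ // v.1 ≠ i0}
  let V2 := {v : V1 // v.1.2 ≠ s0}
  let D := MP V2 A
  let inc : D →+* MP (ι × τ) A := (rename (fun v : V2 => v.1.1)).toRingHom
  have hinc : Injective inc := rename_injective _ (fun v w h => Subtype.ext (Subtype.ext h))
  have hincC : ∀ y : A, inc (C y) = C y := fun y => rename_C _ y
  have hincX : ∀ v : V2, inc (X v) = X v.1.1 := fun y => rename_X _ y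
  let g : V1 → D := fun v => if h : v.1.2 = s0 then
    - ∑ s : {s : τ // s ≠ s0}, C (a v.1.1 s) * X ⟨⟨(v.1.1, s.1), v.2⟩, s.2⟩ else X ⟨v, h⟩
  have hg : ∀ v, inc (g v) = gen a s0 v.1 := by
    intro v
    by_cases h : v.1.2 = s0
    · simp only [g, dif_pos h, gen, if_pos h, map_neg, map_sum, map_mul]
      congr 1
      rw [← Finset.sum_subtype_of_mem (p := fun s => s ≠ s0)
        (f := fun s => (C (a v.1.1 s) * X (v.1.1, s) : MP (ι × τ) A)) (by simp)]
      have : Finset.subtype (fun s => s ≠ s0) (univ.erase s0) = univ := by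
        ext s; simp [s.2]
      rw [this]
      refine sum_congr rfl fun s _ => ?_
      rw [hincC, hincX]
    · simp only [g, h, gen, dif_neg, if_false, not_false_eq_true]
      rw [hincX]
  have hgi : AlgebraicIndependent ℤ g := by
    rw [AlgebraicIndependent, injective_iff_map_eq_zero]
    intro P hP
    apply gen_inj a s0 ha i0 J hJ hind.1
    have : inc (ev g P) = 0 := by
      rw [show ev g P = 0 from ?_, map_zero]
      rw [← hP, aeval_def]; congr 1
    rw [hom_ev] at this
    simpa only [hg] using this
  have hb := hind.sumElim_comp (IsTranscendenceBasis.mvPolynomial V2 A)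
  have hcard := hb.cardinalMk_eq_trdeg
  have hbas : IsTranscendenceBasis ℤ g := by
    apply hgi.isTranscendenceBasis_of_trdeg_le_of_finite
    rw [← hcard]
    rw [Cardinal.mk_fintype, Cardinal.mk_fintype]
    norm_cast
    have : Injective (fun x : V2 ⊕ {b : ι // b ≠ i0} =>
        (Sum.elim (fun v => v.1) (fun b => ⟨(b.1, s0), b.2⟩) x : V1)) := by
      rintro (x | x) (y | y) h
      · simp at h; rw [Subtype.ext h]
      · exfalso; simp at h; apply x.2; rw [h]
      · exfalso; simp at h; apply y.2; rw [← h]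
      · simp at h; have := congrArg (fun v : V1 => v.1.1) h; simp at this; rw [Subtype.ext this]
    exact Fintype.card_le_of_injective _ this
  have halg := hbas.isAlgebraic
  obtain ⟨q, hq, hq0⟩ := halg.isAlgebraic (C y : D)
  let e := hgi.aevalEquiv
  refine ⟨q.map e.symm.toRingEquiv.toRingHom, ?_, ?_⟩
  · intro h
    apply hq
    exact Polynomial.map_injective _ e.symm.injective (by simpa using h)
  · rw [Polynomial.eval₂_map]
    have h2 := congrArg inc hq0
    rw [map_zero, Polynomial.aeval_def, Polynomial.hom_eval₂] at h2
    rw [← h2]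
    rw [hincC]
    congr 1
    have key : (ev fun v : V1 => gen a s0 v.1) =
        (inc.comp (algebraMap (Algebra.adjoin ℤ (Set.range g)) D)).comp e.toRingEquiv.toRingHom := by
      apply MvPolynomial.ringHom_ext
      · intro r; simp
      · intro v
        simp [e]
        rw [← hg]
    rw [key]
    ext z
    simp

set_option maxHeartbeats 800000 in
lemma exists_Q (a : ι → τ → A) (s0 : τ) (ha : ∀ b, a b s0 = 1) (i0 : ι) (J : ι → τ)
    (hJ : ∀ b, b ≠ i0 → J b ≠ s0)
    (hind : IsTranscendenceBasis ℤ (fun b : {b : ι // b ≠ i0} => a b (J b))) :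
    ∃ Q : MP (ι × τ) ℤ, InK a Q ∧
      ∀ w : τ → ℤ, ∑ s, (w s : A) * a i0 s ≠ 0 → ev (spec i0 w) Q ≠ 0 := by
  classical
  let R := MP {v : ι × τ // v.1 ≠ i0} ℤ
  let D := MP (ι × τ) A
  let F := FractionRing D
  let L := FractionRing R
  let r0 : R →+* F := (algebraMap D F).comp (ev fun v => gen a s0 v.1)
  have hr0 : Injective r0 := by
    rw [injective_iff_map_eq_zero]
    intro P hP
    apply gen_inj a s0 ha i0 J hJ hind.1
    apply IsFractionRing.injective D F
    rw [map_zero]; exact hP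
  letI : Algebra L F := (IsFractionRing.lift hr0 : L →+* F).toAlgebra
  have hLF : ∀ r : R, algebraMap L F (algebraMap R L r) = r0 r := fun r =>
    IsFractionRing.lift_algebraMap hr0 r
  let y : τ → F := fun s => algebraMap D F (C (a i0 s))
  have hy : ∀ s, IsIntegral L (y s) := by
    intro s
    obtain ⟨q, hq, hq0⟩ := gen_alg a s0 ha i0 J hJ hind (a i0 s)
    apply IsAlgebraic.isIntegral
    refine ⟨q.map (algebraMap R L), ?_, ?_⟩
    · intro h
      exact hq (Polynomial.map_injective _ (IsFractionRing.injective R L) (by simpa using h))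
    · rw [Polynomial.aeval_def, Polynomial.eval₂_map]
      have h2 := congrArg (algebraMap D F) hq0
      rw [map_zero, Polynomial.hom_eval₂] at h2
      rw [← h2]
      congr 1
      exact RingHom.ext fun r => hLF r
  let E := IntermediateField.adjoin L (Set.range y)
  haveI : FiniteDimensional L E :=
    IntermediateField.finiteDimensional_adjoin (by rintro x ⟨s, rfl⟩; exact hy s)
  haveI : Module.Free L E := Module.Free.of_divisionRing L E
  let yE : τ → E := fun s => ⟨y s, IntermediateField.subset_adjoin L _ ⟨s, rfl⟩⟩
  let bas := Module.finBasis L E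
  let N := Module.finrank L E
  let M : τ → Matrix (Fin N) (Fin N) L := fun s => Algebra.leftMulMatrix bas (yE s)
  obtain ⟨ρ, hρ⟩ := IsLocalization.exist_integer_multiples_of_finite (nonZeroDivisors R)
    (fun x : τ × Fin N × Fin N => M x.1 x.2.1 x.2.2)
  have hρ0 : (ρ : R) ≠ 0 := nonZeroDivisors.ne_zero ρ.2
  choose m hm using hρ
  let M' : τ → Matrix (Fin N) (Fin N) R := fun s => Matrix.of fun i j => m (s, i, j)
  have hM' : ∀ s, (M' s).map (algebraMap R L) = algebraMap R L ρ • M s := by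
    intro s
    ext i j
    have := hm (s, i, j)
    simp only [Matrix.map_apply, M', Matrix.of_apply, this, Matrix.smul_apply, smul_eq_mul]
    rw [Algebra.smul_def]
  let rn : R →+* MP (ι × τ) ℤ := (rename Subtype.val).toRingHom
  let Q : MP (ι × τ) ℤ := (∑ s, (X (i0, s) : MP (ι × τ) ℤ) • (M' s).map rn).det
  have hQ : ∀ (B : Type) [CommRing B] (u : ι × τ → B),
      ev u Q = (∑ s, u (i0, s) • (M' s).map (ev (fun v => u v.1))).det := by
    intro B _ u
    rw [RingHom.map_det]
    congr 1
    ext i j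
    simp only [RingHom.mapMatrix_apply, Matrix.map_apply, Matrix.sum_apply, map_sum,
      Matrix.smul_apply, smul_eq_mul, map_mul]
    refine sum_congr rfl fun s _ => ?_
    congr 1
    · simp
    · exact ev_rename _ _ _
  refine ⟨Q, ?_, ?_⟩
  · rw [inK_iff a s0 ha]
    apply IsFractionRing.injective D F
    rw [map_zero, hom_ev, hQ]
    rw [← Matrix.exists_vecMul_eq_zero_iff]
    let β : Fin N → F := fun i => (bas i : F)
    have hN : 0 < N := Module.finrank_pos
    refine ⟨β, ?_, ?_⟩
    · intro h
      have := congrFun h ⟨0, hN⟩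
      simp only [β, Pi.zero_apply] at this
      exact bas.ne_zero ⟨0, hN⟩ (Subtype.ext this)
    · have hmul : ∀ s j, ∑ i, β i * (algebraMap L F) (M s i j) = y s * β j := by
        intro s j
        have h3 : yE s * bas j = ∑ i, M s i j • bas i := by
          simp only [M, Algebra.leftMulMatrix_eq_repr_mul]
          exact (bas.sum_repr (yE s * bas j)).symm
        have h4 := congrArg (fun x : E => (x : F)) h3
        simp only [IntermediateField.coe_mul, IntermediateField.coe_sum] at h4
        rw [show y s * β j = (yE s : F) * (bas j : F) from rfl, h4]
        refine sum_congr rfl fun i _ => ?_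
        rw [IntermediateField.coe_smul, Algebra.smul_def, mul_comm]
      have hent : ∀ s i j, (ev fun v : {v : ι × τ // v.1 ≠ i0} => algebraMap D F (gen a s0 v.1))
          (M' s i j) = r0 ρ * algebraMap L F (M s i j) := by
        intro s i j
        rw [← hom_ev (algebraMap D F) (fun v : {v : ι × τ // v.1 ≠ i0} => gen a s0 v.1)]
        have h5 := congrFun (congrFun (hM' s) i) j
        have h6 := congrArg (algebraMap L F) h5
        simp only [Matrix.map_apply, Matrix.smul_apply, smul_eq_mul, map_mul, hLF] at h6
        exact h6
      funext j
      simp only [Matrix.vecMul, dotProduct, Matrix.sum_apply, Matrix.smul_apply, Matrix.map_apply,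
        smul_eq_mul, hent, mul_sum, Pi.zero_apply]
      rw [Finset.sum_comm]
      have h7 : ∀ s, ∑ i, β i * (algebraMap D F (gen a s0 (i0, s)) * (r0 ρ * algebraMap L F (M s i j)))
          = r0 ρ * β j * algebraMap D F (C (a i0 s) * gen a s0 (i0, s)) := by
        intro s
        have : ∀ i, β i * (algebraMap D F (gen a s0 (i0, s)) * (r0 ρ * algebraMap L F (M s i j)))
          = (algebraMap D F (gen a s0 (i0, s)) * r0 ρ) * (β i * algebraMap L F (M s i j)) := by
          intro i; ring
        simp only [this]
        rw [← mul_sum, hmul, map_mul]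
        simp only [y]; ring
      rw [sum_congr rfl fun s _ => h7 s, ← mul_sum, ← map_sum,
        gen_rel a s0 ha i0, map_zero, mul_zero]
  · intro w hw h0
    have h1 := congrArg (algebraMap R L) h0
    rw [map_zero, hQ] at h1
    have hid : (ev fun v : {v : ι × τ // v.1 ≠ i0} => spec i0 w v.1) = RingHom.id R := by
      apply MvPolynomial.ringHom_ext
      · intro r; simp
      · intro v; simp [spec, v.2]; rfl
    rw [hid, RingHom.map_det] at h1
    have h2 : (algebraMap R L).mapMatrix (∑ s, spec i0 w (i0, s) • (M' s).map (RingHom.id R))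
        = algebraMap R L ρ • Algebra.leftMulMatrix bas (∑ s, (w s : E) * yE s) := by
      have hsum : Algebra.leftMulMatrix bas (∑ s, (w s : E) * yE s) = ∑ s, (w s : L) • M s := by
        rw [map_sum]
        refine sum_congr rfl fun s _ => ?_
        have : (w s : E) * yE s = (w s : L) • yE s := by
          rw [Algebra.smul_def, map_intCast]
        rw [this, map_smul]
      rw [hsum, map_sum, Finset.smul_sum]
      refine sum_congr rfl fun s _ => ?_
      ext i j
      have h5 := congrFun (congrFun (hM' s) i) j
      simp only [Matrix.map_apply, Matrix.smul_apply, smul_eq_mul] at h5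
      simp only [RingHom.mapMatrix_apply, Matrix.map_apply, Matrix.smul_apply, smul_eq_mul,
        map_mul, RingHom.id_apply, h5]
      simp [spec]
      ring
    rw [h2, Matrix.det_smul, ← Algebra.norm_eq_matrix_det] at h1
    rcases mul_eq_zero.1 h1 with h3 | h3
    · exact hρ0 (IsFractionRing.injective R L (by rw [map_zero]; exact eq_zero_of_pow_eq_zero h3))
    · rw [Algebra.norm_eq_zero_iff] at h3
      have h4 := congrArg (fun x : E => (x : F)) h3
      simp only [IntermediateField.coe_sum, IntermediateField.coe_mul] at h4
      apply hw
      apply C_injective (ι × τ) A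
      apply IsFractionRing.injective D F
      rw [map_zero, map_zero, map_sum, map_sum]
      simp only [map_mul, map_intCast]
      simpa [yE, y] using h4

end M3

section M4
open MvPolynomial
open Finset (mul_sum prod_congr prod_mul_distrib prod_pow_eq_pow_sum sum_congr univ)
open Function (Injective)

lemma exists_split {σ W : Type} (f : σ → W) (hf : Injective f) :
    ∃ (rest : Type) (j : rest → W) (Θ : MP W ℤ ≃+* MP rest (MP σ ℤ)),
      (∀ P, Θ (rename f P) = C P) ∧ (∀ w, (∃ v, f v = w) ∨ ∃ r, j r = w) ∧
      (∀ r, Θ (X (j r)) = X r) ∧ (∀ r v, j r ≠ f v) ∧ Injective j := by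
  classical
  let rest := {w // w ∉ Set.range f}
  let e : rest ⊕ σ ≃ W := (Equiv.sumComm _ _).trans
    ((Equiv.sumCongr (Equiv.ofInjective f hf) (Equiv.refl _)).trans (Equiv.Set.sumCompl (Set.range f)))
  have hel : ∀ r : rest, e (Sum.inl r) = r.1 := fun r => rfl
  have her : ∀ v, e (Sum.inr v) = f v := fun r => rfl
  let Θ := ((renameEquiv ℤ e.symm).trans (sumAlgEquiv ℤ rest σ)).toRingEquiv
  have h1 : ∀ v, Θ (X (f v)) = C (X v) := by
    intro v
    have : e.symm (f v) = Sum.inr v := by rw [← her, Equiv.symm_apply_apply]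
    simp [Θ, this]
  have h2 : ∀ r : rest, Θ (X r.1) = X r := by
    intro v
    have : e.symm v.1 = Sum.inl v := by rw [← hel, Equiv.symm_apply_apply]
    simp [Θ, this]
  refine ⟨rest, Subtype.val, Θ, ?_, ?_, h2, ?_, Subtype.val_injective⟩
  · intro P
    have : Θ.toRingHom.comp (rename (R := ℤ) f).toRingHom = C := by
      apply MvPolynomial.ringHom_ext
      · intro r; simp
      · intro v; simpa using h1 v
    exact congrArg (fun F => F P) this
  · intro w
    by_cases h : w ∈ Set.range f
    · exact Or.inl h
    · exact Or.inr ⟨⟨w, h⟩, rfl⟩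
  · intro r v h; exact r.2 ⟨v, h.symm⟩

lemma prime_rename_inj {σ W : Type} (f : σ → W) (hf : Injective f) (P : MP σ ℤ)
    (hP : Prime P) : Prime (rename f P) := by
  obtain ⟨rest, j, Θ, h1, -⟩ := exists_split f hf
  rw [← MulEquiv.prime_iff Θ, h1]
  exact (prime_C_iff _).2 hP

lemma coeff_scale {V : Type} [Fintype V] (c : V → ℤ) (P : MP V ℤ) (m : V →₀ ℕ) :
    coeff m (ev (fun v => C (c v) * X v) P : MP V ℤ) = (∏ v, c v ^ m v) * coeff m P := by
  classical
  induction P using MvPolynomial.induction_on' with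
  | monomial k r =>
    have : (ev (fun v => C (c v) * X v) (monomial k r) : MP V ℤ)
        = monomial k ((∏ v, c v ^ k v) * r) := by
      rw [ev, coe_eval₂Hom, eval₂_monomial, Finsupp.prod_fintype _ _ (by simp)]
      simp only [mul_pow, prod_mul_distrib, ← map_pow, ← map_prod]
      rw [monomial_eq, Finsupp.prod_fintype _ _ (by simp)]
      simp [map_mul]; ring
    rw [this, coeff_monomial, coeff_monomial]
    split_ifs with h
    · rw [h]
    · simp
  | add p q hp hq => rw [map_add, coeff_add, hp, hq, coeff_add, mul_add]

lemma isBH_of_support {V κ : Type} [Fintype V] [Fintype κ] [DecidableEq κ] (g : V → κ) (δ : κ → ℕ)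
    (P : MP V ℤ)
    (h : ∀ m ∈ P.support, ∀ b, ∑ v ∈ univ.filter (fun v => g v = b), m v = δ b) :
    IsBH g δ P := by
  intro B _ c u
  simp only [ev, coe_eval₂Hom, eval₂_eq']
  rw [mul_sum]
  refine sum_congr rfl fun m hm => ?_
  simp only [mul_pow, prod_mul_distrib]
  have : ∏ v, c (g v) ^ m v = ∏ b, c b ^ δ b := by
    rw [← Finset.prod_fiberwise (s := univ) (g := g)]
    refine prod_congr rfl fun b _ => ?_
    rw [← h m hm b, ← prod_pow_eq_pow_sum]
    refine prod_congr rfl fun v hv => ?_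
    rw [(Finset.mem_filter.1 hv).2]
  rw [this]; ring

variable {ι τ : Type} [Fintype ι] [Fintype τ] [DecidableEq ι] [DecidableEq τ]
  {A : Type} [CommRing A] [IsDomain A] [CharZero A]

def IsGen (a : ι → τ → A) (P : MP (ι × τ) ℤ) : Prop :=
  Prime P ∧ ∀ Q, InK a Q ↔ P ∣ Q

lemma exists_gen (a : ι → τ → A) (s0 : τ) (ha : ∀ b, a b s0 = 1) (i0 : ι) (J : ι → τ)
    (hJ : ∀ b, b ≠ i0 → J b ≠ s0)
    (hind : IsTranscendenceBasis ℤ (fun b : {b : ι // b ≠ i0} => a b (J b))) :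
    ∃ P, IsGen a P := by
  obtain ⟨Q, hQ, hQ'⟩ := exists_Q a s0 ha i0 J hJ hind
  have hQ0 : Q ≠ 0 := by
    rintro rfl
    refine hQ' (fun s => if s = s0 then 1 else 0) ?_ (map_zero _)
    simp [ha]
  obtain ⟨p, hp, hp'⟩ := principal_mv (i0, s0) (ev (gen a s0)) (fun P hP =>
    inK_ind a s0 ha i0 J hJ hind.1 P ((inK_iff a s0 ha _).2 hP)) Q hQ0 ((inK_iff a s0 ha _).1 hQ)
  exact ⟨p, hp, fun q => by rw [inK_iff a s0 ha, hp']⟩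

lemma IsGen.spec_ne {a : ι → τ → A} {P : MP (ι × τ) ℤ} (hP : IsGen a P)
    (s0 : τ) (ha : ∀ b, a b s0 = 1) (i0 : ι) (J : ι → τ)
    (hJ : ∀ b, b ≠ i0 → J b ≠ s0)
    (hind : IsTranscendenceBasis ℤ (fun b : {b : ι // b ≠ i0} => a b (J b)))
    (w : τ → ℤ) (hw : ∑ s, (w s : A) * a i0 s ≠ 0) : ev (spec i0 w) P ≠ 0 := by
  obtain ⟨Q, hQ, hQ'⟩ := exists_Q a s0 ha i0 J hJ hind
  obtain ⟨R, rfl⟩ := (hP.2 Q).1 hQ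
  intro h
  exact hQ' w hw (by rw [map_mul, h, zero_mul])

lemma InK.scale {a : ι → τ → A} {P : MP (ι × τ) ℤ} (hP : InK a P) (c : ι → ℤ) :
    InK a (ev (fun v => C (c v.1) * X v) P) := by
  intro B _ h u hu
  rw [ev_ev]
  apply hP B h
  intro b
  have := congrArg (fun x => (c b : B) * x) (hu b)
  simp only [mul_zero, mul_sum] at this
  rw [← this]
  refine sum_congr rfl fun s _ => ?_
  have e1 : ev u (C (c b) * X (b, s)) = (c b : B) * u (b, s) := by
    rw [map_mul, ev, eval₂Hom_C, eval₂Hom_X']; rfl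
  rw [e1]; ring

lemma IsGen.exists_isBH {a : ι → τ → A} {P : MP (ι × τ) ℤ} (hP : IsGen a P) :
    ∃ δ : ι → ℕ, IsBH Prod.fst δ P := by
  have hP0 : P ≠ 0 := hP.1.ne_zero
  have key : ∀ b, ∃ k : ℕ, ∀ m ∈ P.support,
      ∑ v ∈ univ.filter (fun v : ι × τ => v.1 = b), m v = k := by
    intro b
    let c : ι → ℤ := fun b' => if b' = b then 2 else 1
    obtain ⟨q, hq⟩ := (hP.2 _).1 (((hP.2 P).2 dvd_rfl).scale c)
    have hco : ∀ m, coeff m (P * q) =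
        2 ^ (∑ v ∈ univ.filter (fun v : ι × τ => v.1 = b), m v) * coeff m P := by
      intro m
      rw [← hq, coeff_scale]
      congr 1
      simp only [c, ite_pow, one_pow]
      rw [← Finset.prod_filter, prod_pow_eq_pow_sum]
    have hq0 : q ≠ 0 := by
      rintro rfl
      obtain ⟨m, hm⟩ := ne_zero_iff.1 hP0
      have := hco m
      simp [hm] at this
    have hdeg : q.totalDegree = 0 := by
      have h1 := totalDegree_mul_of_isDomain hP0 hq0
      have h2 : (P * q).totalDegree ≤ P.totalDegree := by
        apply totalDegree_le_of_support_subset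
        intro m hm
        rw [mem_support_iff, hco] at hm
        rw [mem_support_iff]
        exact right_ne_zero_of_mul hm
      omega
    rw [totalDegree_eq_zero_iff_eq_C] at hdeg
    obtain ⟨m0, hm0⟩ := support_nonempty.2 hP0
    refine ⟨_, fun m hm => (?_ : _ = ∑ v ∈ univ.filter (fun v : ι × τ => v.1 = b), m0 v)⟩
    have h3 : ∀ m ∈ P.support,
        (2 : ℤ) ^ (∑ v ∈ univ.filter (fun v : ι × τ => v.1 = b), m v) = coeff 0 q := by
      intro m hm
      have := hco m
      rw [hdeg, mul_comm P, coeff_C_mul] at this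
      exact (mul_right_cancel₀ (mem_support_iff.1 hm) this).symm
    have h4 := (h3 m hm).trans (h3 m0 hm0).symm
    exact Int.pow_right_injective (by norm_num) h4
  choose δ hδ using key
  exact ⟨δ, isBH_of_support _ _ _ fun m hm b => hδ b m hm⟩

lemma IsGen.symm {a : ι → τ → A} {P : MP (ι × τ) ℤ} (hP : IsGen a P)
    {δ : ι → ℕ} (hδ : IsBH Prod.fst δ P) (b b' : ι) (h : a b = a b') : δ b ≤ δ b' := by
  let π := Equiv.swap b b'
  have hπ : ∀ x, a (π x) = a x := by
    intro x
    rcases Equiv.swap_apply_eq_iff.1 (rfl : π x = π x) with _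
    by_cases h1 : x = b
    · subst h1; simp [π, h]
    · by_cases h2 : x = b'
      · subst h2; simp [π, h]
      · simp [π, Equiv.swap_apply_of_ne_of_ne h1 h2]
  let f : ι × τ → ι × τ := fun v => (π v.1, v.2)
  have hf : Injective f := by
    rintro ⟨x, s⟩ ⟨y, t⟩ hxy
    simpa [f] using hxy
  have h1 : InK a (rename f P) := by
    intro B _ φ u hu
    rw [ev_rename]
    apply (hP.2 P).2 dvd_rfl B φ
    intro x
    have := hu (π x)
    rwa [hπ] at this
  have h2 : IsBH Prod.fst (fun x => δ (π x)) (rename f P) := by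
    intro B _ c u
    rw [ev_rename, ev_rename]
    have := hδ B (fun x => c (π x)) (fun v => u (f v))
    rw [this]
    congr 1
    rw [← Equiv.prod_comp π (fun x => c x ^ δ (π x))]
    refine prod_congr rfl fun x _ => ?_
    simp [π]
  have := hδ.le_of_dvd h2 ((map_ne_zero_iff _ (rename_injective f hf)).2 hP.1.ne_zero)
    ((hP.2 _).1 h1) b
  simpa [π] using this

lemma IsGen.dvd_of_vanish {a : ι → τ → A} {P : MP (ι × τ) ℤ} (hP : IsGen a P)
    (s0 : τ) (ha : ∀ b, a b s0 = 1) {W : Type} (f : ι × τ → W) (hf : Injective f)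
    (G : MP W ℤ)
    (hG : ∀ (B : Type) [CommRing B] (h : A →+* B) (u : W → B),
      (∀ b, ∑ s, h (a b s) * u (f (b, s)) = 0) → ev u G = 0) : rename f P ∣ G := by
  obtain ⟨rest, j, Θ, h1, h2, h3, h4, h5⟩ := exists_split f hf
  suffices C P ∣ Θ G by
    have := map_dvd Θ.symm this
    rwa [← h1, RingEquiv.symm_apply_apply, RingEquiv.symm_apply_apply] at this
  rw [C_dvd_iff_dvd_coeff]
  intro m
  rw [← hP.2, inK_iff a s0 ha]
  classical
  let B := MP rest (MP (ι × τ) A)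
  let h : A →+* B := C.comp C
  let Ξ : MP rest (MP (ι × τ) ℤ) →+* B := MvPolynomial.map (ev (gen a s0))
  let u : W → B := fun w => Ξ (Θ (X w))
  have hu : ev u G = Ξ (Θ G) := by
    have := hom_eq_ev (Ξ.comp Θ.toRingHom)
    exact (congrArg (fun F => F G) this).symm
  have hr := hG B h u (fun b => by
    have : ∀ s, u (f (b, s)) = C (gen a s0 (b, s)) := by
      intro s
      have := h1 (X (b, s))
      rw [rename_X] at this
      simp only [u, this]
      exact (map_C _ _).trans (by rw [ev, eval₂Hom_X'])
    simp only [this, h, RingHom.comp_apply, ← map_mul, ← map_sum, gen_rel a s0 ha b, map_zero])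
  rw [hu] at hr
  have := congrArg (coeff m) hr
  rwa [coeff_map, coeff_zero] at this

lemma IsGen.pos {a : ι → τ → A} {P : MP (ι × τ) ℤ} (hP : IsGen a P)
    (s0 : τ) (ha : ∀ b, a b s0 = 1) (i0 : ι) (J : ι → τ)
    (hJ : ∀ b, b ≠ i0 → J b ≠ s0)
    (hind : IsTranscendenceBasis ℤ (fun b : {b : ι // b ≠ i0} => a b (J b)))
    {δ : ι → ℕ} (hδ : IsBH Prod.fst δ P) : 0 < δ i0 := by
  by_contra h0
  have h0 : δ i0 = 0 := by omega
  have h1 : rename Subtype.val (ev (spec i0 (0 : τ → ℤ)) P) = P := by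
    have e1 := hδ _ (fun b => if b = i0 then (0 : MP (ι × τ) ℤ) else 1) X
    have e2 : ∏ b, (if b = i0 then (0 : MP (ι × τ) ℤ) else 1) ^ δ b = 1 := by
      apply Finset.prod_eq_one
      intro b _
      by_cases hb : b = i0
      · rw [hb, h0, pow_zero]
      · simp [hb]
    rw [e2, one_mul, ev_X] at e1
    refine Eq.trans ?_ e1
    have := hom_ev (rename (R := ℤ) (Subtype.val : {v : ι × τ // v.1 ≠ i0} → ι × τ)).toRingHom
      (spec i0 (0 : τ → ℤ)) P
    refine this.trans ?_
    congr 2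
    funext v
    by_cases hv : v.1 = i0 <;> simp [spec, hv]
  have h2 : ev (spec i0 (0 : τ → ℤ)) P = 0 := by
    apply gen_inj a s0 ha i0 J hJ hind.1
    have := (inK_iff a s0 ha P).1 ((hP.2 P).2 dvd_rfl)
    rw [← h1, ev_rename] at this
    exact this
  rw [h2, map_zero] at h1
  exact hP.1.ne_zero h1.symm

end M4

section M5
open MvPolynomial
open Finset (mem_insert_of_mem mem_insert_self mem_univ mul_prod_erase ne_of_mem_erase sum_congr univ)

variable {ι τ : Type} [Fintype ι] [Fintype τ] [DecidableEq ι] [DecidableEq τ]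
  {A : Type} [CommRing A] [IsDomain A] [CharZero A]

lemma prod_dvd_of_prime {R I : Type*} [CommRing R] [IsDomain R] [DecidableEq I] (s : Finset I)
    (P : I → R) (G : R) (hP : ∀ i ∈ s, Prime (P i)) (hne : ∀ i ∈ s, ∀ j ∈ s, i ≠ j → ¬ P i ∣ P j)
    (hd : ∀ i ∈ s, P i ∣ G) : ∏ i ∈ s, P i ∣ G := by
  induction s using Finset.induction_on generalizing G with
  | empty => simp
  | insert a s ha ih =>
    rw [Finset.prod_insert ha]
    obtain ⟨H, rfl⟩ := hd a (mem_insert_self _ _)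
    refine mul_dvd_mul_left _ (ih H (fun i hi => hP i (mem_insert_of_mem hi))
      (fun i hi j hj => hne i (mem_insert_of_mem hi) j (mem_insert_of_mem hj)) ?_)
    intro i hi
    have h1 := hd i (mem_insert_of_mem hi)
    refine ((hP i (mem_insert_of_mem hi)).dvd_or_dvd h1).resolve_left ?_
    exact hne i (mem_insert_of_mem hi) a (mem_insert_self _ _)
      (fun h => ha (h ▸ hi))

lemma replace (a a' : ι → τ → A) (s0 : τ) (ha : ∀ b, a b s0 = 1) (ha' : ∀ b, a' b s0 = 1)
    (i0 : ι) (hoff : ∀ b, b ≠ i0 → a' b = a b) (J : ι → τ) (hJ : ∀ b, b ≠ i0 → J b ≠ s0)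
    (hind : IsTranscendenceBasis ℤ (fun b : {b : ι // b ≠ i0} => a b (J b)))
    (e : ℕ) (g : τ → MP (Fin e × τ) ℤ)
    (hg : ∀ (B : Type) [CommRing B] (h : A →+* B) (w : Fin e × τ → B),
      ∏ i, ∑ s, h (a' i0 s) * w (i, s) = ∑ t, h (a i0 t) * ev w (g t))
    (hgBH : ∀ t, IsBH Prod.fst (fun _ => 1) (g t)) (Λ : ℝ) (hΛ : 0 < Λ)
    (hgΛ : ∀ t (w : Fin e × τ → ℂ), (∀ v, ‖w v‖ ≤ 1) → ‖ev w (g t)‖ ≤ Λ ^ e)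
    {C0 C' : MP (ι × τ) ℤ} (hC : IsGen a C0) (hC' : IsGen a' C')
    {δ δ' : ι → ℕ} (hδ : IsBH Prod.fst δ C0) (hδ' : IsBH Prod.fst δ' C') :
    (e ≠ 0 → δ' i0 ≤ δ i0) ∧ (∀ b, b ≠ i0 → e * δ' b ≤ δ b) ∧
    supS C' ^ e ≤ 2 ^ (e * δ i0 + ∑ b ∈ univ.erase i0, δ b) * (Λ ^ (e * δ i0) * supS C0) := by
  classical
  have hind' : IsTranscendenceBasis ℤ (fun b : {b : ι // b ≠ i0} => a' b (J b)) := by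
    have : (fun b : {b : ι // b ≠ i0} => a' b (J b)) = (fun b : {b : ι // b ≠ i0} => a b (J b)) := by
      funext b; rw [hoff b b.2]
    rw [this]; exact hind
  let W := (Fin e × τ) ⊕ (ι × τ)
  let sub : ι × τ → MP W ℤ := fun v =>
    if v.1 = i0 then rename Sum.inl (g v.2) else X (Sum.inr v)
  let G := ev sub C0
  let f : Fin e → ι × τ → W := fun i v => if v.1 = i0 then Sum.inl (i, v.2) else Sum.inr v
  have hf : ∀ i, Function.Injective (f i) := by
    rintro i ⟨b, s⟩ ⟨b', s'⟩ h
    by_cases h1 : b = i0 <;> by_cases h2 : b' = i0 <;> simp only [f, h1, h2, if_true, if_false] at h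
    · have := Prod.ext_iff.1 (Sum.inl.inj h)
      exact Prod.ext (h1.trans h2.symm) this.2
    · cases h
    · cases h
    · exact Sum.inr.inj h
  have hdv : ∀ i, rename (f i) C' ∣ G := by
    intro i
    refine hC'.dvd_of_vanish s0 ha' (f i) (hf i) G ?_
    intro B _ h u hu
    simp only [G]
    rw [ev_ev]
    apply (hC.2 C0).2 dvd_rfl B h
    intro b
    by_cases hb : b = i0
    · subst hb
      have := hg B h (fun v => u (Sum.inl v))
      rw [Finset.prod_eq_zero (mem_univ i)] at this
      · rw [this]
        refine sum_congr rfl fun s _ => ?_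
        simp only [sub, if_true]
        rw [ev_rename]
      · have := hu b
        simpa [f] using this
    · have := hu b
      rw [hoff b hb] at this
      rw [← this]
      refine sum_congr rfl fun s _ => ?_
      simp [sub, f, hb]
  let γ : W → Fin e ⊕ ι := Sum.map Prod.fst Prod.fst
  let δG : Fin e ⊕ ι → ℕ := Sum.elim (fun _ => δ i0) (fun b => if b = i0 then 0 else δ b)
  have hprod : ∀ (B : Type) [CommRing B] (c1 : ι → B) (k : ι → ℕ) (x : B),
      ∏ b, (if b = i0 then x else c1 b) ^ k b
        = x ^ k i0 * ∏ b, c1 b ^ (if b = i0 then 0 else k b) := by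
    intro B _ c1 k x
    rw [← mul_prod_erase _ _ (mem_univ i0),
      ← mul_prod_erase univ (fun b => c1 b ^ (if b = i0 then 0 else k b))
        (mem_univ i0)]
    simp only [if_true, pow_zero, one_mul]
    congr 1
    refine Finset.prod_congr rfl fun b hb => ?_
    simp [ne_of_mem_erase hb]
  have hGBH : IsBH γ δG G := by
    intro B _ c u
    simp only [G]
    rw [ev_ev, ev_ev]
    let c' : ι → B := fun b => if b = i0 then ∏ i, c (Sum.inl i) else c (Sum.inr b)
    have := hδ B c' (fun v => ev u (sub v))
    rw [Fintype.prod_sum_type]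
    simp only [δG, Sum.elim_inl, Sum.elim_inr]
    simp only [c'] at this
    rw [hprod B (fun b => c (Sum.inr b)) δ] at this
    rw [Finset.prod_pow, ← this]
    congr 2
    funext v
    by_cases hv : v.1 = i0
    · simp only [sub, hv, if_true]
      rw [ev_rename, ev_rename]
      have := hgBH v.2 B (fun i => c (Sum.inl i)) (fun v => u (Sum.inl v))
      simpa [γ] using this
    · simp [sub, hv, γ]
  let δP : Fin e → Fin e ⊕ ι → ℕ := fun i => Sum.elim (fun j => if j = i then δ' i0 else 0)
    (fun b => if b = i0 then 0 else δ' b)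
  have hPBH : ∀ i, IsBH γ (δP i) (rename (f i) C') := by
    intro i B _ c u
    rw [ev_rename, ev_rename]
    let c' : ι → B := fun b => if b = i0 then c (Sum.inl i) else c (Sum.inr b)
    have := hδ' B c' (fun v => u (f i v))
    rw [Fintype.prod_sum_type]
    simp only [δP, Sum.elim_inl, Sum.elim_inr]
    simp only [c'] at this
    rw [hprod B (fun b => c (Sum.inr b)) δ'] at this
    simp only [pow_ite, pow_zero, Finset.prod_ite_eq', mem_univ, if_true] at this ⊢
    rw [← this]
    congr 2
    funext v
    by_cases hv : v.1 = i0 <;> simp [f, hv, γ]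
  have hpos : 0 < δ' i0 := hC'.pos s0 ha' i0 J hJ hind' hδ'
  have hpr : ∀ i, Prime (rename (f i) C') := fun i => prime_rename_inj _ (hf i) _ hC'.1
  have hPd : ∏ i, rename (f i) C' ∣ G := by
    apply prod_dvd_of_prime _ _ _ (fun i _ => hpr i) _ (fun i _ => hdv i)
    intro i _ j _ hij hd
    have := (hPBH i).le_of_dvd (hPBH j) (hpr j).ne_zero hd (Sum.inl i)
    simp [δP, hij] at this
    omega
  have hG0 : G ≠ 0 := by
    let w : Fin e × τ → ℤ := fun v => if v.2 = s0 then 1 else 0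
    have h1 := hg A (RingHom.id A) (fun v => (w v : A))
    have h2 := hC.spec_ne s0 ha i0 J hJ hind (fun t => ev w (g t)) (by
      have e1 : ∀ t, ((ev w (g t) : ℤ) : A) = ev (fun v => (w v : A)) (g t) := by
        intro t
        exact hom_ev (Int.castRingHom A) w (g t)
      simp only [e1]
      simp only [mul_comm (ev _ _)]
      simp only [RingHom.id_apply] at h1
      rw [← h1]
      simp [w, ha'])
    intro h0
    apply h2
    have := congrArg (ev (fun x : W => Sum.elim (fun v => C (w v)) (fun v =>
      if h : v.1 = i0 then (0 : MP {v : ι × τ // v.1 ≠ i0} ℤ) else X ⟨v, h⟩) x)) h0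
    rw [map_zero] at this
    simp only [G] at this
    rw [ev_ev] at this
    rw [← this]
    congr 2
    funext v
    by_cases hv : v.1 = i0
    · simp only [sub, hv, if_true, spec]
      rw [ev_rename]
      simp only [Sum.elim_inl]
      simp only [dif_pos]
      exact hom_ev (C : ℤ →+* MP {v : ι × τ // v.1 ≠ i0} ℤ) w (g v.2)
    · simp [sub, hv, spec]
  have hPBH' := IsBH.prod univ (fun i _ => hPBH i)
  refine ⟨?_, ?_, ?_⟩
  · intro he
    have i : Fin e := ⟨0, Nat.pos_of_ne_zero he⟩
    have := hPBH'.le_of_dvd hGBH hG0 hPd (Sum.inl i)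
    simpa [δP, δG, Finset.sum_apply] using this
  · intro b hb
    have := hPBH'.le_of_dvd hGBH hG0 hPd (Sum.inr b)
    simpa [δP, δG, Finset.sum_apply, hb] using this
  · obtain ⟨R, hR⟩ := hPd
    have hR0 : R ≠ 0 := by rintro rfl; simp [hG0] at hR
    have h1 := gelfond hPBH'.isHom (by rw [← hR]; exact hGBH.isHom) hR0
    rw [← hR] at h1
    have h2 : ∑ b, δG b = e * δ i0 + ∑ b ∈ univ.erase i0, δ b := by
      rw [Fintype.sum_sum_type]
      simp only [δG, Sum.elim_inl, Sum.elim_inr, Finset.sum_const, Finset.card_univ,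
        Fintype.card_fin, smul_eq_mul]
      congr 1
      rw [← Finset.add_sum_erase _ _ (mem_univ i0)]
      simp only [if_true, zero_add]
      refine sum_congr rfl fun b hb => ?_
      simp [ne_of_mem_erase hb]
    rw [h2] at h1
    have h3 : supS G ≤ Λ ^ (e * δ i0) * supS C0 := by
      obtain ⟨u, hu, hu'⟩ := supS_attained G
      rw [← hu']
      simp only [G]
      rw [ev_ev]
      have := bh_bound hδ (fun b => if b = i0 then Λ ^ e else 1)
        (fun b => by by_cases h : b = i0 <;> simp [h]; positivity) (fun v => ev u (sub v)) (by
          intro v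
          by_cases hv : v.1 = i0
          · simp only [sub, hv, if_true]
            rw [ev_rename]
            exact hgΛ _ _ fun v => hu _
          · simp [sub, hv, hu])
      refine this.trans (le_of_eq ?_)
      congr 1
      rw [← mul_prod_erase _ _ (mem_univ i0), Finset.prod_eq_one]
      · simp [pow_mul]
      · intro b hb
        simp [ne_of_mem_erase hb]
    have h4 : supS C' ^ e ≤ supS (∏ i, rename (f i) C') := by
      obtain ⟨u, hu, hu'⟩ := supS_attained C'
      let u1 : W → ℂ := Sum.elim (fun v => u (i0, v.2)) u
      have := le_supS (∏ i, rename (f i) C') u1 (by rintro (v | v) <;> simp [u1, hu])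
      rw [map_prod, norm_prod] at this
      have e1 : ∀ i, ev u1 (rename (f i) C') = ev u C' := by
        intro i
        rw [ev_rename]
        congr 2
        funext v
        by_cases hv : v.1 = i0
        · simp only [f, hv, u1, if_true, Sum.elim_inl]
          exact congrArg u (Prod.ext hv.symm rfl)
        · simp [f, hv, u1]
      simp only [e1, hu'] at this
      simpa using this
    refine h4.trans (h1.trans ?_)
    gcongr

end M5

section M6
open MvPolynomial
open Finset (mem_univ prod_congr prod_cons prod_insert single_le_sum sum_congr sum_cons sum_insert sum_le_sum sum_mul_sum sum_subset)
open Int (castRingHom)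

lemma gelfond_two {V : Type} [Fintype V] {P Q : MP V ℤ} {p q : ℕ} (hP : IsHom p P) (hQ : IsHom q Q)
    (α β : ℝ) (hα : 0 < α) (hβ : 0 < β) :
    (α ^ p * supS P) * (β ^ q * supS Q) ≤ (α + β) ^ (p + q) * supS (P * Q) := by
  obtain ⟨u, hu, hu'⟩ := supS_attained Q
  obtain ⟨w, hw, hw'⟩ := supS_attained P
  have hPQ : IsHom (p + q) (P * Q) := by
    intro B _ c x
    rw [map_mul, map_mul, hP, hQ]; ring
  have key := max_mod (fun z : ℂ => ev (fun v => β * u v + z * (α * w v)) Q *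
    ev (fun v => α * (starRingEnd ℂ) (w v) + z * (β * (starRingEnd ℂ) (u v))) P)
    ((diff_line Q _ _).mul (diff_line P _ _)) ((α + β) ^ (p + q) * supS (P * Q)) ?_
  · simp only [zero_mul, add_zero] at key
    rw [hQ ℂ, hP ℂ, conj_aeval] at key
    simp only [norm_mul, norm_pow, RCLike.norm_conj, hu', hw', Complex.norm_real,
      Real.norm_of_nonneg hα.le, Real.norm_of_nonneg hβ.le] at key
    linarith
  · intro z hz
    have hzz : z * (starRingEnd ℂ) z = 1 := by
      rw [Complex.mul_conj, Complex.normSq_eq_norm_sq, hz]; simp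
    set y : V → ℂ := fun v => β * u v + z * (α * w v)
    have e1 : (fun v => α * (starRingEnd ℂ) (w v) + z * (β * (starRingEnd ℂ) (u v)))
        = fun v => z * (starRingEnd ℂ) (y v) := by
      funext v
      simp only [y, map_add, map_mul, Complex.conj_ofReal]
      linear_combination (-(α : ℂ) * (starRingEnd ℂ) (w v)) * hzz
    rw [e1, hP ℂ z, conj_aeval]
    simp only [norm_mul, norm_pow, hz, one_pow, one_mul, RCLike.norm_conj]
    rw [mul_comm, ← norm_mul, ← map_mul]
    refine hom_bound hPQ (α + β) (by positivity) y fun v => ?_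
    refine (norm_add_le _ _).trans ?_
    simp only [norm_mul, hz, one_mul, Complex.norm_real,
      Real.norm_of_nonneg hα.le, Real.norm_of_nonneg hβ.le]
    have := mul_le_of_le_one_right hα.le (hw v)
    have := mul_le_of_le_one_right hβ.le (hu v)
    linarith

lemma supS_nonneg {V : Type} [Fintype V] (P : MP V ℤ) : 0 ≤ supS P := by
  obtain ⟨u, hu, hu'⟩ := supS_attained P
  rw [← hu']; positivity

lemma gelfond_multi {V I : Type} [Fintype V] [DecidableEq I] (s : Finset I) (hs : s.Nonempty)
    (P : I → MP V ℤ) (g : I → ℕ) (hP : ∀ i ∈ s, IsHom (g i) (P i)) (α : I → ℝ)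
    (hα : ∀ i ∈ s, 0 < α i) :
    IsHom (∑ i ∈ s, g i) (∏ i ∈ s, P i) ∧
    ∏ i ∈ s, (α i ^ g i * supS (P i)) ≤ (∑ i ∈ s, α i) ^ (∑ i ∈ s, g i) * supS (∏ i ∈ s, P i) := by
  induction hs using Finset.Nonempty.cons_induction with
  | singleton a => simp; exact hP a (by simp)
  | cons a s ha hs ih =>
    obtain ⟨ih1, ih2⟩ := ih (fun i hi => hP i (by simp [hi])) (fun i hi => hα i (by simp [hi]))
    have hPa := hP a (by simp)
    constructor
    · intro B _ c x
      simp only [prod_cons, sum_cons]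
      rw [map_mul, map_mul, hPa, ih1]; ring
    · simp only [prod_cons, sum_cons]
      refine le_trans (mul_le_mul_of_nonneg_left ih2 ?_) (gelfond_two hPa ih1 _ _ (hα a (by simp)) ?_)
      · exact mul_nonneg (pow_nonneg (hα a (by simp)).le _) (supS_nonneg _)
      · exact Finset.sum_pos (fun i hi => hα i (by simp [hi])) hs

noncomputable def l1 {σ : Type} (p : MP σ ℂ) : ℝ := ∑ m ∈ p.support, ‖coeff m p‖

lemma l1_eq {σ : Type} (p : MP σ ℂ) (s : Finset (σ →₀ ℕ)) (h : p.support ⊆ s) :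
    l1 p = ∑ m ∈ s, ‖coeff m p‖ := by
  refine sum_subset h fun m _ hm => ?_
  rw [notMem_support_iff.1 hm, norm_zero]

lemma l1_nonneg {σ : Type} (p : MP σ ℂ) : 0 ≤ l1 p :=
  Finset.sum_nonneg fun _ _ => norm_nonneg _

lemma l1_add {σ : Type} (p q : MP σ ℂ) : l1 (p + q) ≤ l1 p + l1 q := by
  classical
  rw [l1_eq (p + q) (p.support ∪ q.support) support_add,
    l1_eq p (p.support ∪ q.support) Finset.subset_union_left,
    l1_eq q (p.support ∪ q.support) Finset.subset_union_right, ← Finset.sum_add_distrib]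
  refine sum_le_sum fun m _ => ?_
  rw [coeff_add]; exact norm_add_le _ _

lemma l1_sum {σ I : Type} (s : Finset I) (p : I → MP σ ℂ) :
    l1 (∑ i ∈ s, p i) ≤ ∑ i ∈ s, l1 (p i) := by
  classical
  induction s using Finset.induction_on with
  | empty => simp [l1]
  | insert a s ha ih =>
    rw [sum_insert ha, sum_insert ha]
    exact (l1_add _ _).trans (by linarith)

lemma l1_monomial {σ : Type} (m : σ →₀ ℕ) (c : ℂ) : l1 (monomial m c) ≤ ‖c‖ := by
  classical
  rw [l1_eq _ {m} support_monomial_subset]; simp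

lemma l1_mul {σ : Type} (p q : MP σ ℂ) : l1 (p * q) ≤ l1 p * l1 q := by
  classical
  have h1 : p * q = ∑ m ∈ p.support, ∑ k ∈ q.support, monomial (m + k) (coeff m p * coeff k q) := by
    conv_lhs => rw [p.as_sum, q.as_sum, sum_mul_sum]
    simp [monomial_mul]
  rw [h1]
  refine (l1_sum _ _).trans ?_
  rw [l1, l1, sum_mul_sum]
  refine sum_le_sum fun m _ => (l1_sum _ _).trans (sum_le_sum fun k _ => ?_)
  exact (l1_monomial _ _).trans (by rw [norm_mul])

lemma l1_prod {σ I : Type} (s : Finset I) (p : I → MP σ ℂ) :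
    l1 (∏ i ∈ s, p i) ≤ ∏ i ∈ s, l1 (p i) := by
  classical
  induction s using Finset.induction_on with
  | empty => simp; exact (l1_monomial 0 1).trans (by simp)
  | insert a s ha ih =>
    rw [prod_insert ha, prod_insert ha]
    exact (l1_mul _ _).trans (mul_le_mul_of_nonneg_left ih (l1_nonneg _))

lemma coeff_le_l1 {σ : Type} (p : MP σ ℂ) (m : σ →₀ ℕ) : ‖coeff m p‖ ≤ l1 p := by
  classical
  rw [l1_eq p (insert m p.support) (Finset.subset_insert _ _)]
  exact single_le_sum (f := fun m => ‖coeff m p‖) (fun _ _ => norm_nonneg _)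
    (Finset.mem_insert_self _ _)

noncomputable def L1 {σ : Type} (f : MP σ ℤ) : ℝ := l1 (MvPolynomial.map (castRingHom ℂ) f)

lemma L1_nonneg {σ : Type} (p : MP σ ℤ) : 0 ≤ L1 p := l1_nonneg _

abbrev Mon (n m : ℕ) := {s : Fin n → Fin (m + 1) // ∑ i, (s i : ℕ) ≤ m}

noncomputable def Mon.fs {n m : ℕ} (s : Mon n m) : Fin n →₀ ℕ :=
  Finsupp.equivFunOnFinite.symm (fun i => (s.1 i : ℕ))

lemma Mon.fs_inj {n m : ℕ} : Function.Injective (Mon.fs (n := n) (m := m)) := by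
  intro s t h
  apply Subtype.ext
  funext i
  have := DFunLike.congr_fun h i
  exact Fin.ext this

lemma Mon.exists_fs {n m : ℕ} (k : Fin n →₀ ℕ) (hk : ∑ i, k i ≤ m) : ∃ s : Mon n m, s.fs = k := by
  have h : ∀ i, k i < m + 1 := fun i => by
    have := single_le_sum (f := fun i => k i) (fun _ _ => Nat.zero_le _) (mem_univ i)
    omega
  refine ⟨⟨fun i => ⟨k i, h i⟩, hk⟩, ?_⟩
  ext i; rfl

noncomputable def Mon.pol {n m : ℕ} (s : Mon n m) : MP (Fin n) ℤ := monomial s.fs 1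

lemma exists_g {n m e D' : ℕ} (χ : Mon n m → MP (Fin n) ℤ)
    (hχ : ∀ s, (χ s).totalDegree ≤ D') (hm : e * D' ≤ m) (Λ : ℝ) (hΛ : ∑ s, L1 (χ s) ≤ Λ) :
    ∃ g : Mon n m → MP (Fin e × Mon n m) ℤ,
      (∀ (B : Type) [CommRing B] (h : MP (Fin n) ℤ →+* B) (w : Fin e × Mon n m → B),
        ∏ i, ∑ s, h (χ s) * w (i, s) = ∑ t : Mon n m, h (t.pol) * ev w (g t)) ∧
      (∀ t, IsBH Prod.fst (fun _ => 1) (g t)) ∧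
      (∀ t (w : Fin e × Mon n m → ℂ), (∀ v, ‖w v‖ ≤ 1) → ‖ev w (g t)‖ ≤ Λ ^ e) := by
  classical
  let S := MP (Fin e × Mon n m) ℤ
  let H : MP (Fin n) S := ∏ i : Fin e, ∑ s, MvPolynomial.map C (χ s) * C (X (i, s))
  have hH : H.totalDegree ≤ m := by
    refine (totalDegree_finset_prod _ _).trans ?_
    refine le_trans ?_ hm
    refine (Finset.sum_le_card_nsmul _ _ D' ?_).trans (by simp)
    intro i _
    apply totalDegree_finsetSum_le
    intro s _
    refine (totalDegree_mul _ _).trans ?_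
    rw [totalDegree_C, add_zero]
    exact le_trans (Finset.sup_mono (support_map_subset _ _)) (hχ s)
  have hmap : ∀ (B : Type) [CommRing B] (w : Fin e × Mon n m → B),
      MvPolynomial.map (ev w) H = ∏ i : Fin e, ∑ s, MvPolynomial.map (castRingHom B) (χ s) * C (w (i, s)) := by
    intro B _ w
    simp only [H, map_prod, map_sum, map_mul, map_C, MvPolynomial.map_map]
    refine prod_congr rfl fun i _ => sum_congr rfl fun s _ => ?_
    congr 1
    · rw [show (ev w).comp C = castRingHom B from RingHom.ext_int _ _]
    · simp
  have hco : ∀ (B : Type) [CommRing B] (w : Fin e × Mon n m → B) (t : Mon n m),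
      ev w (coeff t.fs H) = coeff t.fs (∏ i : Fin e, ∑ s, MvPolynomial.map (castRingHom B) (χ s) * C (w (i, s))) := by
    intro B _ w t
    rw [← hmap, coeff_map]
  refine ⟨fun t => coeff t.fs H, ?_, ?_, ?_⟩
  · intro B _ h w
    have hh : ∀ q, h q = ev (fun j => h (X j)) q := fun q => DFunLike.congr_fun (hom_eq_ev h) q
    let Ev : MP (Fin n) S →+* B := eval₂Hom (ev w) (fun j => h (X j))
    have h1 : Ev H = ∏ i, ∑ s, h (χ s) * w (i, s) := by
      simp only [H, map_prod, map_sum, map_mul]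
      refine prod_congr rfl fun i _ => sum_congr rfl fun s _ => ?_
      congr 1
      · rw [hh]
        simp only [Ev, coe_eval₂Hom, eval₂_map, ev]
        congr 1
        ext; simp
      · simp only [Ev, eval₂Hom_C]
        exact eval₂Hom_X' _ _ _
    rw [← h1]
    conv_lhs => rw [H.as_sum, map_sum]
    have h2 : H.support ⊆ Finset.univ.image (Mon.fs (n := n) (m := m)) := by
      intro k hk
      have := (le_totalDegree hk).trans hH
      rw [Finsupp.sum_fintype _ _ (fun _ => rfl)] at this
      obtain ⟨s, hs⟩ := Mon.exists_fs k this
      exact Finset.mem_image.2 ⟨s, mem_univ _, hs⟩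
    rw [sum_subset h2 (fun k _ hk => by
      rw [notMem_support_iff.1 hk, map_zero, map_zero]),
      Finset.sum_image (fun s _ t _ h => Mon.fs_inj h)]
    refine sum_congr rfl fun t _ => ?_
    rw [hh]
    simp only [Ev, Mon.pol, ev, coe_eval₂Hom, eval₂_monomial]
    simp [mul_comm]
    rfl
  · intro t B _ c u
    rw [hco, hco]
    have : ∀ i : Fin e, ∑ s, MvPolynomial.map (castRingHom B) (χ s) * C (c i * u (i, s))
        = C (c i) * ∑ s, MvPolynomial.map (castRingHom B) (χ s) * C (u (i, s)) := by
      intro i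
      rw [Finset.mul_sum]
      refine sum_congr rfl fun s _ => ?_
      rw [C_mul]; ring
    simp only [this, Finset.prod_mul_distrib, ← map_prod, coeff_C_mul, pow_one]
  · intro t w hw
    rw [hco]
    refine (coeff_le_l1 _ _).trans ((l1_prod _ _).trans ?_)
    have : ∀ i : Fin e, l1 (∑ s, MvPolynomial.map (castRingHom ℂ) (χ s) * C (w (i, s))) ≤ Λ := by
      intro i
      refine (l1_sum _ _).trans (le_trans (sum_le_sum fun s _ => ?_) hΛ)
      refine (l1_mul _ _).trans ?_
      have h1 := (l1_monomial (0 : Fin n →₀ ℕ) (w (i, s))).trans (hw _)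
      exact mul_le_of_le_one_right (l1_nonneg _) h1
    refine (Finset.prod_le_prod (fun i _ => l1_nonneg _) (fun i _ => this i)).trans (by simp)

end M6

section M7
open MvPolynomial
open Finset (card_univ mem_filter mul_sum prod_congr sum_add_distrib sum_congr sum_eq_single univ)

lemma macaulay (n m : ℕ) (hm : 1 ≤ m) :
    ∃ (Q : MP (Fin (n + 1) × Mon n m) ℤ) (δ : Fin (n + 1) → ℕ), Q ≠ 0 ∧
      (∀ (B : Type) [CommRing B] (h : MP (Fin n) ℤ →+* B) (u : Fin (n + 1) × Mon n m → B),
        (∀ b, ∑ s : Mon n m, h s.pol * u (b, s) = 0) → ev u Q = 0) ∧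
      IsBH Prod.fst δ Q ∧ δ 0 ≤ m ^ n ∧
      ∑ b, δ b = Fintype.card (Mon n ((n + 1) * m)) ∧
      supS Q ≤ (Fintype.card (Mon n ((n + 1) * m))).factorial := by
  classical
  set M := (n + 1) * m with hM
  have hrow : ∀ β : Mon n M, ∃ (b : Fin (n + 1)) (k : Fin n →₀ ℕ) (s1 : Fin n →₀ ℕ),
      k + s1 = β.fs ∧ (∑ i, k i + m ≤ M) ∧
      s1 = (Fin.cons 0 (fun l => Finsupp.single l m) : Fin (n + 1) → (Fin n →₀ ℕ)) b ∧
      (b = 0 → ∀ i, (β.1 i : ℕ) < m) := by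
    intro β
    by_cases h : ∃ l, m ≤ (β.1 l : ℕ)
    · obtain ⟨l, hl⟩ := h
      have e1 : Finsupp.single l m ≤ β.fs := Finsupp.single_le_iff.2 hl
      refine ⟨l.succ, β.fs - Finsupp.single l m, Finsupp.single l m, tsub_add_cancel_of_le e1, ?_, ?_, ?_⟩
      · have h2 : ∑ i, (β.fs - Finsupp.single l m) i + ∑ i, (Finsupp.single l m) i = ∑ i, β.fs i := by
          rw [← sum_add_distrib]
          refine sum_congr rfl fun i _ => ?_
          rw [← Finsupp.add_apply, tsub_add_cancel_of_le e1]
        have h3 : ∑ i, (Finsupp.single l m : Fin n →₀ ℕ) i = m := by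
          simp [Finsupp.single_apply]
        rw [h3] at h2
        rw [h2]
        exact β.2
      · simp
      · intro h; exact absurd h (Fin.succ_ne_zero l)
    · push Not at h
      refine ⟨0, β.fs, 0, add_zero _, ?_, by simp, fun _ => h⟩
      have : ∑ i, β.fs i ≤ ∑ i : Fin n, (m - 1) := Finset.sum_le_sum fun i _ => by
        have := h i
        show (β.1 i : ℕ) ≤ m - 1
        omega
      simp only [Finset.sum_const, card_univ, Fintype.card_fin, smul_eq_mul] at this
      have h2 : n * (m - 1) ≤ n * m := Nat.mul_le_mul_left _ (by omega)
      have h3 : M = n * m + m := by rw [hM, add_mul, one_mul]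
      omega
  choose blk bs s1 hs1 hdeg hs1' hblk using hrow
  let S := MP (Fin (n + 1) × Mon n m) ℤ
  let Mx : Matrix (Mon n M) (Mon n M) S := fun β γ =>
    ∑ s : Mon n m, if bs β + s.fs = γ.fs then X (blk β, s) else 0
  have hev : ∀ (B : Type) [CommRing B] (u : Fin (n + 1) × Mon n m → B),
      ev u Mx.det = Matrix.det (fun β γ => ∑ s : Mon n m, if bs β + s.fs = γ.fs then u (blk β, s) else 0) := by
    intro B _ u
    rw [RingHom.map_det]
    congr 1
    funext β γ
    show ev u (∑ s : Mon n m, if bs β + s.fs = γ.fs then X (blk β, s) else 0) = _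
    rw [map_sum]
    refine sum_congr rfl fun s _ => ?_
    split_ifs
    · exact eval₂Hom_X' _ _ _
    · simp
  refine ⟨Mx.det, fun b => (univ.filter (fun β => blk β = b)).card, ?_, ?_, ?_, ?_, ?_, ?_⟩
  · intro h0
    have h1 := hev ℤ (fun v => if v.2.fs = (Fin.cons 0 (fun l => Finsupp.single l m) :
      Fin (n + 1) → (Fin n →₀ ℕ)) v.1 then 1 else 0)
    rw [h0, map_zero] at h1
    have h2 : (fun β γ => ∑ s : Mon n m, if bs β + s.fs = γ.fs then (if s.fs = (Fin.cons 0 (fun l =>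
        Finsupp.single l m) : Fin (n + 1) → (Fin n →₀ ℕ)) (blk β) then 1 else 0) else 0)
        = (1 : Matrix (Mon n M) (Mon n M) ℤ) := by
      funext β γ
      have hs1m : ∑ i, s1 β i ≤ m := by
        rw [hs1']
        refine Fin.cases ?_ (fun l => ?_) (blk β)
        · simp
        · simp [Finsupp.single_apply]
      obtain ⟨t, ht⟩ := Mon.exists_fs (s1 β) hs1m
      rw [← hs1' β, sum_eq_single t]
      · rw [ht, if_pos rfl, hs1, Matrix.one_apply]
        by_cases hbg : β = γ
        · simp [hbg]
        · rw [if_neg hbg, if_neg (fun h => hbg (Mon.fs_inj h))]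
      · intro s _ hst
        rw [if_neg (c := s.fs = s1 β) (fun h => hst (Mon.fs_inj (h.trans ht.symm)))]
        simp
      · simp
    simp only [h2, Matrix.det_one] at h1
    exact zero_ne_one h1
  · intro B _ h u hu
    rw [hev]
    set N : Matrix (Mon n M) (Mon n M) B := (fun β γ => ∑ s : Mon n m, if bs β + s.fs = γ.fs then u (blk β, s) else 0) with hN
    let ξ : Mon n M → B := fun γ => h (monomial γ.fs 1)
    have h1 : N.mulVec ξ = 0 := by
      funext β
      simp only [Matrix.mulVec, dotProduct, hN, Pi.zero_apply, Finset.sum_mul]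
      rw [Finset.sum_comm]
      have h2 : ∀ s : Mon n m, ∑ γ : Mon n M, (if bs β + s.fs = γ.fs then u (blk β, s) else 0) * ξ γ
          = h (monomial (bs β) 1) * (h s.pol * u (blk β, s)) := by
        intro s
        obtain ⟨γ, hγ⟩ := Mon.exists_fs (m := M) (bs β + s.fs) (by
          have := hdeg β
          have h3 : ∑ i, s.fs i ≤ m := s.2
          simp only [Finsupp.add_apply, sum_add_distrib]
          omega)
        rw [sum_eq_single γ]
        · rw [if_pos hγ.symm]
          simp only [ξ, hγ, Mon.pol]
          rw [← mul_assoc, ← map_mul, monomial_mul, one_mul, mul_comm]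
        · intro γ' _ hne
          rw [if_neg (fun h => hne (Mon.fs_inj (h.symm.trans hγ.symm))), zero_mul]
        · simp
      simp only [h2]
      rw [← mul_sum, hu, mul_zero]
    have h2 : N.det • ξ = 0 := by
      have := congrArg (N.adjugate.mulVec) h1
      rw [Matrix.mulVec_mulVec, Matrix.adjugate_mul, Matrix.mulVec_zero, Matrix.smul_mulVec,
        Matrix.one_mulVec] at this
      exact this
    obtain ⟨γ0, hγ0⟩ := Mon.exists_fs (m := M) (0 : Fin n →₀ ℕ) (by simp)
    have h3 := congrFun h2 γ0
    simp only [Pi.smul_apply, smul_eq_mul, ξ, hγ0, Pi.zero_apply] at h3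
    have h4 : (monomial (0 : Fin n →₀ ℕ) (1 : ℤ)) = 1 := rfl
    rwa [h4, map_one, mul_one] at h3
  · intro B _ c u
    rw [hev, hev]
    have h1 := Matrix.det_mul_column (fun β : Mon n M => c (blk β))
      (fun β γ => ∑ s : Mon n m, if bs β + s.fs = γ.fs then u (blk β, s) else 0)
    have h2 : ∏ β, c (blk β) = ∏ b, c b ^ (univ.filter (fun β => blk β = b)).card := by
      rw [← Finset.prod_fiberwise (s := univ) (g := blk)]
      refine prod_congr rfl fun b _ => ?_
      rw [prod_congr rfl (fun β hβ => by rw [(mem_filter.1 hβ).2]), Finset.prod_const]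
    rw [← h2, ← h1]
    congr 1
    funext β γ
    simp only [Matrix.of_apply, mul_sum, mul_ite, mul_zero]
  · have h1 : ∀ β ∈ univ.filter (fun β => blk β = 0), ∀ i, ((β : Mon n M).1 i : ℕ) < m :=
      fun β hβ => hblk β (mem_filter.1 hβ).2
    have h2 : (univ : Finset (Fin n → Fin m)).card = m ^ n := by simp
    rw [← h2]
    refine Finset.card_le_card_of_injOn (fun β i => if h : ((β : Mon n M).1 i : ℕ) < m then
      ⟨(β.1 i : ℕ), h⟩ else ⟨0, hm⟩) (fun _ _ => by simp) ?_
    intro β hβ γ hγ hbg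
    apply Subtype.ext
    funext i
    have := congrFun hbg i
    simp only [h1 β hβ i, h1 γ hγ i, dif_pos, Fin.mk.injEq] at this
    exact Fin.ext this
  · rw [← card_univ, Finset.card_eq_sum_card_fiberwise (f := blk) (t := univ) (by simp)]
  · obtain ⟨u, hu, hu'⟩ := supS_attained Mx.det
    rw [← hu', hev]
    have := Matrix.det_le (A := (fun β γ => ∑ s : Mon n m, if bs β + s.fs = γ.fs then u (blk β, s) else 0 :
      Matrix (Mon n M) (Mon n M) ℂ)) (abv := NormedField.toAbsoluteValue ℂ) (x := 1) (by
      intro β γ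
      show ‖∑ s : Mon n m, if bs β + s.fs = γ.fs then u (blk β, s) else 0‖ ≤ 1
      by_cases h : ∃ s : Mon n m, bs β + s.fs = γ.fs
      · obtain ⟨s, hs⟩ := h
        rw [sum_eq_single s]
        · rw [if_pos hs]; exact hu _
        · intro t _ hts
          rw [if_neg]
          intro h
          exact hts (Mon.fs_inj (add_left_cancel (h.trans hs.symm)))
        · simp
      · push Not at h
        simp [h])
    simp only [one_pow, nsmul_eq_mul, mul_one] at this
    exact this

end M7

section M8
open MvPolynomial
open Finset (mem_univ single_le_sum sum_le_sum univ)
open Real (log log_mul log_pow)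

def Mon.z {n m : ℕ} : Mon n m := ⟨fun _ => 0, by simp⟩

lemma Mon.z_fs {n m : ℕ} : (Mon.z : Mon n m).fs = 0 := by ext i; rfl

lemma Mon.z_pol {n m : ℕ} : (Mon.z : Mon n m).pol = 1 := by rw [Mon.pol, Mon.z_fs]; rfl

noncomputable def Mon.e {n m : ℕ} (hm : 1 ≤ m) (j : Fin n) : Mon n m :=
  Classical.choose (Mon.exists_fs (m := m) (Finsupp.single j 1) (by simpa [Finsupp.single_apply] using hm))

lemma Mon.e_fs {n m : ℕ} (hm : 1 ≤ m) (j : Fin n) : (Mon.e hm j).fs = Finsupp.single j 1 :=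
  Classical.choose_spec (Mon.exists_fs (m := m) (Finsupp.single j 1) (by simpa [Finsupp.single_apply] using hm))

lemma Mon.e_pol {n m : ℕ} (hm : 1 ≤ m) (j : Fin n) : (Mon.e hm j).pol = X j := by
  rw [Mon.pol, Mon.e_fs]; rfl

lemma Mon.e_ne {n m : ℕ} (hm : 1 ≤ m) (j : Fin n) : Mon.e hm j ≠ Mon.z := by
  intro h
  have := Mon.e_fs hm j
  rw [h, Mon.z_fs] at this
  have := DFunLike.congr_fun this j
  simp at this

noncomputable def lin {n m : ℕ} (s : Mon n m) : MP (Fin n) ℤ :=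
  if ∑ i, s.fs i ≤ 1 then s.pol else 0

noncomputable def pen {n m : ℕ} (s1 : Mon n m) (f : MP (Fin n) ℤ) (s : Mon n m) : MP (Fin n) ℤ :=
  if s = Mon.z then 1 else if s = s1 then f else 0

lemma lin_z {n m : ℕ} : lin (Mon.z : Mon n m) = 1 := by simp [lin, Mon.z_fs, Mon.z_pol]

lemma lin_e {n m : ℕ} (hm : 1 ≤ m) (j : Fin n) : lin (Mon.e hm j) = X j := by
  simp [lin, Mon.e_fs, Mon.e_pol, Finsupp.single_apply]

lemma pen_z {n m : ℕ} (s1 : Mon n m) (f) : pen s1 f Mon.z = 1 := by simp [pen]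

lemma pen_s1 {n m : ℕ} (s1 : Mon n m) (h : s1 ≠ Mon.z) (f) : pen s1 f s1 = f := by simp [pen, h]

lemma L1_monomial {n : ℕ} (k : Fin n →₀ ℕ) : L1 (monomial k (1 : ℤ)) ≤ 1 := by
  rw [L1, map_monomial]
  exact (l1_monomial _ _).trans (by simp)

lemma L1_zero {n : ℕ} : L1 (0 : MP (Fin n) ℤ) = 0 := by
  rw [L1, map_zero]; simp [l1]

lemma L1_lin {n m : ℕ} : ∑ s : Mon n m, L1 (lin s) ≤ n + 1 := by
  classical
  have h1 : ∀ s : Mon n m, L1 (lin s) ≤ if ∑ i, s.fs i ≤ 1 then 1 else 0 := by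
    intro s
    rw [lin]
    split_ifs
    · exact L1_monomial _
    · rw [L1_zero]
  refine (sum_le_sum fun s _ => h1 s).trans ?_
  rw [Finset.sum_boole]
  have h2 : (univ.filter (fun s : Mon n m => ∑ i, s.fs i ≤ 1)).card ≤ (univ : Finset (Option (Fin n))).card := by
    refine Finset.card_le_card_of_injOn (fun s => if h : ∃ i, s.fs i = 1 then some h.choose else none) (by simp) ?_
    have key : ∀ s : Mon n m, ∑ i, s.fs i ≤ 1 → (∀ (h : ∃ i, s.fs i = 1), s.fs = Finsupp.single h.choose 1) ∧
        ((¬ ∃ i, s.fs i = 1) → s.fs = 0) := by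
      intro s hs
      constructor
      · intro h
        have hc := h.choose_spec
        ext i
        by_cases hi : h.choose = i
        · rw [← hi, hc]; simp
        · rw [Finsupp.single_eq_of_ne (Ne.symm hi)]
          have := Finset.add_sum_erase univ (fun i => s.fs i) (mem_univ h.choose)
          have h3 := single_le_sum (f := fun i => s.fs i) (fun _ _ => Nat.zero_le _)
            (Finset.mem_erase.2 ⟨Ne.symm hi, mem_univ i⟩)
          omega
      · intro h
        push Not at h
        ext i
        have := single_le_sum (f := fun i => s.fs i) (fun _ _ => Nat.zero_le _) (mem_univ i)
        have h2 := h i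
        simp only [Finsupp.coe_zero, Pi.zero_apply] at *
        omega
    intro s hs t ht hst
    simp only [Finset.coe_filter, mem_univ, true_and, Set.mem_setOf_eq] at hs ht
    apply Mon.fs_inj
    by_cases h1 : ∃ i, s.fs i = 1 <;> by_cases h2 : ∃ i, t.fs i = 1 <;>
      simp only [h1, h2, dif_pos, dif_neg, not_false_eq_true] at hst
    · rw [(key s hs).1 h1, (key t ht).1 h2, Option.some.inj hst]
    · exact absurd hst (by simp)
    · exact absurd hst (by simp)
    · rw [(key s hs).2 h1, (key t ht).2 h2]
  have h3 : (univ : Finset (Option (Fin n))).card = n + 1 := by simp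
  rw [h3] at h2
  exact_mod_cast h2

lemma L1_pen {n m : ℕ} (s1 : Mon n m) (f) : ∑ s : Mon n m, L1 (pen s1 f s) ≤ 1 + L1 f := by
  classical
  have h1 : ∀ s : Mon n m, L1 (pen s1 f s) ≤ (if s = Mon.z then 1 else 0) + (if s = s1 then L1 f else 0) := by
    intro s
    have := L1_nonneg f
    rw [pen]
    by_cases h1 : s = Mon.z <;> by_cases h2 : s = s1 <;> simp only [h1, h2, if_true, if_false]
    · have := L1_monomial (0 : Fin n →₀ ℕ)
      have h : (monomial (0 : Fin n →₀ ℕ) (1 : ℤ)) = 1 := rfl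
      rw [h] at this
      split_ifs <;> linarith
    · have := L1_monomial (0 : Fin n →₀ ℕ)
      have h : (monomial (0 : Fin n →₀ ℕ) (1 : ℤ)) = 1 := rfl
      rw [h] at this
      split_ifs <;> linarith
    · rw [if_neg (h2 ▸ h1)]; split_ifs <;> linarith
    · rw [L1_zero]; simp
  refine (sum_le_sum fun s _ => h1 s).trans ?_
  rw [Finset.sum_add_distrib]
  simp

lemma lin_deg {n m : ℕ} (s : Mon n m) : (lin s).totalDegree ≤ 1 := by
  rw [lin]
  split_ifs with h
  · refine (totalDegree_monomial_le _ _).trans ?_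
    rw [Finsupp.sum_fintype _ _ (fun _ => rfl)]
    exact h
  · simp

lemma pen_deg {n m D' : ℕ} (s1 : Mon n m) (f : MP (Fin n) ℤ) (hf : f.totalDegree ≤ D') (s : Mon n m) :
    (pen s1 f s).totalDegree ≤ D' := by
  rw [pen]
  split_ifs <;> simp [hf]

noncomputable def lS {V : Type} [Fintype V] (P : MP V ℤ) : ℝ := log (supS P)

lemma lS_nonneg {V : Type} [Fintype V] (P : MP V ℤ) (hP : P ≠ 0) : 0 ≤ lS P :=
  Real.log_nonneg (one_le_supS P hP)

variable {ι : Type} [Fintype ι] [DecidableEq ι] {A : Type} [CommRing A] [IsDomain A] [CharZero A]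

lemma replace_log {n m e D' : ℕ} (π : MP (Fin n) ℤ →+* A) (ψ ψ' : ι → Mon n m → MP (Fin n) ℤ)
    (hψ : ∀ b, ψ b Mon.z = 1) (hψ' : ∀ b, ψ' b Mon.z = 1) (i0 : ι) (hoff : ∀ b, b ≠ i0 → ψ' b = ψ b)
    (hpol : ψ i0 = Mon.pol) (hdeg : ∀ s, (ψ' i0 s).totalDegree ≤ D') (hm : e * D' ≤ m) (he : e ≠ 0)
    (Λ : ℝ) (hΛ0 : 0 < Λ) (hΛ : ∑ s, L1 (ψ' i0 s) ≤ Λ) (J : ι → Mon n m) (hJ : ∀ b, b ≠ i0 → J b ≠ Mon.z)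
    (hind : IsTranscendenceBasis ℤ (fun b : {b : ι // b ≠ i0} => π (ψ b (J b))))
    {C0 C' : MP (ι × Mon n m) ℤ} (hC : IsGen (fun b s => π (ψ b s)) C0)
    (hC' : IsGen (fun b s => π (ψ' b s)) C')
    {δ δ' : ι → ℕ} (hδ : IsBH Prod.fst δ C0) (hδ' : IsBH Prod.fst δ' C') :
    (δ' i0 ≤ δ i0) ∧ (∀ b, b ≠ i0 → e * δ' b ≤ δ b) ∧
    e * lS C' ≤ lS C0 + e * δ i0 * log Λ +
      (e * δ i0 + ∑ b ∈ univ.erase i0, (δ b : ℝ)) * log 2 := by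
  obtain ⟨g, h1, h2, h3⟩ := exists_g (ψ' i0) hdeg hm Λ hΛ
  obtain ⟨r1, r2, r3⟩ := replace (fun b s => π (ψ b s)) (fun b s => π (ψ' b s)) Mon.z
    (fun b => by simp [hψ]) (fun b => by simp [hψ']) i0 (fun b hb => by rw [hoff b hb]) J hJ hind e g
    (by
      intro B _ h w
      simp only [hpol]
      exact h1 B (h.comp π) w) h2 Λ hΛ0 h3 hC hC' hδ hδ'
  refine ⟨r1 he, r2, ?_⟩
  have p1 := one_le_supS C0 hC.1.ne_zero
  have p2 := one_le_supS C' hC'.1.ne_zero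
  have := Real.log_le_log (by positivity) r3
  rw [log_pow, log_mul (by positivity) (by positivity), log_mul (by positivity) (by positivity),
    log_pow, log_pow] at this
  push_cast at this
  simp only [lS]
  linarith

end M8

section M9
open MvPolynomial

variable {A : Type} [CommRing A] [IsDomain A] [CharZero A]

lemma hind_of {n m d : ℕ} (hm : 1 ≤ m) (π : MP (Fin n) ℤ →+* A)
    (ψ : Fin (d + 1) → Mon n m → MP (Fin n) ℤ) (i0 : Fin (d + 1))
    (J : Fin d → Fin n) (hJ : IsTranscendenceBasis ℤ (fun b => π (X (J b))))
    (σ : {b : Fin (d + 1) // b ≠ i0} ≃ Fin d)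
    (h : ∀ b, ψ b.1 (Mon.e hm (J (σ b))) = X (J (σ b))) :
    ∃ Jm : Fin (d + 1) → Mon n m, (∀ b, b ≠ i0 → Jm b ≠ Mon.z) ∧
      IsTranscendenceBasis ℤ (fun b : {b : Fin (d + 1) // b ≠ i0} => π (ψ b (Jm b))) := by
  classical
  refine ⟨fun b => if h : b ≠ i0 then Mon.e hm (J (σ ⟨b, h⟩)) else Mon.z, ?_, ?_⟩
  · intro b hb
    simp only [hb, ne_eq, not_false_eq_true, dif_pos]
    exact Mon.e_ne _ _
  · have : (fun b : {b : Fin (d + 1) // b ≠ i0} => π (ψ b ((fun b => if h : b ≠ i0 then Mon.e hm (J (σ ⟨b, h⟩)) else Mon.z) b)))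
        = (fun b => π (X (J b))) ∘ σ := by
      funext b
      have hb := b.2
      simp only [hb, ne_eq, not_false_eq_true, dif_pos, Function.comp_apply]
      rw [← h b]
    rw [this]
    exact (isTranscendenceBasis_equiv σ).2 hJ

noncomputable def fam {n m : ℕ} (d : ℕ) (b : Fin (d + 1)) : Mon n m → MP (Fin n) ℤ :=
  if b = 0 then lin else Mon.pol

lemma fam_z {n m d : ℕ} (b : Fin (d + 1)) : fam d b (Mon.z : Mon n m) = 1 := by
  rw [fam]; split_ifs; exacts [lin_z, Mon.z_pol]

lemma fam_e {n m d : ℕ} (hm : 1 ≤ m) (b : Fin (d + 1)) (j : Fin n) : fam d b (Mon.e hm j) = X j := by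
  rw [fam]; split_ifs; exacts [lin_e _ _, Mon.e_pol _ _]

def dl {d : ℕ} (δ0 δ1 : ℕ) (b : Fin (d + 1)) : ℕ := if b = 0 then δ0 else δ1

lemma sum_dl {d δ0 δ1 : ℕ} : ∑ b : Fin (d + 1), dl δ0 δ1 b = δ0 + d * δ1 := by
  rw [Fin.sum_univ_succ]
  simp [dl, Fin.succ_ne_zero]

structure IsNode {n m : ℕ} (d : ℕ) (π : MP (Fin n) ℤ →+* A)
    (P : MP (Fin (d + 1) × Mon n m) ℤ) (δ0 δ1 : ℕ) : Prop where
  basis : ∃ J : Fin d → Fin n, IsTranscendenceBasis ℤ (fun b => π (X (J b)))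
  isGen : IsGen (fun b s => π (fam d b s)) P
  isBH : IsBH Prod.fst (dl δ0 δ1) P
  zero : d = 0 → δ1 = 0

lemma fam_hind {n m d : ℕ} (hm : 1 ≤ m) (π : MP (Fin n) ℤ →+* A) (i0 : Fin (d + 1))
    (J : Fin d → Fin n) (hJ : IsTranscendenceBasis ℤ (fun b => π (X (J b)))) :
    ∃ Jm : Fin (d + 1) → Mon n m, (∀ b, b ≠ i0 → Jm b ≠ Mon.z) ∧
      IsTranscendenceBasis ℤ (fun b : {b : Fin (d + 1) // b ≠ i0} => π (fam d b (Jm b))) :=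
  hind_of hm π (fam d) i0 J hJ (finSuccAboveEquiv i0).symm (fun b => fam_e _ _ _)

lemma eq_dl {n m d : ℕ} (π : MP (Fin n) ℤ →+* A) {P : MP (Fin (d + 1) × Mon n m) ℤ}
    (hP : IsGen (fun b s => π (fam d b s)) P) {δ : Fin (d + 1) → ℕ} (hδ : IsBH Prod.fst δ P) :
    ∃ δ1, δ = dl (δ 0) δ1 ∧ (d = 0 → δ1 = 0) := by
  classical
  refine ⟨if h : d = 0 then 0 else δ (Fin.last d), ?_, fun h => by simp [h]⟩
  funext b
  rw [dl]
  by_cases hb : b = 0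
  · simp [hb]
  · rw [if_neg hb]
    have hd : d ≠ 0 := by
      rintro rfl
      exact hb (Subsingleton.elim (α := Fin 1) _ _)
    rw [dif_neg hd]
    have hl : Fin.last d ≠ 0 := by
      intro h; exact hd (by simpa using congrArg Fin.val h)
    have : (fun s : Mon n m => π (fam d b s)) = fun s => π (fam d (Fin.last d) s) := by
      simp only [fam, hb, hl, if_false]
    exact le_antisymm (hP.symm hδ _ _ this) (hP.symm hδ _ _ this.symm)

lemma exists_node {n m d : ℕ} (hm : 1 ≤ m) (π : MP (Fin n) ℤ →+* A)
    (J : Fin d → Fin n) (hJ : IsTranscendenceBasis ℤ (fun b => π (X (J b)))) :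
    ∃ (P : MP (Fin (d + 1) × Mon n m) ℤ) (δ0 δ1 : ℕ), IsNode d π P δ0 δ1 := by
  classical
  obtain ⟨Jm, h1, h2⟩ := fam_hind (m := m) hm π 0 J hJ
  obtain ⟨P, hP⟩ := exists_gen (fun b s => π (fam d b s)) Mon.z (fun b => by simp [fam_z]) 0 Jm h1 h2
  obtain ⟨δ, hδ⟩ := hP.exists_isBH
  obtain ⟨δ1, h3, h4⟩ := eq_dl π hP hδ
  refine ⟨P, δ 0, δ1, ⟨J, hJ⟩, hP, ?_, h4⟩
  rw [← h3]; exact hδ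

end M9

section M10
open MvPolynomial
open Real (log log_le_log log_mul log_nonneg log_pow)

variable {A : Type} [CommRing A] [IsDomain A] [CharZero A]

lemma dvd_deg_lS {V κ : Type} [Fintype V] [Fintype κ] {g : V → κ} {P Q : MP V ℤ} {δ δ' : κ → ℕ}
    (hP : IsBH g δ P) (hQ : IsBH g δ' Q) (hQ0 : Q ≠ 0) (hd : P ∣ Q) :
    (∀ b, δ b ≤ δ' b) ∧ lS P ≤ lS Q + (∑ b, (δ' b : ℝ)) * log 2 := by
  refine ⟨fun b => hP.le_of_dvd hQ hQ0 hd b, ?_⟩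
  obtain ⟨R, rfl⟩ := hd
  have hP0 : P ≠ 0 := fun h => hQ0 (by simp [h])
  have hR0 : R ≠ 0 := fun h => hQ0 (by simp [h])
  have h := gelfond hP.isHom hQ.isHom hR0
  have p1 := one_le_supS P hP0
  have p2 := one_le_supS (P * R) hQ0
  have := log_le_log (by positivity) h
  rw [log_mul (by positivity) (by positivity), log_pow] at this
  push_cast at this
  simp only [lS]
  linarith

lemma node_base {n m : ℕ} (hm : 1 ≤ m) (π : MP (Fin n) ℤ →+* A)
    (hJ : IsTranscendenceBasis ℤ (fun j : Fin n => π (X j)))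
    (P : MP (Fin (n + 1) × Mon n m) ℤ) (δ0 δ1 : ℕ) (hP : IsNode n π P δ0 δ1) :
    δ0 ≤ m ^ n ∧ m * δ1 ≤ m ^ n ∧
    m * lS P ≤ (Fintype.card (Mon n ((n + 1) * m)) : ℝ) * log 2 +
      (Fintype.card (Mon n ((n + 1) * m)) : ℝ) * log (Fintype.card (Mon n ((n + 1) * m)))
      + m * m ^ n * log (n + 1) + (m * m ^ n + n * m ^ n) * log 2 := by
  classical
  obtain ⟨Q, δQ, hQ0, hQ, hδQ, h0, hs, hsup⟩ := macaulay n m hm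
  set N := Fintype.card (Mon n ((n + 1) * m)) with hN
  obtain ⟨Jm, h1, h2⟩ := hind_of (m := m) hm π (fun _ => Mon.pol) (0 : Fin (n + 1)) id hJ
    (finSuccAboveEquiv 0).symm (fun b => Mon.e_pol _ _)
  obtain ⟨C0, hC0⟩ := exists_gen (fun (b : Fin (n + 1)) (s : Mon n m) => π s.pol) Mon.z
    (fun b => by simp [Mon.z_pol]) 0 Jm h1 h2
  obtain ⟨δ, hδ⟩ := hC0.exists_isBH
  have hd : C0 ∣ Q := (hC0.2 Q).1 (fun B _ h u hu => hQ B (h.comp π) u hu)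
  obtain ⟨k1, k2⟩ := dvd_deg_lS hδ hδQ hQ0 hd
  have k3 : ∀ b, δ b ≤ m ^ n := fun b => (hC0.symm hδ b 0 rfl).trans ((k1 0).trans h0)
  have hlQ : lS Q ≤ N * log N := by
    have p1 := one_le_supS Q hQ0
    refine (log_le_log (by positivity) hsup).trans ?_
    rw [← log_pow]
    refine log_le_log (by positivity) ?_
    exact_mod_cast Nat.factorial_le_pow N
  have hsR : (∑ b, (δQ b : ℝ)) = N := by exact_mod_cast hs
  rw [hsR] at k2
  obtain ⟨r1, r2, r3⟩ := replace_log (e := m) (D' := 1) π (fun _ => Mon.pol) (fam n) (fun _ => Mon.z_pol) fam_z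
    (0 : Fin (n + 1)) (fun b hb => by simp [fam, hb]) rfl (fun s => by simpa [fam] using lin_deg s) (by simp) (by omega)
    (n + 1) (by positivity) (by simpa [fam] using L1_lin) Jm h1 h2 hC0 hP.isGen hδ hP.isBH
  have hl2 : 0 ≤ log 2 := log_nonneg (by norm_num)
  refine ⟨r1.trans (k3 0), ?_, ?_⟩
  · rcases Nat.eq_zero_or_pos n with hn | hn
    · rw [hP.zero hn]; simp
    · have : (Fin.last n) ≠ 0 := by
        intro h; exact hn.ne' (by simpa using congrArg Fin.val h)
      have := (r2 _ this).trans (k3 _)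
      simpa [dl, hn.ne'] using this
  · have e1 : (δ 0 : ℝ) ≤ m ^ n := by exact_mod_cast k3 0
    have e2 : ∑ b ∈ Finset.univ.erase (0 : Fin (n + 1)), (δ b : ℝ) ≤ n * m ^ n := by
      refine (Finset.sum_le_sum (g := fun _ => (m : ℝ) ^ n) fun b _ => by exact_mod_cast k3 b).trans ?_
      simp
    have e3 : 0 ≤ log ((n : ℝ) + 1) := log_nonneg (by linarith [(Nat.cast_nonneg n : (0:ℝ) ≤ n)])
    have m0 : (0 : ℝ) ≤ m := Nat.cast_nonneg m
    calc (m : ℝ) * lS P ≤ _ := r3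
      _ ≤ (N * log 2 + N * log N) + m * m ^ n * log (n + 1) + (m * m ^ n + n * m ^ n) * log 2 := by
        gcongr
        linarith
      _ = _ := by ring

lemma log_lim (n : ℕ) : ∃ m0 : ℕ, 1 ≤ m0 ∧ ∀ m : ℕ, m0 ≤ m →
    ((n : ℝ) + 2) ^ n * (log 2 + n * (log (n + 2) + log m)) + n * log 2 ≤ m := by
  have h1 : Filter.Tendsto (fun x : ℝ => log x / x) Filter.atTop (nhds 0) :=
    Real.isLittleO_log_id_atTop.tendsto_div_nhds_zero
  have h2 : Filter.Tendsto (fun x : ℝ => x⁻¹) Filter.atTop (nhds 0) := tendsto_inv_atTop_zero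
  have h3 : Filter.Tendsto (fun x : ℝ => ((n : ℝ) + 2) ^ n * n * (log x / x) +
      (((n : ℝ) + 2) ^ n * (log 2 + n * log (n + 2)) + n * log 2) * x⁻¹) Filter.atTop (nhds 0) := by
    simpa using (h1.const_mul (((n : ℝ) + 2) ^ n * n)).add
      (h2.const_mul (((n : ℝ) + 2) ^ n * (log 2 + n * log (n + 2)) + n * log 2))
  have h4 := (h3.comp tendsto_natCast_atTop_atTop).eventually (gt_mem_nhds (show (0 : ℝ) < 1 by norm_num))
  obtain ⟨m0, hm0⟩ := Filter.eventually_atTop.1 h4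
  refine ⟨max m0 1, le_max_right _ _, fun m hm => ?_⟩
  have := hm0 m (le_trans (le_max_left _ _) hm)
  have hm1 : (1 : ℝ) ≤ m := by exact_mod_cast (le_trans (le_max_right _ _) hm)
  simp only [Function.comp] at this
  have h5 := mul_le_mul_of_nonneg_left this.le (by linarith : (0 : ℝ) ≤ m)
  have h6 : (m : ℝ) ≠ 0 := by linarith
  field_simp at h5
  nlinarith [h5]

lemma node_base' (n : ℕ) : ∃ m0 : ℕ, 1 ≤ m0 ∧ ∀ m : ℕ, m0 ≤ m → ∀ (A : Type) [CommRing A] [IsDomain A] [CharZero A]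
    (π : MP (Fin n) ℤ →+* A)
    (hJ : IsTranscendenceBasis ℤ (fun j : Fin n => π (X j)))
    (P : MP (Fin (n + 1) × Mon n m) ℤ) (δ0 δ1 : ℕ) (hP : IsNode n π P δ0 δ1),
    δ0 ≤ m ^ n ∧ m * δ1 ≤ m ^ n ∧ lS P ≤ m ^ n * (log (n + 1) + 2) := by
  obtain ⟨m0, h1, h2⟩ := log_lim n
  refine ⟨m0, h1, fun m hm A _ _ _ π hJ P δ0 δ1 hP => ?_⟩
  obtain ⟨r1, r2, r3⟩ := node_base (h1.trans hm) π hJ P δ0 δ1 hP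
  refine ⟨r1, r2, ?_⟩
  have hl := h2 m hm
  have hm1 : (1 : ℝ) ≤ m := by exact_mod_cast h1.trans hm
  set N := Fintype.card (Mon n ((n + 1) * m)) with hN
  have hNle : N ≤ ((n + 2) * m) ^ n := by
    have : N ≤ Fintype.card (Fin n → Fin ((n + 1) * m + 1)) := Fintype.card_subtype_le _
    simp at this
    refine this.trans (Nat.pow_le_pow_left ?_ n)
    have : 1 ≤ m := h1.trans hm
    nlinarith
  have hN1 : 1 ≤ N := Fintype.card_pos_iff.2 ⟨Mon.z⟩
  have hNR : (N : ℝ) ≤ ((n + 2) ^ n * m ^ n) := by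
    rw [← mul_pow]; exact_mod_cast hNle
  have hlog : log N ≤ n * (log (n + 2) + log m) := by
    rw [← log_mul (by positivity) (by positivity), ← log_pow]
    apply log_le_log (by exact_mod_cast hN1)
    rw [mul_pow]; exact hNR
  have hl2 : 0 ≤ log 2 := log_nonneg (by norm_num)
  have hl21 : log 2 ≤ 1 := by have := Real.log_two_lt_d9; linarith
  have hlN : 0 ≤ log N := log_nonneg (by exact_mod_cast hN1)
  have a1 : (N : ℝ) * log 2 + N * log N ≤ ((n + 2) ^ n * m ^ n) * (log 2 + n * (log (n + 2) + log m)) := by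
    rw [← mul_add]
    gcongr
  have mp : (0 : ℝ) < m ^ n := by positivity
  have a2 := mul_le_mul_of_nonneg_left hl mp.le
  have a3 : (m : ℝ) * m ^ n * log 2 ≤ m * m ^ n * 1 := by gcongr
  refine le_of_mul_le_mul_left (a := (m : ℝ)) ?_ (by linarith)
  nlinarith

end M10

section M11
open MvPolynomial
open Finset (card_erase_of_mem univ)
open Real (log)

variable {A : Type} [CommRing A] [IsDomain A] [CharZero A]

noncomputable def famc {n m d : ℕ} (hm : 1 ≤ m) (J : Fin d → Fin n) (k : ℕ) (b : Fin (d + 1)) :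
    Mon n m → MP (Fin n) ℤ :=
  Fin.cases lin (fun i => if (i : ℕ) < k then pen (Mon.e hm (J i)) (X (J i)) else Mon.pol) b

lemma famc_z {n m d : ℕ} (hm : 1 ≤ m) (J : Fin d → Fin n) (k : ℕ) (b : Fin (d + 1)) :
    famc hm J k b Mon.z = 1 := by
  refine Fin.cases ?_ (fun i => ?_) b
  · exact lin_z
  · simp only [famc, Fin.cases_succ]
    split_ifs; exacts [pen_z _ _, Mon.z_pol]

lemma famc_zero {n m d : ℕ} (hm : 1 ≤ m) (J : Fin d → Fin n) : famc hm J 0 = fam d := by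
  funext b
  refine Fin.cases ?_ (fun i => ?_) b
  · simp [famc, fam]
  · simp [famc, fam, Fin.succ_ne_zero]

lemma famc_e {n m d : ℕ} (hm : 1 ≤ m) (J : Fin d → Fin n) (k : ℕ) (i : Fin d) :
    famc hm J k i.succ (Mon.e hm (J i)) = X (J i) := by
  simp only [famc, Fin.cases_succ]
  split_ifs; exacts [pen_s1 _ (Mon.e_ne _ _) _, Mon.e_pol _ _]

lemma famc_hind {n m d : ℕ} (hm : 1 ≤ m) (π : MP (Fin n) ℤ →+* A) (k : ℕ) (i0 : Fin (d + 1))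
    (J : Fin d → Fin n) (hJ : IsTranscendenceBasis ℤ (fun b => π (X (J b)))) :
    ∃ Jm : Fin (d + 1) → Mon n m, (∀ b, b ≠ i0 → Jm b ≠ Mon.z) ∧
      IsTranscendenceBasis ℤ (fun b : {b : Fin (d + 1) // b ≠ i0} => π (famc hm J k b (Jm b))) := by
  let σ : {b : Fin (d + 1) // b ≠ i0} ≃ Fin d :=
    (Equiv.subtypeEquiv (Equiv.swap 0 i0) (fun b => by
      rw [not_iff_not, Equiv.swap_apply_eq_iff, Equiv.swap_apply_left])).trans (finSuccAboveEquiv (0 : Fin (d + 1))).symm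
  have hσ : ∀ b, (σ b).succ = Equiv.swap 0 i0 b.1 := by
    intro b
    have : ((finSuccAboveEquiv (0 : Fin (d + 1))) (σ b)).1 = Equiv.swap 0 i0 b.1 := by
      simp [σ]
    rw [← this]
    simp [finSuccAboveEquiv_apply]
  refine hind_of hm π _ i0 J hJ σ (fun b => ?_)
  by_cases h0 : b.1 = 0
  · rw [h0]; exact lin_e _ _
  · have := hσ b
    rw [Equiv.swap_apply_of_ne_of_ne h0 b.2] at this
    rw [← this]
    exact famc_e _ _ _ _

lemma famc_gen {n m d : ℕ} (hm : 1 ≤ m) (π : MP (Fin n) ℤ →+* A) (k : ℕ)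
    (J : Fin d → Fin n) (hJ : IsTranscendenceBasis ℤ (fun b => π (X (J b)))) :
    ∃ (P : MP (Fin (d + 1) × Mon n m) ℤ) (δ : Fin (d + 1) → ℕ),
      IsGen (fun b s => π (famc hm J k b s)) P ∧ IsBH Prod.fst δ P ∧ ∀ b, 0 < δ b := by
  obtain ⟨Jm, h1, h2⟩ := famc_hind hm π k 0 J hJ
  obtain ⟨P, hP⟩ := exists_gen (fun b s => π (famc hm J k b s)) Mon.z (fun b => by simp [famc_z]) 0 Jm h1 h2
  obtain ⟨δ, hδ⟩ := hP.exists_isBH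
  refine ⟨P, δ, hP, hδ, fun b => ?_⟩
  obtain ⟨Jm, h1, h2⟩ := famc_hind hm π k b J hJ
  exact hP.pos Mon.z (fun b => by simp [famc_z]) b Jm h1 h2 hδ

lemma chain_aux {n m d : ℕ} (hm : 1 ≤ m) (π : MP (Fin n) ℤ →+* A)
    (J : Fin d → Fin n) (hJ : IsTranscendenceBasis ℤ (fun b => π (X (J b))))
    {P : MP (Fin (d + 1) × Mon n m) ℤ} {δ0 δ1 : ℕ} (hP : IsNode d π P δ0 δ1) (k : ℕ) (hk : k ≤ d) :
    ∀ (Q : MP (Fin (d + 1) × Mon n m) ℤ) (δ : Fin (d + 1) → ℕ),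
      IsGen (fun b s => π (famc hm J k b s)) Q → IsBH Prod.fst δ Q →
      m ^ k * δ 0 ≤ δ0 ∧ (∀ i : Fin d, m ^ k * δ i.succ ≤ m * δ1) ∧ (∀ i : Fin d, k ≤ i → m ^ k * δ i.succ ≤ δ1) ∧
      m ^ k * lS Q ≤ lS P + log 2 * (k * (δ0 + (d + 1) * m * δ1)) := by
  classical
  have hl2 : 0 ≤ log 2 := Real.log_nonneg (by norm_num)
  induction k with
  | zero =>
    intro Q δ hQ hδ
    rw [famc_zero] at hQ
    have d1 : P ∣ Q := (hP.isGen.2 Q).1 ((hQ.2 Q).2 dvd_rfl)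
    have d2 : Q ∣ P := (hQ.2 P).1 ((hP.isGen.2 P).2 dvd_rfl)
    have e : ∀ b, δ b = dl δ0 δ1 b := fun b => le_antisymm
      (hδ.le_of_dvd hP.isBH hP.isGen.1.ne_zero d2 b) (hP.isBH.le_of_dvd hδ hQ.1.ne_zero d1 b)
    have hs : supS Q = supS P := by
      obtain ⟨u, hu⟩ := associated_of_dvd_dvd d2 d1
      obtain ⟨r, hr, hr'⟩ := MvPolynomial.isUnit_iff_eq_C_of_isReduced.1 u.isUnit
      rw [← hu, hr']
      rcases Int.isUnit_iff.1 hr with rfl | rfl <;> simp [supS]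
    refine ⟨by simp [e, dl], fun i => ?_, fun i _ => by simp [e, dl, Fin.succ_ne_zero], ?_⟩
    · simp [e, dl, Fin.succ_ne_zero]; nlinarith
    · simp [lS, hs]
  | succ k ih =>
    intro Q' δ' hQ' hδ'
    have ih := ih (by omega)
    obtain ⟨Q, δ, hQ, hδ, -⟩ := famc_gen (m := m) hm π k J hJ
    obtain ⟨i1, i2, i3, i4⟩ := ih Q δ hQ hδ
    let i : Fin d := ⟨k, by omega⟩
    obtain ⟨Jm, h1, h2⟩ := famc_hind hm π k i.succ J hJ
    obtain ⟨r1, r2, r3⟩ := replace_log (e := m) (D' := 1) π (famc hm J k) (famc hm J (k + 1)) (famc_z _ _ _) (famc_z _ _ _)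
      i.succ (fun b => by
        refine Fin.cases ?_ (fun j => ?_) b
        · intro _; rfl
        · intro hj
          have : (j : ℕ) ≠ k := fun h => hj (by rw [Fin.succ_inj]; exact Fin.ext h)
          simp only [famc, Fin.cases_succ]
          have : (j : ℕ) < k + 1 ↔ (j : ℕ) < k := by omega
          simp only [this])
      (by simp [famc, i]) (fun s => by
        simp only [famc, Fin.cases_succ, i, Nat.lt_succ_self, if_true]
        exact pen_deg _ _ (by simp) s) (by simp) (by omega) 2 (by norm_num) (by
        simp only [famc, Fin.cases_succ, i, Nat.lt_succ_self, if_true]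
        refine (L1_pen _ _).trans ?_
        have := L1_monomial (Finsupp.single (J ⟨k, by omega⟩) 1)
        have hX : (X (J ⟨k, by omega⟩) : MP (Fin n) ℤ) = monomial (Finsupp.single (J ⟨k, by omega⟩) 1) 1 := rfl
        rw [hX]; linarith) Jm h1 h2 hQ hQ' hδ hδ'
    have n0 : ∀ j : Fin d, m ^ (k + 1) * δ' j.succ ≤ m * δ1 ∧ (k + 1 ≤ j → m ^ (k + 1) * δ' j.succ ≤ δ1) := by
      intro j
      by_cases hj : j = i
      · subst hj
        refine ⟨?_, fun h => absurd h (by simp [i])⟩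
        have := i3 i le_rfl
        calc m ^ (k + 1) * δ' i.succ = m * (m ^ k * δ' i.succ) := by ring
          _ ≤ m * (m ^ k * δ i.succ) := by gcongr
          _ ≤ _ := by gcongr
      · have := r2 j.succ (by rw [Ne, Fin.succ_inj]; exact hj)
        have e : m ^ (k + 1) * δ' j.succ = m ^ k * (m * δ' j.succ) := by ring
        rw [e]
        exact ⟨(Nat.mul_le_mul_left _ this).trans (i2 j), fun h => (Nat.mul_le_mul_left _ this).trans (i3 j (by omega))⟩
    refine ⟨?_, fun j => (n0 j).1, fun j => (n0 j).2, ?_⟩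
    · have := r2 0 (Fin.succ_ne_zero _).symm
      calc m ^ (k + 1) * δ' 0 = m ^ k * (m * δ' 0) := by ring
        _ ≤ m ^ k * δ 0 := by gcongr
        _ ≤ _ := i1
    · have q1 : (m : ℝ) ^ k * δ i.succ ≤ δ1 := by exact_mod_cast i3 i le_rfl
      have q2 : (m : ℝ) ^ k * ∑ b ∈ univ.erase i.succ, (δ b : ℝ) ≤ δ0 + (d - 1) * (m * δ1) := by
        have : i.succ ∈ (univ : Finset (Fin (d + 1))) := Finset.mem_univ _
        rw [Finset.mul_sum, ← Finset.add_sum_erase _ _ (show (0 : Fin (d + 1)) ∈ univ.erase i.succ by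
          simp [(Fin.succ_ne_zero i).symm])]
        have c1 : (m : ℝ) ^ k * δ 0 ≤ δ0 := by exact_mod_cast i1
        have c2 : ∑ x ∈ (univ.erase i.succ).erase 0, (m : ℝ) ^ k * δ x ≤ (d - 1) * (m * δ1) := by
          refine (Finset.sum_le_card_nsmul _ _ (m * δ1 : ℝ) ?_).trans ?_
          · intro x hx
            have hx0 : x ≠ 0 := Finset.ne_of_mem_erase hx
            obtain ⟨j, rfl⟩ := Fin.exists_succ_eq.2 hx0
            exact_mod_cast i2 j
          · rw [card_erase_of_mem (by simp [(Fin.succ_ne_zero i).symm]), card_erase_of_mem (by simp)]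
            simp only [Finset.card_univ, Fintype.card_fin, nsmul_eq_mul]
            have : 1 ≤ d := by omega
            have : ((d + 1 - 1 - 1 : ℕ) : ℝ) = d - 1 := by
              rw [Nat.add_sub_cancel]; push_cast [this]; ring
            rw [this]
        linarith
      have m1 : (0 : ℝ) ≤ m := Nat.cast_nonneg m
      have mk : (0 : ℝ) ≤ (m : ℝ) ^ k := by positivity
      have r4 := mul_le_mul_of_nonneg_left r3 mk
      have q3 := mul_le_mul_of_nonneg_left q1 m1
      have q4 : (m : ℝ) ^ k * (m * δ i.succ + m * δ i.succ + ∑ b ∈ univ.erase i.succ, (δ b : ℝ)) ≤ δ0 + (d + 1) * m * δ1 := by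
        nlinarith
      have q5 := mul_le_mul_of_nonneg_left q4 hl2
      calc (m : ℝ) ^ (k + 1) * lS Q' = m ^ k * (m * lS Q') := by ring
        _ ≤ _ := r4
        _ = m ^ k * lS Q + log 2 * ((m : ℝ) ^ k * (m * δ i.succ + m * δ i.succ + ∑ b ∈ univ.erase i.succ, (δ b : ℝ))) := by ring
        _ ≤ (lS P + log 2 * (k * (δ0 + (d + 1) * m * δ1))) + log 2 * (δ0 + (d + 1) * m * δ1) := add_le_add i4 q5
        _ = _ := by push_cast; ring

lemma chain {n m d : ℕ} (hm : 1 ≤ m) (π : MP (Fin n) ℤ →+* A)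
    (J : Fin d → Fin n) (hJ : IsTranscendenceBasis ℤ (fun b => π (X (J b))))
    {P : MP (Fin (d + 1) × Mon n m) ℤ} {δ0 δ1 : ℕ} (hP : IsNode d π P δ0 δ1) :
    ∃ (Q : MP (Fin (d + 1) × Mon n m) ℤ) (δ : Fin (d + 1) → ℕ),
      IsGen (fun b s => π (famc hm J d b s)) Q ∧ IsBH Prod.fst δ Q ∧ (∀ b, 0 < δ b) ∧
      m ^ d * δ 0 ≤ δ0 ∧ (∀ i : Fin d, m ^ d * δ i.succ ≤ m * δ1) ∧
      m ^ d * lS Q ≤ lS P + log 2 * (d * (δ0 + (d + 1) * m * δ1)) := by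
  obtain ⟨Q, δ, h1, h2, h3⟩ := famc_gen (m := m) hm π d J hJ
  obtain ⟨r1, r2, -, r4⟩ := chain_aux hm π J hJ hP d le_rfl Q δ h1 h2
  exact ⟨Q, δ, h1, h2, h3, r1, r2, r4⟩

end M11

section M12
open MvPolynomial
open Algebra (trdeg)

lemma alg_of_integral {s : ℕ} {B : Type} [CommRing B] [IsDomain B] [Algebra ℚ B]
    (g : MP (Fin s) ℚ →ₐ[ℚ] B) (hint : g.toRingHom.IsIntegral) :
    Algebra.IsAlgebraic (Algebra.adjoin ℚ (Set.range (fun i => g (X i)))) B := by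
  have hg : ∀ P, g P ∈ Algebra.adjoin ℚ (Set.range (fun i => g (X i))) := by
    intro P
    rw [Algebra.adjoin_range_eq_range_aeval]
    refine ⟨P, ?_⟩
    rw [AlgHom.toRingHom_eq_coe, AlgHom.coe_toRingHom]
    have : (aeval fun i => g (X i)) = g := by ext i; simp
    rw [this]
  let g' : MP (Fin s) ℚ →+* Algebra.adjoin ℚ (Set.range (fun i => g (X i))) :=
    (g.codRestrict _ hg).toRingHom
  refine ⟨fun b => ?_⟩
  obtain ⟨p, hp, hpb⟩ := hint b
  refine ⟨p.map g', (hp.map g').ne_zero, ?_⟩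
  rw [Polynomial.aeval_def, Polynomial.eval₂_map]
  exact hpb

lemma trdeg_le_of_integral {s : ℕ} {B : Type} [CommRing B] [IsDomain B] [Algebra ℚ B]
    (g : MP (Fin s) ℚ →ₐ[ℚ] B) (hint : g.toRingHom.IsIntegral) (hs : (s : Cardinal) ≤ trdeg ℚ B) :
    Function.Injective g := by
  have := alg_of_integral g hint
  have h := Algebra.IsAlgebraic.isTranscendenceBasis_of_le_trdeg_of_finite ℚ (fun i : Fin s => g (X i)) (by simpa using hs)
  have h1 := h.1
  rw [AlgebraicIndependent] at h1
  have e : (aeval fun i => g (X i)) = g := by ext i; simp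
  rwa [e] at h1

lemma trdeg_drop {A : Type} [CommRing A] [IsDomain A] [Algebra ℚ A] [Algebra.FiniteType ℚ A]
    (f : A) (hf : f ≠ 0) (q : Ideal A) (hq : q ∈ (Ideal.span {f}).minimalPrimes) (d : ℕ)
    (hd : trdeg ℚ A = d) : ∃ d', d = d' + 1 ∧ ∀ _ : q.IsPrime, trdeg ℚ (A ⧸ q) = d' := by
  have hqp : q.IsPrime := hq.1.1
  have hfq : f ∈ q := hq.1.2 (Ideal.subset_span rfl)
  obtain ⟨s, g, hinj, hfin⟩ := exists_finite_inj_algHom_of_fg ℚ A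
  have hint : g.toRingHom.IsIntegral := RingHom.IsIntegral.of_finite hfin
  have hsd : s = d := by
    have h1 : AlgebraicIndependent ℚ (fun i => g (X i)) := by
      rw [AlgebraicIndependent]
      have e : (aeval fun i => g (X i)) = g := by ext i; simp
      rwa [e]
    have h2 := h1.cardinalMk_le_trdeg
    have := alg_of_integral g hint
    have h3 := Algebra.IsAlgebraic.trdeg_le_cardinalMk ℚ (A := A) (Set.range (fun i => g (X i)))
    have h4 : Cardinal.mk (Set.range (fun i => g (X i))) ≤ Cardinal.mk (Fin s) := Cardinal.mk_range_le
    have h5 := h3.trans h4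
    rw [hd] at h2 h5
    simp at h2 h5
    omega
  subst hsd
  have : IsNoetherianRing A := Algebra.FiniteType.isNoetherianRing ℚ A
  letI : Algebra (MP (Fin s) ℚ) A := g.toRingHom.toAlgebra
  have hmap : algebraMap (MP (Fin s) ℚ) A = g.toRingHom := rfl
  haveI : Algebra.IsIntegral (MP (Fin s) ℚ) A := ⟨hint⟩
  haveI : FaithfulSMul (MP (Fin s) ℚ) A := (faithfulSMul_iff_algebraMap_injective _ _).2 hinj
  have hqbot : q ≠ ⊥ := fun h => hf (by rw [h] at hfq; simpa using hfq)
  have hht : q.height ≤ 1 := Ideal.height_le_one_of_isPrincipal_of_mem_minimalPrimes (Ideal.span {f}) q hq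
  let q0 := q.under (MP (Fin s) ℚ)
  have hq0 : q0 ≠ ⊥ := fun h => hqbot (Ideal.eq_bot_of_comap_eq_bot h)
  haveI : q0.IsPrime := Ideal.IsPrime.under _ q
  obtain ⟨g0, hg0, hg0p⟩ := Ideal.IsPrime.exists_mem_prime_of_ne_bot ‹q0.IsPrime› hq0
  have hspan : Ideal.span {g0} = q0 := by
    by_contra hne
    have hlt : Ideal.span {g0} < q0 := lt_of_le_of_ne ((Ideal.span_singleton_le_iff_mem _).2 hg0) hne
    haveI : (Ideal.span {g0}).IsPrime := (Ideal.span_singleton_prime hg0p.ne_zero).2 hg0p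
    haveI : q.LiesOver q0 := ⟨rfl⟩
    obtain ⟨P, hP, hPp, hPo⟩ := Ideal.exists_ideal_lt_liesOver_of_lt q hlt
    have hPb : (⊥ : Ideal A) < P := by
      rw [bot_lt_iff_ne_bot]
      rintro rfl
      have := hPo.over
      have h2 : g0 ∈ (⊥ : Ideal A).under (MP (Fin s) ℚ) := this ▸ Ideal.subset_span rfl
      rw [Ideal.mem_comap, Ideal.mem_bot] at h2
      exact hg0p.ne_zero (hinj (by rw [map_zero]; exact h2))
    have h1 : (⊥ : Ideal A).height + 1 ≤ P.height := Ideal.height_add_one_le_of_lt_of_isPrime hPb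
    have h2 : P.height + 1 ≤ q.height := Ideal.height_add_one_le_of_lt_of_isPrime hP
    have h3 : P.height ≤ 0 := by
      have := h2.trans hht
      exact (ENat.add_le_add_iff_right (by simp : (1:ℕ∞) ≠ ⊤)).1 (by simpa using this)
    have h4 := h1.trans h3
    simp at h4
  let g1 : MP (Fin s) ℚ →ₐ[ℚ] A ⧸ q := (Ideal.Quotient.mkₐ ℚ q).comp g
  have hker : ∀ P, g1 P = 0 ↔ g0 ∣ P := by
    intro P
    rw [← Ideal.mem_span_singleton, hspan]
    exact Ideal.Quotient.eq_zero_iff_mem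
  have hint1 : g1.toRingHom.IsIntegral := hint.trans _ _ (RingHom.isIntegral_of_surjective _ (Ideal.Quotient.mkₐ_surjective ℚ q))
  have hlt : ¬ (s : Cardinal) ≤ trdeg ℚ (A ⧸ q) := by
    intro h
    have := trdeg_le_of_integral g1 hint1 h
    exact hg0p.ne_zero (this (by rw [map_zero]; exact (hker _).2 dvd_rfl))
  have hvar : ∃ i, g0.degreeOf i ≠ 0 := by
    by_contra! h
    have h0 : g0 = C (coeff 0 g0) := by
      rw [← vars_eq_empty_iff_eq_C, Finset.eq_empty_iff_forall_notMem]
      intro j hj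
      exact mem_vars_iff_degreeOf_ne_zero.1 hj (h j)
    have h1 : IsUnit g0 := by
      rw [h0]
      apply IsUnit.map C
      rw [isUnit_iff_ne_zero]
      intro h2
      rw [h2, map_zero] at h0
      exact hg0p.ne_zero h0
    exact hg0p.not_unit h1
  obtain ⟨i, hi⟩ := hvar
  have hge : AlgebraicIndependent ℚ (fun j : {j // j ≠ i} => g1 (X j.1)) := by
    rw [AlgebraicIndependent, injective_iff_map_eq_zero]
    intro P hP
    have e : (aeval (fun j : {j // j ≠ i} => g1 (X j.1))) = g1.comp (rename Subtype.val) := by ext j; simp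
    rw [e, AlgHom.comp_apply, hker] at hP
    obtain ⟨R, hR⟩ := hP
    by_contra hP0
    have hP1 : rename (Subtype.val : {j // j ≠ i} → Fin s) P ≠ 0 := fun h => hP0 (rename_injective _ Subtype.val_injective (by rw [h, map_zero]))
    have hR0 : R ≠ 0 := fun h => hP1 (by rw [hR, h, mul_zero])
    have hd0 : (rename (Subtype.val : {j // j ≠ i} → Fin s) P).degreeOf i = 0 := by
      by_contra h
      have := vars_rename (Subtype.val : {j // j ≠ i} → Fin s) P
      have h2 : i ∈ (rename (Subtype.val : {j // j ≠ i} → Fin s) P).vars := by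
        rw [vars_def, Multiset.mem_toFinset, ← Multiset.count_ne_zero]
        rw [degreeOf_def] at h
        convert h
      have h3 := this h2
      simp at h3
    rw [hR, degreeOf_mul_eq hg0p.ne_zero hR0] at hd0
    omega
  have hge' := hge.cardinalMk_le_trdeg
  have hc : Cardinal.mk {j : Fin s // j ≠ i} = (s - 1 : ℕ) := by
    rw [Cardinal.mk_fintype, Fintype.card_subtype_compl]; simp
  rw [hc] at hge'
  have hs1 : 1 ≤ s := i.pos
  refine ⟨s - 1, by omega, fun _ => ?_⟩
  push Not at hlt
  obtain ⟨t, ht⟩ := Cardinal.lt_aleph0.1 (hlt.trans (Cardinal.natCast_lt_aleph0))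
  rw [ht] at hlt hge' ⊢
  norm_cast at hlt hge' ⊢
  omega

end M12

section M13
open MvPolynomial
open Int (castRingHom)
open Algebra (trdeg)

abbrev RQ (n : ℕ) := MP (Fin n) ℚ

noncomputable def pr {n : ℕ} (p : Ideal (RQ n)) : MP (Fin n) ℤ →+* RQ n ⧸ p :=
  (Ideal.Quotient.mk p).comp (map (castRingHom ℚ))

lemma pr_eq_zero {n : ℕ} (p : Ideal (RQ n)) (f) : pr p f = 0 ↔ map (castRingHom ℚ) f ∈ p :=
  Ideal.Quotient.eq_zero_iff_mem

lemma pr_X {n : ℕ} (p : Ideal (RQ n)) (j) : pr p (X j) = Ideal.Quotient.mk p (X j) := by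
  simp [pr]

lemma quot_charZero {n : ℕ} (p : Ideal (RQ n)) (hp : p.IsPrime) : CharZero (RQ n ⧸ p) :=
  algebraRat.charZero _

lemma int_rat_basis : IsTranscendenceBasis ℤ (Empty.elim : Empty → ℚ) := by
  rw [isTranscendenceBasis_iff_algebraicIndependent_isAlgebraic]
  refine ⟨algebraicIndependent_empty_type_iff.2 Int.cast_injective, ?_⟩
  have : Algebra.IsAlgebraic ℤ ℚ := IsFractionRing.comap_isAlgebraic_iff (A := ℤ) (K := ℚ) (C := ℚ) |>.2 inferInstance
  exact Algebra.IsAlgebraic.extendScalars (R := ℤ) (fun a b h => by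
    have := congrArg Subtype.val h
    simpa using this)

lemma exists_basis_abs {n : ℕ} {B : Type} [CommRing B] [IsDomain B] [Algebra ℚ B]
    (φ : RQ n →ₐ[ℚ] B) (hφ : Function.Surjective φ) (d : ℕ) (hd : trdeg ℚ B = d) :
    ∃ J : Fin d → Fin n, IsTranscendenceBasis ℤ (fun b => φ (X (J b))) := by
  have halg : Algebra.IsAlgebraic (Algebra.adjoin ℚ (Set.range fun j => φ (X j))) B :=
    alg_of_integral φ (RingHom.isIntegral_of_surjective _ hφ)
  obtain ⟨t, ht, htb⟩ := exists_isTranscendenceBasis_subset (R := ℚ) (Set.range fun j => φ (X j))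
  have hcard := htb.cardinalMk_eq_trdeg
  rw [hd] at hcard
  have e : Nonempty (Fin d ≃ t) := by
    have : Cardinal.mk (Fin d) = Cardinal.mk t := by rw [hcard]; simp
    exact Cardinal.eq.1 this
  obtain ⟨e⟩ := e
  have hJ : ∀ b : Fin d, ∃ j, φ (X j) = (e b).1 := fun b => ht (e b).2
  choose J hJ using hJ
  refine ⟨J, ?_⟩
  have h1 : IsTranscendenceBasis ℚ (fun b => φ (X (J b))) := by
    have : (fun b => φ (X (J b))) = (Subtype.val : t → _) ∘ e := by
      funext b
      rw [hJ]; rfl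
    rw [this]
    exact (isTranscendenceBasis_equiv e).2 htb
  have h2 := int_rat_basis.sumElim_comp h1
  have h3 := (isTranscendenceBasis_equiv (Equiv.sumEmpty (Fin d) Empty).symm).2 h2
  convert h3
  rfl

lemma exists_basis {n : ℕ} (p : Ideal (RQ n)) (hp : p.IsPrime) (d : ℕ)
    (hd : trdeg ℚ (RQ n ⧸ p) = d) :
    ∃ J : Fin d → Fin n, IsTranscendenceBasis ℤ (fun b => pr p (X (J b))) := by
  obtain ⟨J, hJ⟩ := exists_basis_abs (Ideal.Quotient.mkₐ ℚ p) (Ideal.Quotient.mkₐ_surjective ℚ p) d hd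
  refine ⟨J, ?_⟩
  convert hJ using 2
  · exact Subsingleton.elim _ _
  · exact pr_X _ _

lemma drop {n : ℕ} (p : Ideal (RQ n)) (hp : p.IsPrime) (f : RQ n) (hf : f ∉ p) (d : ℕ)
    (hd : trdeg ℚ (RQ n ⧸ p) = d) (q : Ideal (RQ n)) (hq : q ∈ (Ideal.span {f} ⊔ p).minimalPrimes) :
    ∃ d', d = d' + 1 ∧ trdeg ℚ (RQ n ⧸ q) = d' := by
  have hpq : p ≤ q := le_sup_right.trans hq.1.2
  have h1 : q.map (Ideal.Quotient.mk p) ∈ (Ideal.span {Ideal.Quotient.mk p f}).minimalPrimes := by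
    have := Ideal.minimalPrimes_map_of_surjective (Ideal.Quotient.mk_surjective (I := p)) (Ideal.span {f})
    rw [Ideal.map_span, Set.image_singleton, Ideal.mk_ker] at this
    rw [this]
    exact ⟨q, hq, rfl⟩
  obtain ⟨d', h2, h3⟩ := trdeg_drop (Ideal.Quotient.mk p f) (fun h => hf (Ideal.Quotient.eq_zero_iff_mem.1 h)) _ h1 d hd
  refine ⟨d', h2, ?_⟩
  rw [← h3 h1.1.1]
  exact ((DoubleQuot.quotQuotEquivQuotOfLEₐ ℚ hpq).trdeg_eq).symm

end M13

section M14
open MvPolynomial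
open Finset (add_sum_erase mem_erase mem_univ sum_add_distrib sum_congr sum_eq_zero)
open Int (castRingHom)

lemma chain_rule {V V' A : Type} [Fintype V] [CommRing A] (w : V → MP V' A) (i : V')
    (P : MP V ℤ) :
    pderiv i (ev w P) = ∑ v, ev w (pderiv v P) * pderiv i (w v) := by
  classical
  induction P using MvPolynomial.induction_on with
  | C a =>
    have h1 : ev w (C a) = C (a : A) := by
      rw [show ev w (C a) = _ from eval₂Hom_C _ _ _]; simp
    rw [h1, pderiv_C]
    symm
    apply sum_eq_zero
    intro v _
    rw [pderiv_C, map_zero, zero_mul]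
  | add p q hp hq =>
    rw [map_add, map_add, hp, hq, ← sum_add_distrib]
    apply sum_congr rfl
    intro v _
    rw [map_add, map_add, add_mul]
  | mul_X p v0 hp =>
    have h1 : ev w (X v0) = w v0 := eval₂Hom_X' _ _ _
    rw [map_mul, pderiv_mul, hp, h1]
    have h2 : ∀ v, ev w (pderiv v (p * X v0)) * pderiv i (w v) =
        ev w (pderiv v p) * pderiv i (w v) * w v0 + (if v0 = v then ev w p * pderiv i (w v) else 0) := by
      intro v
      rw [pderiv_mul, map_add, map_mul, map_mul, h1]
      by_cases h : v0 = v
      · subst h; rw [pderiv_X_self, map_one, if_pos rfl]; ring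
      · rw [pderiv_X_of_ne h, map_zero, if_neg h]; ring
    rw [sum_congr rfl (fun v _ => h2 v), sum_add_distrib, Finset.sum_ite_eq, if_pos (mem_univ _), Finset.sum_mul]

lemma deriv_rel {V V' A : Type} [Fintype V] [CommRing A] (w : V → MP V' A) (i : V')
    (P : MP V ℤ) (hP : ev w P = 0) (v0 v1 : V) (h01 : v0 ≠ v1) (c : MP V' A) (h0 : pderiv i (w v0) = c)
    (h1 : pderiv i (w v1) = 1) (h : ∀ v, v ≠ v0 → v ≠ v1 → pderiv i (w v) = 0) :
    ev w (pderiv v0 P) * c + ev w (pderiv v1 P) = 0 := by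
  classical
  have := chain_rule w i P
  rw [hP, map_zero, ← add_sum_erase _ _ (mem_univ v0),
    ← add_sum_erase _ _ (mem_erase.2 ⟨h01.symm, mem_univ v1⟩), sum_eq_zero, h0, h1] at this
  · rw [this]; ring
  · intro v hv
    simp only [mem_erase] at hv
    rw [h v hv.2.1 hv.1, mul_zero]

lemma not_dvd_pderiv {V : Type} (P : MP V ℤ) (v : V) (hv : P.degreeOf v ≠ 0) :
    ¬ P ∣ pderiv v P := by
  classical
  have hP0 : P ≠ 0 := by rintro rfl; simp at hv
  have hlt : (pderiv v P).degreeOf v < P.degreeOf v := by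
    rw [degreeOf_lt_iff (Nat.pos_of_ne_zero hv)]
    intro m hm
    rw [mem_support_iff, coeff_pderiv] at hm
    have : m + Finsupp.single v 1 ∈ P.support := by
      rw [mem_support_iff]; exact left_ne_zero_of_mul hm
    have := monomial_le_degreeOf v this
    simp at this
    omega
  have hne : pderiv v P ≠ 0 := by
    rw [degreeOf_eq_sup] at hv
    have : ∃ m ∈ P.support, m v ≠ 0 := by
      by_contra! h
      exact hv (by rw [← Nat.le_zero, Finset.sup_le_iff]; intro b hb; rw [h b hb])
    obtain ⟨m, hm, hmv⟩ := this
    intro h0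
    have h1 := coeff_pderiv (i := v) P (m - Finsupp.single v 1)
    have h2 : m - Finsupp.single v 1 + Finsupp.single v 1 = m := by
      apply tsub_add_cancel_of_le
      rw [Finsupp.single_le_iff]; omega
    rw [h0, h2, coeff_zero] at h1
    rcases mul_eq_zero.1 h1.symm with h | h
    · exact (mem_support_iff.1 hm) h
    · norm_cast at h
  rintro ⟨R, hR⟩
  have hR0 : R ≠ 0 := by rintro rfl; rw [mul_zero] at hR; exact hne hR
  rw [hR, degreeOf_mul_eq hP0 hR0] at hlt
  omega

lemma homog {σ R : Type} [CommRing R] (g : MP σ R) :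
    ∃ N : ℕ, ∀ N' ≥ N, ∃ G : MP (Option σ) R, ∀ (B : Type) [CommRing B] (f : R →+* B) (y0 : B) (y a : σ → B),
      (∀ j, y j = y0 * a j) → eval₂ f (fun o => Option.elim o y0 y) G = y0 ^ N' * eval₂ f a g := by
  induction g using MvPolynomial.induction_on with
  | C r =>
    refine ⟨0, fun N' _ => ⟨C r * X none ^ N', ?_⟩⟩
    intro B _ f y0 y a h
    simp [mul_comm]
  | add p q hp hq =>
    obtain ⟨N1, h1⟩ := hp
    obtain ⟨N2, h2⟩ := hq
    refine ⟨max N1 N2, fun N' hN => ?_⟩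
    obtain ⟨G1, h1⟩ := h1 N' ((le_max_left _ _).trans hN)
    obtain ⟨G2, h2⟩ := h2 N' ((le_max_right _ _).trans hN)
    refine ⟨G1 + G2, ?_⟩
    intro B _ f y0 y a h
    rw [eval₂_add, eval₂_add, h1 B f y0 y a h, h2 B f y0 y a h]; ring
  | mul_X p j hp =>
    obtain ⟨N1, h1⟩ := hp
    refine ⟨N1 + 1, fun N' hN => ?_⟩
    obtain ⟨N', rfl⟩ : ∃ k, N' = k + 1 := ⟨N' - 1, by omega⟩
    obtain ⟨G1, h1⟩ := h1 N' (by omega)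
    refine ⟨G1 * X (some j), ?_⟩
    intro B _ f y0 y a h
    rw [eval₂_mul, eval₂_mul, h1 B f y0 y a h, eval₂_X, eval₂_X]
    simp only [Option.elim]
    rw [h j]; ring

variable {A : Type} [CommRing A] [IsDomain A] [CharZero A]

lemma pd_deg {n m d : ℕ} {π : MP (Fin n) ℤ →+* A}
    {P : MP (Fin (d + 1) × Mon n m) ℤ} (ψ : Fin (d + 1) → Mon n m → MP (Fin n) ℤ)
    (hz : ∀ b, ψ b Mon.z = 1) (hP : IsGen (fun b s => π (ψ b s)) P)
    (hJ : ∃ Jm : Fin (d + 1) → Mon n m, (∀ b, b ≠ 0 → Jm b ≠ Mon.z) ∧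
      IsTranscendenceBasis ℤ (fun b : {b : Fin (d + 1) // b ≠ 0} => π (ψ b (Jm b)))) :
    P.degreeOf ((0 : Fin (d+1)), Mon.z) ≠ 0 := by
  classical
  intro h0
  obtain ⟨Jm, hJm, hind⟩ := hJ
  have hvars : ((0 : Fin (d+1)), (Mon.z : Mon n m)) ∉ P.vars := by
    rw [mem_vars_iff_degreeOf_ne_zero]; simpa using h0
  obtain ⟨P1, hP1⟩ := exists_rename_eq_of_vars_subset_range P (Subtype.val : {v : Fin (d+1) × Mon n m // v ≠ (0, Mon.z)} → _)
    Subtype.val_injective (by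
      intro v hv
      simp only [Subtype.range_coe_subtype, Set.mem_setOf_eq]
      rintro rfl
      exact hvars hv)
  have := inK_ind (fun b s => π (ψ b s)) Mon.z (fun b => by rw [hz, map_one]) 0 Jm hJm hind.1 P1
    (by rw [hP1]; exact (hP.2 _).2 dvd_rfl)
  rw [this, map_zero] at hP1
  exact hP.1.ne_zero hP1.symm

lemma pd_core {n m d : ℕ} (hm : 1 ≤ m) {π' : MP (Fin n) ℤ →+* A}
    {P : MP (Fin (d + 1) × Mon n m) ℤ} (ψ : Fin (d + 1) → Mon n m → MP (Fin n) ℤ)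
    (hψ : ∀ b, ψ b Mon.z = 1) (he : ∀ j, ψ 0 (Mon.e hm j) = X j)
    (hdeg : P.degreeOf ((0 : Fin (d+1)), Mon.z) ≠ 0) (hP' : IsGen (fun b s => π' (ψ b s)) P) :
    ∃ g : Fin (d + 1) × Mon n m → MP (Fin (d + 1) × Mon n m) A,
      (∀ Q, P ∣ Q ↔ ev g Q = 0) ∧ ev g (pderiv ((0 : Fin (d+1)), Mon.z) P) ≠ 0 ∧
      ∀ j : Fin n, ev g (pderiv ((0 : Fin (d+1)), Mon.e hm j) P) = ev g (pderiv ((0 : Fin (d+1)), Mon.z) P) * C (π' (X j)) := by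
  classical
  have ha : ∀ b, (fun (b : Fin (d+1)) s => π' (ψ b (s : Mon n m))) b Mon.z = 1 := fun b => by
    show π' _ = 1
    rw [hψ, map_one]
  have key : ∀ Q, P ∣ Q ↔ ev (gen (fun (b : Fin (d+1)) s => π' (ψ b (s : Mon n m))) Mon.z) Q = 0 := fun Q => by
    rw [← hP'.2, inK_iff _ Mon.z ha]
  refine ⟨gen (fun (b : Fin (d+1)) s => π' (ψ b (s : Mon n m))) Mon.z, key, ?_⟩
  set g := gen (fun (b : Fin (d+1)) s => π' (ψ b (s : Mon n m))) Mon.z with hg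
  have hne : ev g (pderiv ((0 : Fin (d+1)), Mon.z) P) ≠ 0 := fun h => not_dvd_pderiv P _ hdeg ((key _).2 h)
  have hPz : ev g P = 0 := (key _).1 dvd_rfl
  refine ⟨hne, ?_⟩
  intro j
  have hz : ∀ b : Fin (d+1), pderiv ((0 : Fin (d+1)), Mon.e hm j) (g (b, Mon.z)) = if b = 0 then - C (π' (X j)) else 0 := by
    intro b
    have : g (b, Mon.z) = - ∑ s ∈ Finset.univ.erase Mon.z, C (π' (ψ b s)) * X (b, s) := by
      rw [hg, gen, if_pos rfl]
    rw [this, map_neg, map_sum]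
    split_ifs with hb
    · subst hb
      rw [Finset.sum_eq_single (Mon.e hm j)]
      · rw [pderiv_C_mul, pderiv_X_self, he, mul_one]
      · intro s _ hs
        rw [pderiv_C_mul, pderiv_X_of_ne (by simpa using hs), mul_zero]
      · intro h
        exact absurd (mem_erase.2 ⟨Mon.e_ne _ _, mem_univ _⟩) h
    · rw [sum_eq_zero, neg_zero]
      intro s _
      rw [pderiv_C_mul, pderiv_X_of_ne (by intro h; exact hb (Prod.ext_iff.1 h).1), mul_zero]
  have hX : ∀ b s, s ≠ Mon.z → g (b, s) = X (b, s) := by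
    intro b s hs
    rw [hg, gen, if_neg hs]
  have := deriv_rel g ((0 : Fin (d+1)), Mon.e hm j) P hPz (0, Mon.z) (0, Mon.e hm j)
    (by intro h; exact Mon.e_ne hm j (Prod.ext_iff.1 h).2.symm) (- C (π' (X j))) (by rw [hz, if_pos rfl])
    (by rw [hX _ _ (Mon.e_ne _ _), pderiv_X_self]) (by
      rintro ⟨b, s⟩ h1 h2
      by_cases hs : s = Mon.z
      · subst hs
        rw [hz, if_neg (by rintro rfl; exact h1 rfl)]
      · rw [hX _ _ hs, pderiv_X_of_ne h2])
  linear_combination this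

lemma IsNode.pd {n m d : ℕ} (hm : 1 ≤ m) {π : MP (Fin n) ℤ →+* A}
    {P : MP (Fin (d + 1) × Mon n m) ℤ} (hP : IsGen (fun b s => π (fam d b s)) P)
    {J : Fin d → Fin n} (hJ : IsTranscendenceBasis ℤ (fun b => π (X (J b)))) :
    ∀ f : MP (Fin n) ℤ, ∃ G : MP (Option (Fin n)) ℤ,
     ∀ (A' : Type) [CommRing A'] [IsDomain A'] [CharZero A'] (π' : MP (Fin n) ℤ →+* A'),
     IsGen (fun b s => π' (fam d b s)) P →
     (π' f = 0 ↔ P ∣ ev (fun o => Option.elim o (pderiv ((0 : Fin (d+1)), Mon.z) P) (fun j => pderiv ((0 : Fin (d+1)), Mon.e hm j) P)) G) := by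
  classical
  intro f
  obtain ⟨N, hN⟩ := homog f
  obtain ⟨G, hG⟩ := hN N le_rfl
  refine ⟨G, ?_⟩
  intro A' _ _ _ π' hP'
  have hdeg := pd_deg (fam d) fam_z hP (fam_hind (m := m) hm π 0 J hJ)
  obtain ⟨g, key, hne, hrel⟩ := pd_core hm (fam d) fam_z (fam_e hm 0) hdeg hP'
  rw [key, hom_ev]
  have e1 : (fun v => ev g (Option.elim v (pderiv ((0 : Fin (d+1)), Mon.z) P) (fun j => pderiv ((0 : Fin (d+1)), Mon.e hm j) P)))
     = fun v => Option.elim v (ev g (pderiv ((0 : Fin (d+1)), Mon.z) P)) (fun j => ev g (pderiv ((0 : Fin (d+1)), Mon.e hm j) P)) := by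
    funext v; cases v <;> rfl
  rw [e1]
  have := hG _ (castRingHom _) (ev g (pderiv ((0 : Fin (d+1)), Mon.z) P)) (fun j => ev g (pderiv ((0 : Fin (d+1)), Mon.e hm j) P))
    (fun j => C (π' (X j))) hrel
  rw [show ev (fun v => Option.elim v (ev g (pderiv ((0 : Fin (d+1)), Mon.z) P)) (fun j => ev g (pderiv ((0 : Fin (d+1)), Mon.e hm j) P))) G = _ from this]
  have e2 : eval₂ (castRingHom _) (fun j => C (π' (X j))) f = (C (π' f) : MP (Fin (d+1) × Mon n m) A') := by
    have := hom_ev ((C : A' →+* MP (Fin (d+1) × Mon n m) A').comp π') X f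
    rw [ev_X] at this
    exact this.symm
  rw [e2, mul_eq_zero, or_iff_right (pow_ne_zero _ hne)]
  exact (C_eq_zero (σ := Fin (d+1) × Mon n m)).symm

lemma ker_eq {n m d : ℕ} (hm : 1 ≤ m) {π : MP (Fin n) ℤ →+* A}
    {P P' : MP (Fin (d + 1) × Mon n m) ℤ} (hP : IsGen (fun b s => π (fam d b s)) P)
    {J : Fin d → Fin n} (hJ : IsTranscendenceBasis ℤ (fun b => π (X (J b))))
    {A' : Type} [CommRing A'] [IsDomain A'] [CharZero A'] {π' : MP (Fin n) ℤ →+* A'}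
    (hP' : IsGen (fun b s => π' (fam d b s)) P') (hd : P ∣ P') (f) : π f = 0 ↔ π' f = 0 := by
  have hd' : P' ∣ P := by
    have := (hP.1.irreducible.associated_of_dvd hP'.1.irreducible hd)
    exact this.symm.dvd
  have hP'' : IsGen (fun b s => π' (fam d b s)) P :=
    ⟨hP.1, fun Q => (hP'.2 Q).trans ⟨fun h => hd.trans h, fun h => hd'.trans h⟩⟩
  obtain ⟨G, hG⟩ := IsNode.pd hm hP hJ f
  rw [hG A π hP, hG A' π' hP'']

end M14

section M15
open MvPolynomial
open Finset (sum_eq_single univ)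
open Real (log)

variable {A : Type} [CommRing A] [IsDomain A] [CharZero A]

noncomputable def sp {d n m : ℕ} {B : Type} [CommRing B] (s1 : Mon n m) (u : Fin (d + 1) × Mon n m → B) (v : Fin (d + 2) × Mon n m) : B :=
  open Classical in
  if h : v.1 = Fin.last (d + 1) then (if v.2 = s1 then 1 else 0) else u (v.1.castPred h, v.2)

lemma sp_last {d n m : ℕ} {B : Type} [CommRing B] (s1 : Mon n m) (u : Fin (d + 1) × Mon n m → B) (s : Mon n m) :
    sp s1 u (Fin.last (d+1), s) = open Classical in (if s = s1 then 1 else 0) := by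
  simp [sp]

lemma sp_cast {d n m : ℕ} {B : Type} [CommRing B] (s1 : Mon n m) (u : Fin (d + 1) × Mon n m → B) (b : Fin (d + 1)) (s : Mon n m) :
    sp s1 u (b.castSucc, s) = u (b, s) := by
  rw [sp, dif_neg (Fin.castSucc_lt_last b).ne]
  simp

lemma hom_sp {d n m : ℕ} {B B' : Type} [CommRing B] [CommRing B'] (h : B →+* B') (s1 : Mon n m)
    (u : Fin (d + 1) × Mon n m → B) (v) : h (sp s1 u v) = sp s1 (fun v => h (u v)) v := by
  rcases v with ⟨b, s⟩
  induction b using Fin.lastCases with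
  | last => rw [sp_last, sp_last]; split_ifs <;> simp
  | cast b => rw [sp_cast, sp_cast]

lemma step_div {n m d e D : ℕ} (hm : 1 ≤ m) (he : e ≠ 0) (heD : e * D ≤ m) (π : MP (Fin n) ℤ →+* A)
    {P : MP (Fin (d + 2) × Mon n m) ℤ} {δ0 δ1 : ℕ} (hP : IsNode (d + 1) π P δ0 δ1)
    (f : MP (Fin n) ℤ) (hf : π f ≠ 0) (hfD : f.totalDegree ≤ D) :
    ∃ (N : MP (Fin (d + 1) × Mon n m) ℤ) (δ : Fin (d + 1) → ℕ), N ≠ 0 ∧ IsBH Prod.fst δ N ∧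
      (∀ b, e * δ b ≤ dl δ0 δ1 b) ∧
      e * lS N ≤ lS P + e * δ1 * log (1 + L1 f) + (e * δ1 + (δ0 + d * δ1)) * log 2 ∧
      ∀ (A' : Type) [CommRing A'] [IsDomain A'] [CharZero A'] (ρ : A →+* A'), ρ (π f) = 0 →
        ∀ P', IsGen (fun b s => (ρ.comp π) (fam d b s)) P' → P' ∣ N := by
  classical
  obtain ⟨J, hJ⟩ := hP.basis
  set s1 : Mon n m := Mon.e hm (J 0) with hs1
  have hs1z : s1 ≠ Mon.z := Mon.e_ne _ _
  set i0 : Fin (d + 2) := Fin.last (d + 1) with hi0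
  have hi00 : i0 ≠ 0 := by rw [hi0]; exact Fin.last_pos.ne'
  let ψ' : Fin (d + 2) → Mon n m → MP (Fin n) ℤ := fun b => if b = i0 then pen s1 f else fam (d + 1) b
  have hψ'i : ψ' i0 = pen s1 f := if_pos rfl
  have hψ'o : ∀ b, b ≠ i0 → ψ' b = fam (d + 1) b := fun b hb => if_neg hb
  have hψ'z : ∀ b, ψ' b Mon.z = 1 := by
    intro b
    by_cases hb : b = i0
    · rw [hb, hψ'i, pen_z]
    · rw [hψ'o b hb, fam_z]
  obtain ⟨Jm, h1, h2⟩ := fam_hind (m := m) hm π i0 J hJ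
  have h2' : IsTranscendenceBasis ℤ (fun b : {b : Fin (d + 2) // b ≠ i0} => π (ψ' b (Jm b))) := by
    have : (fun b : {b : Fin (d + 2) // b ≠ i0} => π (ψ' b (Jm b))) = (fun b : {b : Fin (d + 2) // b ≠ i0} => π (fam (d + 1) b (Jm b))) := by
      funext b
      rw [hψ'o b b.2]
    rw [this]; exact h2
  obtain ⟨C', hC'⟩ := exists_gen (fun b s => π (ψ' b s)) Mon.z (fun b => by simp [hψ'z]) i0 Jm h1 h2'
  obtain ⟨δ', hδ'⟩ := hC'.exists_isBH
  obtain ⟨r1, r2, r3⟩ := replace_log (e := e) (D' := D) π (fam (d + 1)) ψ' (fun b => fam_z b) hψ'z i0 hψ'o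
    (by rw [fam, if_neg hi00]) (fun s => by rw [hψ'i]; exact pen_deg s1 f hfD s) heD he (1 + L1 f)
    (by have := L1_nonneg f; linarith) (by rw [hψ'i]; exact L1_pen s1 f) Jm h1 h2 hP.isGen hC' hP.isBH hδ'
  have hdl : dl δ0 δ1 i0 = δ1 := by rw [dl, if_neg hi00]
  have hdlc : ∀ b : Fin (d + 1), dl δ0 δ1 b.castSucc = dl δ0 δ1 b := by
    intro b; simp only [dl, Fin.castSucc_eq_zero_iff]
  have hcl : ∀ b : Fin (d + 1), b.castSucc ≠ i0 := fun b => (Fin.castSucc_lt_last b).ne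
  let N : MP (Fin (d + 1) × Mon n m) ℤ := ev (sp s1 X) C'
  have hN : ∀ (B : Type) [CommRing B] (u : Fin (d + 1) × Mon n m → B), ev u N = ev (sp s1 u) C' := by
    intro B _ u
    show ev u (ev _ _) = _
    rw [hom_ev]
    congr 2
    funext v
    rw [hom_sp]
    congr 1
    funext v
    exact eval₂Hom_X' _ _ _
  refine ⟨N, fun b => δ' b.castSucc, ?_, ?_, ?_, ?_, ?_⟩
  · have hne := hC'.spec_ne Mon.z (fun b => by simp [hψ'z]) i0 Jm h1 h2' (fun s => if s = s1 then 1 else 0) (by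
      rw [sum_eq_single s1]
      · simp only [hψ'i, if_true]
        rw [pen_s1 s1 hs1z]; simpa using hf
      · intro s _ hs; simp [hs]
      · simp)
    intro h0
    apply hne
    have := hN _ (fun v => (X ⟨(v.1.castSucc, v.2), hcl _⟩ : MP {v : Fin (d+2) × Mon n m // v.1 ≠ i0} ℤ))
    rw [h0, map_zero] at this
    rw [this]
    congr 2
    funext v
    rcases v with ⟨b, s⟩
    induction b using Fin.lastCases with
    | last =>
      rw [sp_last, spec, dif_pos rfl]
      split_ifs <;> simp
    | cast b => rw [sp_cast, spec, dif_neg (hcl b)]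
  · intro B _ c u
    rw [hN, hN]
    have := hδ' B (fun b => if h : b = i0 then 1 else c (b.castPred h)) (sp s1 u)
    rw [Fin.prod_univ_castSucc] at this
    have e1 : ∀ b : Fin (d+1), (fun b => if h : b = i0 then 1 else c (b.castPred h)) b.castSucc = c b := by
      intro b; simp only [hcl, dif_neg, not_false_eq_true, Fin.castPred_castSucc]
    simp only [e1] at this
    rw [dif_pos rfl, one_pow, mul_one] at this
    rw [← this]
    congr 2
    funext v
    rcases v with ⟨b, s⟩
    induction b using Fin.lastCases with
    | last => rw [sp_last, sp_last, dif_pos rfl, one_mul]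
    | cast b =>
      rw [sp_cast, sp_cast]
      exact congrArg (· * u (b, s)) (e1 b).symm
  · intro b
    rw [← hdlc]
    exact r2 b.castSucc (hcl b)
  · have hle : lS N ≤ lS C' := by
      have hN1 : 0 ≤ supS N := supS_nonneg N
      obtain ⟨u, hu, hu'⟩ := supS_attained N
      have hle : supS N ≤ supS C' := by
        rw [← hu', hN]
        apply le_supS
        rintro ⟨b, s⟩
        induction b using Fin.lastCases with
        | last => rw [sp_last]; split_ifs <;> simp
        | cast b => rw [sp_cast]; exact hu _
      rcases hN1.eq_or_lt with h0 | h0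
      · rw [lS, ← h0, Real.log_zero]; exact lS_nonneg C' hC'.1.ne_zero
      · exact Real.log_le_log h0 hle
    have hs : ∑ b ∈ univ.erase i0, (dl δ0 δ1 b : ℝ) = δ0 + d * δ1 := by
      have := sum_dl (d := d + 1) (δ0 := δ0) (δ1 := δ1)
      rw [← Finset.add_sum_erase _ _ (Finset.mem_univ i0), hdl] at this
      have h : ((δ1 + ∑ b ∈ univ.erase i0, dl δ0 δ1 b : ℕ) : ℝ) = ((δ0 + (d + 1) * δ1 : ℕ) : ℝ) := by rw [this]
      push_cast at h
      linarith
    rw [hs, hdl] at r3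
    have : (e : ℝ) * lS N ≤ e * lS C' := by gcongr
    linarith
  · intro A' _ _ _ ρ hρ P' hP'
    refine (hP'.2 N).1 ?_
    intro B _ h u hu
    rw [hN]
    refine (hC'.2 C').2 dvd_rfl B (h.comp ρ) (sp s1 u) ?_
    intro b
    induction b using Fin.lastCases with
    | last =>
      rw [sum_eq_single s1]
      · show (h.comp ρ) (π (ψ' (Fin.last (d+1)) s1)) * _ = 0
        rw [show ψ' (Fin.last (d+1)) = pen s1 f from hψ'i, pen_s1 s1 hs1z, sp_last, if_pos rfl]
        simp [hρ]
      · intro s _ hs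
        rw [sp_last, if_neg hs, mul_zero]
      · simp
    | cast b =>
      rw [← hu b]
      apply Finset.sum_congr rfl
      intro s _
      rw [sp_cast]
      show (h.comp ρ) (π (ψ' b.castSucc s)) * _ = _
      rw [hψ'o _ (hcl b)]
      simp only [fam, Fin.castSucc_eq_zero_iff, RingHom.comp_apply]

end M15

section M16
open MvPolynomial
open Finset (mul_sum univ)
open Real (log log_le_log log_mul log_nonneg log_pow)

variable {A : Type} [CommRing A] [IsDomain A] [CharZero A]

lemma IsNode.ge {n m d e : ℕ} (hm : 1 ≤ m) (hem : e ≤ m) {π : MP (Fin n) ℤ →+* A}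
    {P : MP (Fin (d + 1) × Mon n m) ℤ} {δ0 δ1 : ℕ} (hP : IsNode d π P δ0 δ1) : e ^ d ≤ δ0 := by
  obtain ⟨J, hJ⟩ := hP.basis
  obtain ⟨Q, δ, -, -, h3, h4, -⟩ := chain hm π J hJ hP
  calc e ^ d ≤ m ^ d := Nat.pow_le_pow_left hem d
    _ ≤ m ^ d * δ 0 := Nat.le_mul_of_pos_right _ (h3 0)
    _ ≤ δ0 := h4

lemma step_abs {n m d e D : ℕ} (hm : 1 ≤ m) (he : e ≠ 0) (hem : e ≤ m) (heD : e * D ≤ m) (π : MP (Fin n) ℤ →+* A)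
    {P : MP (Fin (d + 2) × Mon n m) ℤ} {δ0 δ1 : ℕ} (hP : IsNode (d + 1) π P δ0 δ1)
    (f : MP (Fin n) ℤ) (hf : π f ≠ 0) (hfD : f.totalDegree ≤ D)
    {I : Type} [Fintype I] (Aq : I → Type) [∀ i, CommRing (Aq i)] [∀ i, IsDomain (Aq i)] [∀ i, CharZero (Aq i)]
    (ρ : ∀ i, A →+* Aq i) (hρ : ∀ i, ρ i (π f) = 0) (Pq : I → MP (Fin (d + 1) × Mon n m) ℤ)
    (δ0q δ1q : I → ℕ) (hn : ∀ i, IsNode d ((ρ i).comp π) (Pq i) (δ0q i) (δ1q i))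
    (hker : ∀ i j, (∀ g, (ρ i).comp π g = 0 ↔ (ρ j).comp π g = 0) → i = j) :
    e * ∑ i, δ0q i ≤ δ0 ∧ e * ∑ i, δ1q i ≤ δ1 ∧
    e * ∑ i, (lS (Pq i) + (δ0q i + d * δ1q i) * log (δ0q i / e ^ d)) ≤
      (δ0 + d * δ1) * (log (δ0 / e ^ (d + 1)) + 2 * log 2) + e * δ1 * (log (1 + L1 f) + log 2) + lS P := by
  classical
  obtain ⟨N, δ, hN0, hNB, hδ, hNl, hNd⟩ := step_div hm he heD π hP f hf hfD
  have hdv : ∏ i, Pq i ∣ N := by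
    apply prod_dvd_of_prime
    · exact fun i _ => (hn i).isGen.1
    · intro i _ j _ hij hd
      obtain ⟨J, hJ⟩ := (hn i).basis
      exact hij (hker i j (fun g => ker_eq hm (hn i).isGen hJ (hn j).isGen hd g))
    · intro i _
      exact hNd (Aq i) (ρ i) (hρ i) (Pq i) (hn i).isGen
  obtain ⟨hb, hl⟩ := dvd_deg_lS (IsBH.prod univ (fun i _ => (hn i).isBH)) hNB hN0 hdv
  have he0 : (0 : ℝ) < e := by positivity
  have a1 : e * ∑ i, δ0q i ≤ δ0 := by
    have h1 := hb 0
    have h2 := hδ 0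
    simp only [Finset.sum_apply, dl, if_true] at h1 h2
    exact (Nat.mul_le_mul_left e h1).trans h2
  have a2 : e * ∑ i, δ1q i ≤ δ1 := by
    rcases Nat.eq_zero_or_pos d with h0 | h0
    · simp [fun i => (hn i).zero h0]
    · have hne : (Fin.last d) ≠ 0 := by
        intro h; have := congrArg Fin.val h; simp at this; omega
      have h1 := hb (Fin.last d)
      have h2 := hδ (Fin.last d)
      simp only [Finset.sum_apply, dl, if_neg hne] at h1 h2
      exact (Nat.mul_le_mul_left e h1).trans h2
  refine ⟨a1, a2, ?_⟩
  have hsN : e * ∑ b, (δ b : ℝ) ≤ δ0 + d * δ1 := by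
    have : ∑ b, e * δ b ≤ δ0 + d * δ1 := by
      rw [← sum_dl (d := d)]
      exact Finset.sum_le_sum fun b _ => hδ b
    rw [← mul_sum] at this
    exact_mod_cast this
  have hX : (1 : ℝ) ≤ δ0 / e ^ (d + 1) := by
    rw [le_div_iff₀ (by positivity), one_mul]
    exact_mod_cast hP.ge hm hem
  have hlX := log_nonneg hX
  have hl2 := log_nonneg (one_le_two)
  have hLf : 0 ≤ log (1 + L1 f) := log_nonneg (by have := L1_nonneg f; linarith)
  have hlP := lS_nonneg P hP.isGen.1.ne_zero
  rcases isEmpty_or_nonempty I with hI | hI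
  · rw [Finset.univ_eq_empty, Finset.sum_empty, mul_zero]
    positivity
  have hα : ∀ i, (1 : ℝ) ≤ δ0q i / e ^ d := by
    intro i
    rw [le_div_iff₀ (by positivity), one_mul]
    exact_mod_cast (hn i).ge hm hem
  obtain ⟨-, hg⟩ := gelfond_multi univ Finset.univ_nonempty Pq (fun i => δ0q i + d * δ1q i)
    (fun i _ => by have := (hn i).isBH.isHom; rwa [sum_dl] at this) (fun i => δ0q i / e ^ d) (fun i _ => by have := hα i; positivity)
  have hS1 : (1 : ℝ) ≤ ∑ i, (δ0q i / e ^ d : ℝ) := by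
    obtain ⟨i⟩ := hI
    exact (hα i).trans (Finset.single_le_sum (f := fun i => (δ0q i / e ^ d : ℝ)) (fun i _ => by positivity) (Finset.mem_univ i))
  have hSX : ∑ i, (δ0q i / e ^ d : ℝ) ≤ δ0 / e ^ (d + 1) := by
    rw [← Finset.sum_div, div_le_div_iff₀ (by positivity) (by positivity)]
    have : (e : ℝ) * ∑ i, (δ0q i : ℝ) ≤ δ0 := by exact_mod_cast a1
    calc _ = (e * ∑ i, (δ0q i : ℝ)) * e ^ d := by ring
      _ ≤ _ := by gcongr
  have hpr0 : ∏ i, Pq i ≠ 0 := Finset.prod_ne_zero_iff.2 fun i _ => (hn i).isGen.1.ne_zero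
  have hsp : ∀ i, 0 < supS (Pq i) := fun i => one_pos.trans_le (one_le_supS _ (hn i).isGen.1.ne_zero)
  have hgl := log_le_log (Finset.prod_pos fun i _ => mul_pos (pow_pos (one_pos.trans_le (hα i)) _) (hsp i)) hg
  rw [Real.log_prod (fun i _ => (mul_pos (pow_pos (one_pos.trans_le (hα i)) _) (hsp i)).ne'), log_mul (by positivity)
    (one_pos.trans_le (one_le_supS _ hpr0)).ne', log_pow] at hgl
  have hgl2 : ∑ i, (lS (Pq i) + (δ0q i + d * δ1q i) * log (δ0q i / e ^ d)) ≤
      (∑ i, ((δ0q i : ℝ) + d * δ1q i)) * log (∑ i, (δ0q i / e ^ d : ℝ)) + lS (∏ i, Pq i) := by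
    refine le_trans (le_of_eq ?_) (hgl.trans (le_of_eq ?_))
    · apply Finset.sum_congr rfl
      intro i _
      rw [log_mul (pow_pos (one_pos.trans_le (hα i)) _).ne' (hsp i).ne', log_pow, lS]
      push_cast; ring
    · push_cast; rfl
  have hG : e * ∑ i, ((δ0q i : ℝ) + d * δ1q i) ≤ δ0 + d * δ1 := by
    rw [Finset.sum_add_distrib, ← mul_sum]
    have h1 : (e : ℝ) * ∑ i, (δ0q i : ℝ) ≤ δ0 := by exact_mod_cast a1
    have h2 : (e : ℝ) * ∑ i, (δ1q i : ℝ) ≤ δ1 := by exact_mod_cast a2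
    have h3 : (d : ℝ) * (e * ∑ i, (δ1q i : ℝ)) ≤ d * δ1 := by gcongr
    linarith
  have hlog := log_le_log (by positivity) hSX
  have hlog0 := log_nonneg hS1
  calc _ ≤ e * ((∑ i, ((δ0q i : ℝ) + d * δ1q i)) * log (∑ i, (δ0q i / e ^ d : ℝ)) + (lS N + (∑ b, (δ b : ℝ)) * log 2)) := by
        gcongr; linarith
    _ = (e * ∑ i, ((δ0q i : ℝ) + d * δ1q i)) * log (∑ i, (δ0q i / e ^ d : ℝ)) + e * lS N + (e * ∑ b, (δ b : ℝ)) * log 2 := by ring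
    _ ≤ (δ0 + d * δ1) * log (δ0 / e ^ (d+1)) + (lS P + e * δ1 * log (1 + L1 f) + (e * δ1 + (δ0 + d * δ1)) * log 2) + (δ0 + d * δ1) * log 2 := by
        gcongr
    _ = _ := by ring

end M16

section M17
open MvPolynomial
open Real (log log_nonneg)
open Int (castRingHom)
open Algebra (trdeg)

instance specCharZero {n : ℕ} (p : PrimeSpectrum (RQ n)) : CharZero (RQ n ⧸ p.asIdeal) := quot_charZero _ p.2

structure Nd (n m : ℕ) where
  d : ℕ
  p : PrimeSpectrum (RQ n)
  P : MP (Fin (d + 1) × Mon n m) ℤ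
  a0 : ℕ
  a1 : ℕ
  tr : trdeg ℚ (RQ n ⧸ p.asIdeal) = d
  node : IsNode d (pr p.asIdeal) P a0 a1

noncomputable def Nd.X {n m : ℕ} (N : Nd n m) (e : ℕ) : ℝ := N.a0 / e ^ N.d
noncomputable def Nd.Y {n m : ℕ} (N : Nd n m) (e : ℕ) : ℝ := e * N.a1 / e ^ N.d
noncomputable def Nd.pot {n m : ℕ} (N : Nd n m) (e : ℕ) : ℝ :=
  (lS N.P + (N.a0 + N.d * N.a1) * log (N.a0 / e ^ N.d)) / e ^ N.d

lemma exists_nd {n m : ℕ} (hm : 1 ≤ m) (p : PrimeSpectrum (RQ n)) (d : ℕ) (hd : trdeg ℚ (RQ n ⧸ p.asIdeal) = d) :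
    ∃ N : Nd n m, N.p = p ∧ N.d = d := by
  obtain ⟨J, hJ⟩ := exists_basis p.asIdeal p.2 d hd
  obtain ⟨P, a0, a1, h⟩ := exists_node (m := m) hm (pr p.asIdeal) J hJ
  exact ⟨⟨d, p, P, a0, a1, hd, h⟩, rfl, rfl⟩

lemma clear_den {n : ℕ} (x : RQ n) : ∃ (c : ℤ) (g : MP (Fin n) ℤ), c ≠ 0 ∧
    map (castRingHom ℚ) g = C (c : ℚ) * x := by
  induction x using MvPolynomial.induction_on with
  | C a => exact ⟨a.den, C a.num, by exact_mod_cast a.den_nz, by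
      rw [map_C, ← C_mul]; congr 1
      exact_mod_cast (Rat.den_mul_eq_num a).symm⟩
  | add p q hp hq =>
    obtain ⟨c, g, hc, hg⟩ := hp
    obtain ⟨c', g', hc', hg'⟩ := hq
    refine ⟨c * c', C c' * g + C c * g', mul_ne_zero hc hc', ?_⟩
    rw [map_add, map_mul, map_mul, hg, hg', map_C, map_C]
    push_cast
    rw [C_mul]
    simp only [eq_intCast]
    ring
  | mul_X p i hp =>
    obtain ⟨c, g, hc, hg⟩ := hp
    exact ⟨c, g * MvPolynomial.X i, hc, by rw [map_mul, hg, map_X, mul_assoc]⟩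

lemma pr_ker_le {n : ℕ} (p q : Ideal (RQ n)) (h : ∀ g, pr p g = 0 → pr q g = 0) : p ≤ q := by
  intro x hx
  obtain ⟨c, g, hc, hg⟩ := clear_den x
  have h1 : pr p g = 0 := by rw [pr_eq_zero, hg]; exact p.mul_mem_left _ hx
  have h2 := h g h1
  rw [pr_eq_zero, hg] at h2
  have h3 := q.mul_mem_left (C (c : ℚ)⁻¹) h2
  rwa [← mul_assoc, ← C_mul, inv_mul_cancel₀ (by exact_mod_cast hc), C_1, one_mul] at h3

lemma step_nd {n m e D : ℕ} (hm : 1 ≤ m) (he : e ≠ 0) (hem : e ≤ m) (heD : e * D ≤ m) (N : Nd n m) (hNe : N.d ≤ e)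
    (f : MP (Fin n) ℤ) (hf : pr N.p.asIdeal f ≠ 0) (hfD : f.totalDegree ≤ D) :
    ∃ (I : Type) (_ : Fintype I) (M : I → Nd n m), (∀ i, (M i).d + 1 = N.d ∧ N.p.asIdeal ≤ (M i).p.asIdeal ∧ pr (M i).p.asIdeal f = 0) ∧
      (∀ q : Ideal (RQ n), q.IsPrime → N.p.asIdeal ≤ q → pr q f = 0 → ∃ i, (M i).p.asIdeal ≤ q) ∧
      ∑ i, (M i).X e ≤ N.X e ∧ ∑ i, (M i).Y e ≤ N.Y e ∧
      ∑ i, (M i).pot e ≤ N.pot e + N.Y e * log (1 + L1 f) + 3 * (N.X e + N.Y e) := by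
  classical
  obtain ⟨dN, p, P, a0, a1, htr, hnode⟩ := N
  simp only at hf hNe ⊢
  set K := Ideal.span {map (castRingHom ℚ) f} ⊔ p.asIdeal with hK
  have hf' : map (castRingHom ℚ) f ∉ p.asIdeal := fun h => hf ((pr_eq_zero _ _).2 h)
  have hfin : K.minimalPrimes.Finite := Ideal.finite_minimalPrimes_of_isNoetherianRing _ _
  have hcov : ∀ q : Ideal (RQ n), q.IsPrime → p.asIdeal ≤ q → pr q f = 0 → ∃ i : K.minimalPrimes, i.1 ≤ q := by
    intro q hq h1 h2
    rw [pr_eq_zero] at h2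
    have : K ≤ q := sup_le (by rwa [Ideal.span_singleton_le_iff_mem]) h1
    obtain ⟨r, hr, hrq⟩ := Ideal.exists_minimalPrimes_le this
    exact ⟨⟨r, hr⟩, hrq⟩
  haveI : Fintype K.minimalPrimes := hfin.fintype
  rcases dN with _ | d
  · have hemp : IsEmpty K.minimalPrimes := ⟨fun q => by
      obtain ⟨d', h, -⟩ := drop p.asIdeal p.2 _ hf' 0 htr q.1 q.2
      omega⟩
    refine ⟨PEmpty, inferInstance, fun i => i.elim, fun i => i.elim, ?_, ?_, ?_, ?_⟩
    · intro q hq h1 h2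
      obtain ⟨i, -⟩ := hcov q hq h1 h2
      exact hemp.elim i
    all_goals
      have hX : (1 : ℝ) ≤ a0 := by exact_mod_cast hnode.ge hm hem
      have h1 := lS_nonneg P hnode.isGen.1.ne_zero
      have h2 := log_nonneg hX
      have hLf : 0 ≤ log (1 + L1 f) := log_nonneg (by have := L1_nonneg f; linarith)
      simp only [Finset.univ_eq_empty, Finset.sum_empty, Nd.X, Nd.Y, Nd.pot, pow_zero, div_one]
      positivity
  have hq : ∀ q : K.minimalPrimes, ∃ M : Nd n m, M.p.asIdeal = q.1 ∧ M.d = d := by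
    intro q
    obtain ⟨d', h, h'⟩ := drop p.asIdeal p.2 _ hf' (d + 1) htr q.1 q.2
    obtain rfl : d = d' := by omega
    obtain ⟨M, h1, h2⟩ := exists_nd (m := m) hm ⟨q.1, q.2.1.1⟩ d h'
    exact ⟨M, by rw [h1], h2⟩
  have hq2 : ∀ q : K.minimalPrimes, ∃ (P' : MP (Fin (d + 1) × Mon n m) ℤ) (b0 b1 : ℕ) (s : PrimeSpectrum (RQ n)), s.asIdeal = q.1 ∧ 
      trdeg ℚ (RQ n ⧸ s.asIdeal) = d ∧ IsNode d (pr s.asIdeal) P' b0 b1 := by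
    intro q
    obtain ⟨⟨d', s, P', b0, b1, h1, h2⟩, h3, h4⟩ := hq q
    simp only at h4; subst h4
    exact ⟨P', b0, b1, s, h3, h1, h2⟩
  choose Pq b0 b1 sq hs htrq hnq using hq2
  have hle : ∀ i, p.asIdeal ≤ (sq i).asIdeal := fun i => by rw [hs]; exact le_sup_right.trans i.2.1.2
  have hfs : ∀ i, pr (sq i).asIdeal f = 0 := fun i => by
    rw [pr_eq_zero, hs]
    exact (le_sup_left.trans i.2.1.2) (Ideal.mem_span_singleton_self _)
  have hcomp : ∀ i, (Ideal.Quotient.factor (hle i)).comp (pr p.asIdeal) = pr (sq i).asIdeal := fun i => by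
    rw [pr, ← RingHom.comp_assoc, Ideal.Quotient.factor_comp_mk]; rfl
  obtain ⟨r1, r2, r3⟩ := step_abs hm he hem heD (pr p.asIdeal) hnode f hf hfD (fun i => RQ n ⧸ (sq i).asIdeal)
    (fun i => Ideal.Quotient.factor (hle i)) (fun i => by rw [← RingHom.comp_apply, hcomp, hfs]) Pq b0 b1
    (fun i => by rw [hcomp]; exact hnq i) (fun i j h => by
      simp only [hcomp] at h
      apply Subtype.ext
      rw [← hs i, ← hs j]
      exact le_antisymm (pr_ker_le _ _ fun g => (h g).1) (pr_ker_le _ _ fun g => (h g).2))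
  refine ⟨K.minimalPrimes, inferInstance, fun i => ⟨d, sq i, Pq i, b0 i, b1 i, htrq i, hnq i⟩, fun i => ⟨rfl, hle i, hfs i⟩, ?_, ?_, ?_, ?_⟩
  · intro q hq h1 h2
    obtain ⟨i, hi⟩ := hcov q hq h1 h2
    exact ⟨i, by rw [hs]; exact hi⟩
  all_goals
    have he0 : (0 : ℝ) < e := by positivity
    have r1' : (e : ℝ) * ∑ i, (b0 i : ℝ) ≤ a0 := by exact_mod_cast r1
    have r2' : (e : ℝ) * ∑ i, (b1 i : ℝ) ≤ a1 := by exact_mod_cast r2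
    simp only [Nd.X, Nd.Y, Nd.pot]
    rw [← Finset.sum_div]
  · rw [div_le_div_iff₀ (by positivity) (by positivity)]
    calc _ = (e * ∑ i, (b0 i : ℝ)) * e ^ d := by ring
      _ ≤ _ := by gcongr
  · rw [div_le_div_iff₀ (by positivity) (by positivity), ← Finset.mul_sum]
    calc _ = e * (e * ∑ i, (b1 i : ℝ)) * e ^ d := by ring
      _ ≤ _ := by gcongr
  · have hX : (1 : ℝ) ≤ a0 / e ^ (d + 1) := by
      rw [le_div_iff₀ (by positivity), one_mul]
      exact_mod_cast hnode.ge hm hem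
    have hlX := log_nonneg hX
    have hl2 : log 2 ≤ 1 := (Real.log_two_lt_d9.trans (by norm_num)).le
    have hl20 := log_nonneg (one_le_two)
    have hed : ((d : ℝ) + 1) ≤ e := by exact_mod_cast hNe
    rw [div_le_iff₀ (by positivity)]
    have key : (lS P + (a0 + (d + 1 : ℕ) * a1) * log (a0 / e ^ (d + 1))) / (e:ℝ) ^ (d + 1) + e * a1 / e ^ (d+1) * log (1 + L1 f) + 3 * (a0 / e ^ (d + 1) + e * a1 / e ^ (d+1))
      = ((lS P + (a0 + (d + 1 : ℕ) * a1) * log (a0 / e ^ (d + 1))) + e * a1 * log (1 + L1 f) + 3 * (a0 + e * a1)) / e ^ (d+1) := by ring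
    rw [key, pow_succ, ← div_div, div_mul_eq_mul_div, le_div_iff₀ he0, mul_comm _ (e:ℝ)]
    refine r3.trans ?_
    rw [pow_succ] at *
    have h1 : (a1 : ℝ) * log (a0 / (e ^ d * e)) ≥ 0 := by positivity
    have h2 : (a0 + d * a1 : ℝ) * log 2 ≤ (a0 + e * a1) * 1 := by
      gcongr; linarith
    have h3 : (e * a1 : ℝ) * log 2 ≤ e * a1 * 1 := by gcongr
    have h4 : (0 : ℝ) ≤ a0 := by positivity
    rw [div_mul_cancel₀ _ (by positivity)]
    push_cast
    nlinarith

end M17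

section M18
open MvPolynomial
open Finset (add_sum_erase mem_univ sum_le_sum sum_nonneg)
open Real (log log_nonneg)
open Algebra (trdeg)
open Function (Injective)

lemma tree {n m e D k : ℕ} (hm : 1 ≤ m) (he : e ≠ 0) (hem : e ≤ m) (heD : e * D ≤ m)
    (F : Fin k → MP (Fin n) ℤ) (hFD : ∀ j, (F j).totalDegree ≤ D) :
    ∀ (d : ℕ) (N : Nd n m), N.d = d → N.d ≤ e →
    ∃ (I : Type) (_ : Fintype I) (M : I → Nd n m), (∀ i j, pr (M i).p.asIdeal (F j) = 0) ∧
      (∀ q : Ideal (RQ n), q.IsPrime → N.p.asIdeal ≤ q → (∀ j, pr q (F j) = 0) → ∃ i, (M i).p.asIdeal ≤ q) ∧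
      ∑ i, (M i).X e ≤ N.X e ∧ ∑ i, (M i).Y e ≤ N.Y e ∧
      ∑ i, (M i).pot e ≤ N.pot e + N.Y e * (∑ j, open Classical in if pr N.p.asIdeal (F j) = 0 then 0 else log (1 + L1 (F j)))
        + d * (3 * (N.X e + N.Y e)) := by
  classical
  have hL : ∀ j, 0 ≤ log (1 + L1 (F j)) := fun j => log_nonneg (by have := L1_nonneg (F j); linarith)
  have hX0 : ∀ N : Nd n m, 0 ≤ N.X e := fun N => by unfold Nd.X; positivity
  have hY0 : ∀ N : Nd n m, 0 ≤ N.Y e := fun N => by unfold Nd.Y; positivity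
  intro d
  induction d using Nat.strong_induction_on with
  | _ d ih =>
  intro N hNd hNe
  by_cases hall : ∀ j, pr N.p.asIdeal (F j) = 0
  · refine ⟨Unit, inferInstance, fun _ => N, fun _ => hall, fun q _ h _ => ⟨(), h⟩, by simp, by simp, ?_⟩
    simp only [Finset.univ_unique, Finset.sum_const, Finset.card_singleton, one_smul, hall, if_true, smul_zero, mul_zero, add_zero]
    have := hX0 N; have := hY0 N
    have : (0 : ℝ) ≤ d * (3 * (N.X e + N.Y e)) := by positivity
    linarith
  push Not at hall
  obtain ⟨j0, hj0⟩ := hall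
  obtain ⟨I, hI, M, h1, h2, h3, h4, h5⟩ := step_nd hm he hem heD N hNe (F j0) hj0 (hFD j0)
  have h6 : ∀ i, _ := fun i => ih (M i).d (by have := (h1 i).1; omega) (M i) rfl (by have := (h1 i).1; omega)
  choose I' hI' M' g1 g2 g3 g4 g5 using h6
  refine ⟨Σ i, I' i, inferInstance, fun x => M' x.1 x.2, fun x => g1 x.1 x.2, ?_, ?_, ?_, ?_⟩
  · intro q hq h hF
    obtain ⟨i, hi⟩ := h2 q hq h (hF j0)
    obtain ⟨i', hi'⟩ := g2 i q hq hi hF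
    exact ⟨⟨i, i'⟩, hi'⟩
  · rw [Fintype.sum_sigma]
    exact (sum_le_sum fun i _ => g3 i).trans h3
  · rw [Fintype.sum_sigma]
    exact (sum_le_sum fun i _ => g4 i).trans h4
  · rw [Fintype.sum_sigma]
    set S := ∑ j, (if pr N.p.asIdeal (F j) = 0 then 0 else log (1 + L1 (F j))) with hS
    set L := log (1 + L1 (F j0)) with hLL
    have hSi : ∀ i, ∑ j, (if pr (M i).p.asIdeal (F j) = 0 then 0 else log (1 + L1 (F j))) ≤ S - L := by
      intro i
      rw [hS, ← add_sum_erase _ _ (mem_univ j0), ← add_sum_erase _ _ (mem_univ j0), if_pos (h1 i).2.2, if_neg hj0,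
        ← hLL, add_sub_cancel_left, zero_add]
      apply sum_le_sum
      intro j _
      by_cases hj : pr N.p.asIdeal (F j) = 0
      · have : pr (M i).p.asIdeal (F j) = 0 := by
          rw [pr_eq_zero] at hj ⊢
          exact (h1 i).2.1 hj
        rw [if_pos hj, if_pos this]
      · rw [if_neg hj]
        split_ifs
        · exact hL j
        · exact le_rfl
    have hd : ∀ i, (((M i).d : ℕ) : ℝ) + 1 = d := fun i => by
      rw [← hNd]; exact_mod_cast (h1 i).1
    rcases isEmpty_or_nonempty I with hIe | ⟨⟨i0⟩⟩
    · simp only [Finset.univ_eq_empty, Finset.sum_empty] at h5 ⊢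
      have hd1 : (1 : ℝ) ≤ d ∨ d = 0 := by
        rcases Nat.eq_zero_or_pos d with h | h
        · right; exact h
        · left; exact_mod_cast h
      have hXN := hX0 N; have hYN := hY0 N
      have hpot : 0 ≤ N.pot e := by
        have hX : (1 : ℝ) ≤ N.a0 / e ^ N.d := by
          have he0 : (0 : ℝ) < e := by positivity
          rw [le_div_iff₀ (by positivity), one_mul]
          exact_mod_cast N.node.ge hm hem
        have := log_nonneg hX
        have := lS_nonneg N.P N.node.isGen.1.ne_zero
        unfold Nd.pot
        positivity
      have hS0 : 0 ≤ S := sum_nonneg fun j _ => by split_ifs; exact le_rfl; exact hL j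
      have t1 := mul_nonneg hYN hS0
      have t2 : (0:ℝ) ≤ d * (3 * (N.X e + N.Y e)) := mul_nonneg (Nat.cast_nonneg _) (by linarith)
      linarith
    set d' := (M i0).d with hd'
    have hdd : ∀ i, (M i).d = d' := fun i => by have h := (h1 i).1; have h' := (h1 i0).1; omega
    have hdR : (d : ℝ) = d' + 1 := (hd i0).symm
    have hSL : 0 ≤ S - L := le_trans (sum_nonneg fun j _ => by split_ifs; exact le_rfl; exact hL j) (hSi i0)
    calc _ ≤ ∑ i, ((M i).pot e + (M i).Y e * (S - L) + d' * (3 * ((M i).X e + (M i).Y e))) := by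
          apply sum_le_sum
          intro i _
          refine (g5 i).trans ?_
          rw [hdd i]
          have := mul_le_mul_of_nonneg_left (hSi i) (hY0 (M i))
          linarith
      _ = ∑ i, (M i).pot e + (∑ i, (M i).Y e) * (S - L) + d' * (3 * ((∑ i, (M i).X e) + ∑ i, (M i).Y e)) := by
          simp only [Finset.sum_add_distrib, Finset.sum_mul, ← Finset.mul_sum]
      _ ≤ (N.pot e + N.Y e * L + 3 * (N.X e + N.Y e)) + N.Y e * (S - L) + d' * (3 * (N.X e + N.Y e)) := by
          gcongr
      _ = _ := by rw [hdR]; ring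

lemma root_tb (n : ℕ) : IsTranscendenceBasis ℤ (fun j : Fin n => pr (⊥ : Ideal (RQ n)) (X j)) ∧
    trdeg ℚ (RQ n ⧸ (⊥ : Ideal (RQ n))) = n := by
  have htr : trdeg ℚ (RQ n ⧸ (⊥ : Ideal (RQ n))) = n := by
    have h := (AlgEquiv.quotientBot ℚ (RQ n)).trdeg_eq
    rw [h, MvPolynomial.trdeg_of_isDomain]
    simp
  refine ⟨?_, htr⟩
  obtain ⟨J, hJ⟩ := exists_basis ⊥ Ideal.isPrime_bot n htr
  have hinj : Injective J := by
    have := hJ.1.injective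
    intro a b h
    exact this (by simp only [h])
  let σ := Equiv.ofBijective J (Finite.injective_iff_bijective.1 hinj)
  have := (isTranscendenceBasis_equiv' σ (f := fun j : Fin n => pr (⊥ : Ideal (RQ n)) (X j)) (g := fun b => pr ⊥ (X (J b))) rfl).1 hJ
  exact this

lemma leaves {n D k : ℕ} (hD : 1 ≤ D)
    (F : Fin k → MP (Fin n) ℤ) (hFD : ∀ j, (F j).totalDegree ≤ D) :
    ∃ (m e : ℕ) (_ : 1 ≤ m) (_ : 1 ≤ e) (_ : m = D * e) (I : Type) (_ : Fintype I) (M : I → Nd n m), (∀ i j, pr (M i).p.asIdeal (F j) = 0) ∧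
      (∀ i, (M i).d ≤ n) ∧
      (∀ q : Ideal (RQ n), q.IsPrime → (∀ j, pr q (F j) = 0) → ∃ i, (M i).p.asIdeal ≤ q) ∧
      ∑ i, (M i).X e ≤ D ^ n ∧ D * ∑ i, (M i).Y e ≤ D ^ n ∧
      D * ∑ i, (lS (M i).P / e ^ (M i).d) ≤ D ^ n * (D * (log (n + 1) + 2 + 2 * (n * log D) + 6 * n) + ∑ j, log (1 + L1 (F j))) := by
  classical
  obtain ⟨m0, hm0, hb⟩ := node_base' n
  have hL : ∀ j, 0 ≤ log (1 + L1 (F j)) := fun j => log_nonneg (by have := L1_nonneg (F j); linarith)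
  set e := m0 + n with he
  have he1 : 1 ≤ e := by omega
  have hem : e ≤ D * e := Nat.le_mul_of_pos_left _ hD
  have hm : 1 ≤ D * e := he1.trans hem
  obtain ⟨htb, htr⟩ := root_tb n
  let p0 : PrimeSpectrum (RQ n) := ⟨⊥, Ideal.isPrime_bot⟩
  have hcz : CharZero (RQ n ⧸ p0.asIdeal) := specCharZero p0
  obtain ⟨P, a0, a1, hnode⟩ := exists_node (m := D * e) hm (pr p0.asIdeal) id htb
  let N : Nd n (D * e) := ⟨n, p0, P, a0, a1, htr, hnode⟩
  obtain ⟨b0, b1, bl⟩ := hb (D * e) (by omega) _ (pr p0.asIdeal) htb P a0 a1 hnode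
  obtain ⟨I, hI, M, h1, h2, h3, h4, h5⟩ := tree hm (by omega) hem (by rw [mul_comm]) F hFD n N rfl (by show n ≤ e; omega)
  have he0 : (0 : ℝ) < e := by exact_mod_cast he1
  have hD0 : (0 : ℝ) < D := by exact_mod_cast hD
  have hD1 : (1 : ℝ) ≤ D := by exact_mod_cast hD
  have hNX : N.X e ≤ D ^ n := by
    show (a0 / e ^ n : ℝ) ≤ D ^ n
    rw [div_le_iff₀ (by positivity), ← mul_pow]
    exact_mod_cast b0
  have hNX1 : 1 ≤ N.X e := by
    show 1 ≤ (a0 / e ^ n : ℝ)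
    rw [le_div_iff₀ (by positivity), one_mul]
    exact_mod_cast hnode.ge hm hem
  have hNY : D * N.Y e ≤ D ^ n := by
    show (D * (e * a1 / e ^ n) : ℝ) ≤ D ^ n
    rw [mul_div_assoc', div_le_iff₀ (by positivity), ← mul_pow, ← mul_assoc]
    exact_mod_cast b1
  have hNY0 : 0 ≤ N.Y e := by unfold Nd.Y; positivity
  have hNY' : N.Y e ≤ D ^ n := by
    refine le_trans ?_ hNY
    nlinarith
  have hlog : log (N.X e) ≤ n * log D := by
    rw [← Real.log_pow]
    exact Real.log_le_log (by positivity) hNX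
  have hlog0 := log_nonneg hNX1
  have hNp : N.pot e ≤ D ^ n * (log (n + 1) + 2 + 2 * (n * log D)) := by
    have e1 : N.pot e = lS P / e ^ n + (N.X e + n * (N.Y e / e)) * log (N.X e) := by
      show (lS P + (a0 + n * a1) * log (a0 / e ^ n)) / e ^ n = lS P / e ^ n + ((a0 / e ^ n) + n * ((e * a1 / e ^ n) / e)) * log (a0 / e ^ n)
      field_simp
    have e2 : lS P / (e:ℝ) ^ n ≤ D ^ n * (log (n + 1) + 2) := by
      rw [div_le_iff₀ (by positivity)]
      refine bl.trans (le_of_eq ?_)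
      push_cast; ring
    have e3 : n * (N.Y e / e) ≤ D ^ n := by
      refine le_trans ?_ hNY'
      have : (n : ℝ) ≤ e := by exact_mod_cast (show n ≤ e by omega)
      rw [mul_div_assoc', div_le_iff₀ he0, mul_comm]
      gcongr
    have e4 : 0 ≤ N.Y e / e := by positivity
    rw [e1]
    calc _ ≤ D ^ n * (log (n + 1) + 2) + (D ^ n + D ^ n) * (n * log D) := by gcongr
      _ = _ := by ring
  refine ⟨D * e, e, hm, he1, rfl, I, hI, M, h1, ?_, fun q hq h => h2 q hq bot_le h, h3.trans hNX, le_trans (by gcongr) hNY, ?_⟩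
  · intro i
    have h := (M i).node.basis
    obtain ⟨J, hJ⟩ := h
    have hinj : Injective J := by
      have := hJ.1.injective
      intro a b h
      exact this (by simp only [h])
    simpa using Fintype.card_le_of_injective J hinj
  · have s1 : ∑ i, (lS (M i).P / (e:ℝ) ^ (M i).d) ≤ ∑ i, (M i).pot e := by
      apply sum_le_sum
      intro i _
      have hX : (1 : ℝ) ≤ (M i).a0 / e ^ (M i).d := by
        rw [le_div_iff₀ (by positivity), one_mul]
        exact_mod_cast (M i).node.ge hm hem
      have := log_nonneg hX
      unfold Nd.pot
      gcongr
      have : 0 ≤ ((M i).a0 + (M i).d * (M i).a1) * log ((M i).a0 / e ^ (M i).d) := by positivity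
      linarith
    have s2 : (∑ j, if pr N.p.asIdeal (F j) = 0 then 0 else log (1 + L1 (F j))) ≤ ∑ j, log (1 + L1 (F j)) := by
      apply sum_le_sum
      intro j _
      split_ifs
      · exact hL j
      · exact le_rfl
    have s3 : 0 ≤ ∑ j, log (1 + L1 (F j)) := sum_nonneg fun j _ => hL j
    calc _ ≤ D * (N.pot e + N.Y e * (∑ j, log (1 + L1 (F j))) + n * (3 * (N.X e + N.Y e))) := by
          gcongr
          refine s1.trans (h5.trans ?_)
          gcongr
      _ = D * N.pot e + (D * N.Y e) * (∑ j, log (1 + L1 (F j))) + D * (n * (3 * (N.X e + N.Y e))) := by ring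
      _ ≤ D * (D ^ n * (log (n + 1) + 2 + 2 * (n * log D))) + D ^ n * (∑ j, log (1 + L1 (F j))) + D * (n * (3 * (D ^ n + D ^ n))) := by
          gcongr
      _ = _ := by ring

end M18

section M19
open MvPolynomial
open Finset (Icc)
open Int (castRingHom)

lemma sep_poly {S : Type} [Fintype S] (P : Polynomial (MP S ℤ)) (hP : Irreducible P)
    (hd : P.natDegree ≠ 0) (T : ℕ) (hT : ∀ i, (P.coeff i).totalDegree ≤ T) (hdT : P.natDegree ≤ T) :
    ∃ c : S → ℤ, (∀ v, 0 ≤ c v ∧ c v ≤ 3 * T ^ 2) ∧ (P.map (eval c)).natDegree = P.natDegree ∧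
      ((P.map (eval c)).map (castRingHom ℚ)).Separable := by
  classical
  let R := MP S ℤ
  let K := FractionRing R
  have hinj : Function.Injective (algebraMap R K) := IsFractionRing.injective R K
  have : CharZero K := charZero_of_injective_algebraMap hinj
  have hK : Irreducible (P.map (algebraMap R K)) :=
    ((hP.isPrimitive hd).irreducible_iff_irreducible_map_fraction_map).1 hP
  have hsep : IsCoprime (P.map (algebraMap R K)) (P.derivative.map (algebraMap R K)) := by
    rw [← Polynomial.derivative_map]; exact hK.separable
  set ρ := P.resultant P.derivative with hρ
  have hρ0 : ρ ≠ 0 := by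
    have := Polynomial.resultant_ne_zero _ _ hsep
    rw [Polynomial.natDegree_map_eq_of_injective hinj, Polynomial.natDegree_map_eq_of_injective hinj,
      Polynomial.resultant_map_map] at this
    intro h
    exact this (by rw [← hρ, h, map_zero])
  have hder : P.derivative.natDegree ≤ T := (Polynomial.natDegree_derivative_le P).trans (by omega)
  have hT' : ∀ i, (P.derivative.coeff i).totalDegree ≤ T := by
    intro i
    rw [Polynomial.coeff_derivative]
    refine (totalDegree_mul _ _).trans ?_
    have : ((i : MP S ℤ) + 1).totalDegree = 0 := by
      have : ((i : MP S ℤ) + 1) = C ((i : ℤ) + 1) := by simp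
      rw [this, totalDegree_C]
    rw [this]; simpa using hT _
  have hρT : ρ.totalDegree ≤ (T + T) * T := by
    rw [hρ, Polynomial.resultant, Matrix.det_apply]
    refine totalDegree_finsetSum_le (fun σ _ => ?_)
    refine (totalDegree_smul_le _ _).trans ((totalDegree_finset_prod _ _).trans ?_)
    refine (Finset.sum_le_card_nsmul _ _ T ?_).trans ?_
    · intro i _
      rw [Polynomial.sylvester, Matrix.of_apply]
      refine Fin.addCases (fun j => ?_) (fun j => ?_) i
      · rw [Fin.addCases_left]; split_ifs
        · exact hT' _
        · simp
      · rw [Fin.addCases_right]; split_ifs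
        · exact hT _
        · simp
    · rw [Finset.card_univ, Fintype.card_fin, smul_eq_mul]; gcongr
  set H := ρ * P.leadingCoeff with hH
  have hH0 : H ≠ 0 := mul_ne_zero hρ0 (by simpa using hP.ne_zero)
  have hHT : H.totalDegree ≤ 3 * T ^ 2 := by
    refine (totalDegree_mul _ _).trans ?_
    have := hT P.natDegree
    have h1 : 1 ≤ T := by omega
    calc _ ≤ (T + T) * T + T := by gcongr; exact this
      _ ≤ _ := by nlinarith
  have : ∃ c : S → ℤ, (∀ v, c v ∈ Icc (0:ℤ) (3 * T ^ 2)) ∧ eval c H ≠ 0 := by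
    by_contra hcon
    push Not at hcon
    refine hH0 (eq_zero_of_eval_zero_at_prod_finset H (fun _ => Icc (0:ℤ) (3 * T ^ 2)) ?_ hcon)
    intro i
    rw [Int.card_Icc]
    have := (degreeOf_le_totalDegree H i).trans hHT
    have e : ((3 * T ^ 2 : ℤ) + 1 - 0).toNat = 3 * T ^ 2 + 1 := by
      rw [sub_zero]; exact_mod_cast Int.toNat_natCast (3 * T ^ 2 + 1)
    rw [e]; omega
  obtain ⟨c, hc, hcH⟩ := this
  rw [hH, map_mul] at hcH
  have hlead : (P.map (eval c)).natDegree = P.natDegree :=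
    Polynomial.natDegree_map_of_leadingCoeff_ne_zero _ (right_ne_zero_of_mul hcH)
  refine ⟨c, fun v => by simpa using hc v, hlead, ?_⟩
  obtain ⟨a, b, -, -, hab⟩ := Polynomial.exists_mul_add_mul_eq_C_resultant (m := P.natDegree) (n := P.derivative.natDegree) P P.derivative le_rfl le_rfl (Or.inl hd)
  have e := congrArg (Polynomial.map ((castRingHom ℚ).comp (eval c))) hab
  rw [Polynomial.map_add, Polynomial.map_mul, Polynomial.map_mul, Polynomial.map_C, ← hρ] at e
  rw [Polynomial.map_map, Polynomial.Separable, Polynomial.derivative_map]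
  have hne : ((castRingHom ℚ).comp (eval c)) ρ ≠ 0 := by
    simpa using left_ne_zero_of_mul hcH
  generalize (castRingHom ℚ).comp (eval c) = φ at *
  refine ⟨Polynomial.C (φ ρ)⁻¹ * a.map φ, Polynomial.C (φ ρ)⁻¹ * b.map φ, ?_⟩
  calc _ = Polynomial.C (φ ρ)⁻¹ * (P.map φ * a.map φ + P.derivative.map φ * b.map φ) := by ring
    _ = 1 := by rw [e, ← Polynomial.C_mul, inv_mul_cancel₀ hne, Polynomial.C_1]

noncomputable def sz {V : Type} [DecidableEq V] {K : Type*} [CommRing K] (t0 : V) (c : V → K) (v : V) : Polynomial K :=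
  if v = t0 then Polynomial.X else Polynomial.C (c v)

lemma sep_point {V : Type} [Fintype V] [DecidableEq V] (t0 : V) (P : MP V ℤ) (hP : Prime P)
    (hd : P.degreeOf t0 ≠ 0) (T : ℕ) (hT : P.totalDegree ≤ T) :
    ∃ c : V → ℤ, (∀ v, 0 ≤ c v ∧ c v ≤ 3 * T ^ 2) ∧ (ev (sz t0 c) P).natDegree = P.degreeOf t0 ∧
      ((ev (sz t0 c) P).map (castRingHom ℚ)).Separable := by
  have hnat : (splitVar t0 P).natDegree = P.degreeOf t0 := by
    show (optionEquivLeft ℤ _ (rename (Equiv.optionSubtypeNe t0).symm P)).natDegree = _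
    rw [natDegree_optionEquivLeft]
    have := degreeOf_rename_of_injective (p := P) (Equiv.optionSubtypeNe t0).symm.injective t0
    rwa [Equiv.optionSubtypeNe_symm_self] at this
  have hirr : Irreducible (splitVar t0 P) := ((MulEquiv.prime_iff (splitVar t0)).2 hP).irreducible
  obtain ⟨c, h1, h2, h3⟩ := sep_poly (splitVar t0 P) hirr (by rw [hnat]; exact hd) T (by
    intro i
    show ((optionEquivLeft ℤ _ (rename (Equiv.optionSubtypeNe t0).symm P)).coeff i).totalDegree ≤ T
    refine (totalDegree_coeff_optionEquivLeft_le _ _ _ _).trans ((totalDegree_rename_le _ _).trans hT))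
    (by rw [hnat]; exact (degreeOf_le_totalDegree _ _).trans hT)
  have e : ev (sz t0 (fun v => if h : v = t0 then 0 else c ⟨v, h⟩)) P = (splitVar t0 P).map (eval c) := by
    have := hom_eq_ev (((Polynomial.mapRingHom (eval c)).comp (splitVar t0).toRingHom))
    have h := congrArg (fun f => f P) this
    refine Eq.trans ?_ h.symm
    show ev _ P = ev _ P
    congr 2
    funext v
    simp only [sz]
    split_ifs with hv
    · subst hv; simp [splitVar]
    · simp [splitVar, Equiv.optionSubtypeNe_symm_of_ne hv]
  refine ⟨fun v => if h : v = t0 then 0 else c ⟨v, h⟩, ?_, ?_, ?_⟩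
  · intro v; simp only []; split_ifs
    · constructor <;> positivity
    · exact h1 _
  · rw [e, h2, hnat]
  · rw [e]; exact h3

end M19

section M20
open MvPolynomial
open Int (castRingHom)
open Function (Injective)

lemma IsBH.supp {V κ : Type} [Fintype V] [Fintype κ] [DecidableEq κ] {g : V → κ} {δ : κ → ℕ} {P : MP V ℤ}
    (h : IsBH g δ P) (m : V →₀ ℕ) (hm : m ∈ P.support) (b : κ) : ∑ v with g v = b, m v = δ b := by
  classical
  have h1 := h (MP V ℤ) (fun b' => C (if b' = b then 2 else 1)) X
  rw [ev_X] at h1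
  have h2 := coeff_scale (fun v => if g v = b then (2:ℤ) else 1) P m
  rw [h1] at h2
  have e1 : ∏ b', (C (if b' = b then (2:ℤ) else 1) : MP V ℤ) ^ δ b' = C (2 ^ δ b) := by
    rw [Finset.prod_eq_single b]
    · simp
    · intro b' _ hb; simp [hb]
    · simp
  have e2 : ∏ v, (if g v = b then (2:ℤ) else 1) ^ m v = 2 ^ (∑ v with g v = b, m v) := by
    rw [Finset.sum_filter, ← Finset.prod_pow_eq_pow_sum]
    refine Finset.prod_congr rfl fun v _ => ?_
    split_ifs <;> simp
  rw [e1, coeff_C_mul, e2] at h2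
  have h3 := mul_right_cancel₀ (mem_support_iff.1 hm) h2
  exact (Nat.pow_right_injective (le_refl 2) (by exact_mod_cast h3)).symm

lemma IsBH.totalDegree_le {V κ : Type} [Fintype V] [Fintype κ] [DecidableEq κ] {g : V → κ} {δ : κ → ℕ} {P : MP V ℤ}
    (h : IsBH g δ P) : P.totalDegree ≤ ∑ b, δ b := by
  rw [totalDegree]
  refine Finset.sup_le fun m hm => ?_
  rw [Finsupp.sum_fintype _ _ (fun _ => rfl), ← Finset.sum_fiberwise (s := Finset.univ) (g := g)]
  exact (Finset.sum_congr rfl fun b _ => h.supp m hm b).le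

lemma IsBH.degreeOf_le {V κ : Type} [Fintype V] [Fintype κ] [DecidableEq κ] {g : V → κ} {δ : κ → ℕ} {P : MP V ℤ}
    (h : IsBH g δ P) (v : V) : P.degreeOf v ≤ δ (g v) := by
  classical
  rw [degreeOf_le_iff]
  intro m hm
  rw [← h.supp m hm (g v)]
  exact Finset.single_le_sum (f := fun v => m v) (fun _ _ => Nat.zero_le _) (by simp)

noncomputable abbrev mc {V : Type} (P : MP V ℤ) : MP V ℂ := map (castRingHom ℂ) P

lemma comp_gamma {n : ℕ} {V A : Type} [Fintype V] [CommRing A] [IsDomain A]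
    (π : MP (Fin n) ℤ →+* A) (P : MP V ℤ) (hP0 : P ≠ 0) (g : V → MP V A) (t0 : V) (ej : Fin n → V)
    (key : ∀ Q, P ∣ Q ↔ ev g Q = 0) (hne : ev g (pderiv t0 P) ≠ 0)
    (hrel : ∀ j, ev g (pderiv (ej j) P) = ev g (pderiv t0 P) * C (π (X j))) :
    ∃ Gh : MP (Fin n) ℂ → MP V ℂ,
    (∀ (f : MP (Fin n) ℂ) (x : V → ℂ), ev x (pderiv t0 P) ≠ 0 → eval x (Gh f) = 0 →
      eval (fun j => ev x (pderiv (ej j) P) / ev x (pderiv t0 P)) f = 0) ∧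
    (∀ f, π f = 0 → ∀ x : V → ℂ, ev x P = 0 → ev x (pderiv t0 P) ≠ 0 →
      ev (fun j => ev x (pderiv (ej j) P) / ev x (pderiv t0 P)) f = 0) ∧
    ∀ (B : Type) [CommRing B] [IsDomain B] (q : MP (Fin n) ℂ →+* B) (ι : A →+* B),
      Injective ι → (∀ f, ι (π f) = q (mc f)) → ∀ k (F : Fin k → MP (Fin n) ℤ), (∀ i, π (F i) = 0) →
      (∀ I : Ideal (MP (Fin n) ℂ), I.IsPrime → (∀ i, mc (F i) ∈ I) → I ≤ RingHom.ker q → RingHom.ker q ≤ I) →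
      ∃ γ, Prime γ ∧ γ ∣ mc P ∧ ¬ γ ∣ mc (pderiv t0 P) ∧ ∀ f, q f = 0 ↔ γ ∣ Gh f := by
  classical
  have hh := fun f : MP (Fin n) ℂ => (homog f)
  choose N hN using hh
  choose G hG using fun f => hN f (N f) le_rfl
  let Gh : MP (Fin n) ℂ → MP V ℂ := fun f =>
    eval₂ C (fun o => Option.elim o (mc (pderiv t0 P)) (fun j => mc (pderiv (ej j) P))) (G f)
  have hGh : ∀ (S : Type) [CommRing S] (ψ : MP V ℂ →+* S) (a : Fin n → S) (f : MP (Fin n) ℂ),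
      (∀ j, ψ (mc (pderiv (ej j) P)) = ψ (mc (pderiv t0 P)) * a j) →
      ψ (Gh f) = ψ (mc (pderiv t0 P)) ^ (N f) * eval₂ (ψ.comp C) a f := by
    intro S _ ψ a f h
    rw [← hG f S (ψ.comp C) _ _ a h]
    show ψ (eval₂ C _ (G f)) = _
    rw [eval₂_comp_left ψ]
    congr 1
    funext o; cases o <;> rfl
  have hmc : ∀ (S : Type) [CommRing S] (ψ : MP V ℂ →+* S) (R : MP V ℤ), ψ (mc R) = ev (fun v => ψ (X v)) R := by
    intro S _ ψ R
    have := congrArg (fun f => f R) (hom_eq_ev (ψ.comp (map (castRingHom ℂ))))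
    refine Eq.trans this ?_
    show ev _ R = ev _ R
    congr 2; funext v; simp
  have hmx : ∀ (S : Type) [CommRing S] (φ : ℂ →+* S) (a : Fin n → S) (f : MP (Fin n) ℤ), eval₂ φ a (mc f) = ev a f := by
    intro S _ φ a f
    rw [mc, eval₂_map]
    exact congrArg (fun h => eval₂ h a f) (RingHom.ext_int _ _)
  have hπ : ∀ f, π f = 0 → ∃ N : ℕ, ∀ (S : Type) [CommRing S] (x : V → S) (a : Fin n → S), ev x P = 0 →
      (∀ j, ev x (pderiv (ej j) P) = ev x (pderiv t0 P) * a j) → ev x (pderiv t0 P) ^ N * ev a f = 0 := by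
    intro f hf
    obtain ⟨N', hN'⟩ := homog f
    obtain ⟨G', hG'⟩ := hN' N' le_rfl
    have hE : ∀ (S : Type) [CommRing S] (x : V → S) (a : Fin n → S),
      (∀ j, ev x (pderiv (ej j) P) = ev x (pderiv t0 P) * a j) →
      ev x (ev (fun o => Option.elim o (pderiv t0 P) (fun j => pderiv (ej j) P)) G') = ev x (pderiv t0 P) ^ N' * ev a f := by
      intro S _ x a h
      rw [hom_ev, show ev x (pderiv t0 P) ^ N' * ev a f = _ from (hG' S (castRingHom S) _ _ a h).symm]
      show ev _ G' = ev _ G'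
      congr 2
      funext o; cases o <;> rfl
    refine ⟨N', fun S _ x a hx h => ?_⟩
    obtain ⟨R, hR⟩ := (key _).2 (show ev g (ev (fun o => Option.elim o (pderiv t0 P) (fun j => pderiv (ej j) P)) G') = 0 by
      rw [hE _ g (fun j => C (π (X j))) hrel]
      have := hom_ev ((C : A →+* MP V A).comp π) X f
      rw [ev_X] at this
      rw [show ev (fun j => C (π (X j))) f = (C (π f) : MP V A) from this.symm, hf, map_zero, mul_zero])
    rw [← hE S x a h, hR, map_mul, hx, zero_mul]
  refine ⟨Gh, ?_, ?_, ?_⟩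
  · intro f x hx h0
    have := hGh ℂ (eval x) (fun j => ev x (pderiv (ej j) P) / ev x (pderiv t0 P)) f (by
      intro j
      rw [hmc, hmc]
      simp only [eval_X]
      field_simp)
    rw [h0, hmc] at this
    simp only [eval_X] at this
    have h2 := (mul_eq_zero.1 this.symm).resolve_left (pow_ne_zero _ hx)
    rw [show (eval x).comp C = RingHom.id ℂ from RingHom.ext fun r => by simp] at h2
    exact h2
  · intro f hf x hx hx0
    obtain ⟨N', hN'⟩ := hπ f hf
    exact (mul_eq_zero.1 (hN' ℂ x _ hx (fun j => by field_simp))).resolve_left (pow_ne_zero _ hx0)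
  · intro B _ _ q ι hι hιq k F hF hmin
    let h : MP V ℂ →+* MP V B := eval₂Hom ((C : B →+* MP V B).comp (q.comp C)) (fun v => map ι (g v))
    have hmcP : ∀ R, h (mc R) = map ι (ev g R) := by
      intro R
      rw [hmc, hom_ev]
      congr 2
      funext v
      exact eval₂Hom_X' _ _ _
    have hd0 : h (mc (pderiv t0 P)) ≠ 0 := by
      rw [hmcP]
      intro h0
      exact hne (map_injective ι hι (by rw [h0, map_zero]))
    have hq : ∀ f, h (Gh f) = h (mc (pderiv t0 P)) ^ (N f) * C (q f) := by
      intro f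
      rw [hGh _ h (fun j => C (q (X j))) f (by
        intro j
        rw [hmcP, hmcP, hrel, map_mul, map_C, hιq]; simp [mc])]
      congr 1
      have e : (C : B →+* MP V B).comp q = eval₂Hom (h.comp C) (fun j => C (q (X j))) := by
        apply MvPolynomial.ringHom_ext
        · intro r; simp [h]
        · intro v; simp
      exact (congrArg (fun φ => φ f) e).symm
    have hmcinj : Injective (mc : MP V ℤ → _) := map_injective _ Int.cast_injective
    obtain ⟨γ, hγ, hγ0, hγP⟩ := exists_prime_in_ker h (mc P) (fun h0 => hP0 (hmcinj (by rw [h0, mc, map_zero])))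
      (by rw [hmcP, (key P).1 dvd_rfl, map_zero])
    have hγd : ¬ γ ∣ mc (pderiv t0 P) := by
      rintro ⟨c, hc⟩
      exact hd0 (by rw [hc, map_mul, hγ0, zero_mul])
    refine ⟨γ, hγ, hγP, hγd, ?_⟩
    have : (Ideal.span {γ}).IsPrime := (Ideal.span_singleton_prime hγ.ne_zero).2 hγ
    let L := FractionRing (MP V ℂ ⧸ Ideal.span {γ})
    let ψ : MP V ℂ →+* L := (algebraMap (MP V ℂ ⧸ Ideal.span {γ}) L).comp (Ideal.Quotient.mk _)
    have hψ : ∀ R, ψ R = 0 ↔ γ ∣ R := by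
      intro R
      show algebraMap (MP V ℂ ⧸ Ideal.span {γ}) L (Ideal.Quotient.mk _ R) = 0 ↔ _
      rw [map_eq_zero_iff _ (IsFractionRing.injective (MP V ℂ ⧸ Ideal.span {γ}) L), Ideal.Quotient.eq_zero_iff_mem, Ideal.mem_span_singleton]
    have hψ0 : ψ (mc (pderiv t0 P)) ≠ 0 := fun h0 => hγd ((hψ _).1 h0)
    let a : Fin n → L := fun j => ψ (mc (pderiv (ej j) P)) / ψ (mc (pderiv t0 P))
    have ha : ∀ j, ψ (mc (pderiv (ej j) P)) = ψ (mc (pderiv t0 P)) * a j := fun j => by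
      simp only [a]; rw [mul_div_cancel₀ _ hψ0]
    let Φ : MP (Fin n) ℂ →+* L := eval₂Hom (ψ.comp C) a
    have hΦ : ∀ f, Φ f = 0 ↔ γ ∣ Gh f := by
      intro f
      rw [← hψ, hGh L ψ a f ha, mul_eq_zero, or_iff_right (pow_ne_zero _ hψ0)]
      rfl
    have hle : RingHom.ker Φ ≤ RingHom.ker q := by
      intro f hf
      obtain ⟨c, hc⟩ := (hΦ f).1 hf
      have := hq f
      rw [hc, map_mul, hγ0, zero_mul, eq_comm, mul_eq_zero, or_iff_right (pow_ne_zero _ hd0), C_eq_zero] at this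
      exact this
    have := hmin (RingHom.ker Φ) (RingHom.ker_isPrime Φ) (by
      intro i
      obtain ⟨N', hN'⟩ := hπ (F i) (hF i)
      have h1 := hN' L (fun v => ψ (X v)) a (by rw [← hmc, hψ]; exact hγP) (fun j => by rw [← hmc, ← hmc]; exact ha j)
      rw [← hmc, mul_eq_zero, or_iff_right (pow_ne_zero _ hψ0)] at h1
      show eval₂ (ψ.comp C) a (mc (F i)) = 0
      rw [hmx, h1]) hle
    intro f
    rw [← hΦ]
    exact ⟨fun h => this h, fun h => hle h⟩

end M20

section M21
open MvPolynomial

section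
attribute [local instance] MvPolynomial.algebraMvPolynomial

lemma going_down {n : ℕ} (p : Ideal (RQ n)) [p.IsPrime] (I0 : Ideal (MP (Fin n) ℂ))
    [I0.IsPrime] (h : ∀ f ∈ p, map (algebraMap ℚ ℂ) f ∈ I0) :
    ∃ I ≤ I0, I.IsPrime ∧ ∀ f, map (algebraMap ℚ ℂ) f ∈ I ↔ f ∈ p := by
  haveI : Module.Flat (MP (Fin n) ℚ) (MP (Fin n) ℂ) :=
    Module.Flat.isBaseChange ℚ (MP (Fin n) ℚ) ℂ (MP (Fin n) ℂ)
      (Algebra.IsPushout.out (R := ℚ) (S := MP (Fin n) ℚ) (R' := ℂ)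
        (S' := MP (Fin n) ℂ))
  haveI : (I0.under (MP (Fin n) ℚ)).IsPrime := inferInstance
  obtain ⟨I, hI, hp, hl⟩ := Ideal.exists_ideal_le_liesOver_of_le (p := p)
    (q := I0.under (MP (Fin n) ℚ)) I0 (fun f hf => h f hf)
  refine ⟨I, hI, hp, fun f => ?_⟩
  have := hl.over
  constructor
  · intro hf
    rw [this]
    exact hf
  · intro hf
    rw [this] at hf
    exact hf
end

lemma mc_eq {n : ℕ} (f : MP (Fin n) ℤ) :
    map (algebraMap ℚ ℂ) (map (Int.castRingHom ℚ) f) = mc f := by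
  rw [MvPolynomial.map_map]
  congr 1

lemma leaf_emb {n k : ℕ} (F : Fin k → MP (Fin n) ℤ) (p : Ideal (RQ n)) [p.IsPrime]
    (hF : ∀ j, pr p (F j) = 0)
    (I0 : Ideal (MP (Fin n) ℂ)) [I0.IsPrime]
    (h : ∀ f ∈ p, map (algebraMap ℚ ℂ) f ∈ I0)
    (hmin : ∀ I : Ideal (MP (Fin n) ℂ), I.IsPrime → (∀ i, mc (F i) ∈ I) → I ≤ I0 → I0 ≤ I) :
    ∃ ι : (RQ n ⧸ p) →+* (MP (Fin n) ℂ ⧸ I0), Function.Injective ι ∧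
      ∀ f, ι (pr p f) = Ideal.Quotient.mk I0 (mc f) := by
  obtain ⟨I, hI, hIp, hI2⟩ := going_down p I0 h
  have h3 : I0 ≤ I := hmin I hIp (fun i => by
    rw [← mc_eq, hI2, ← pr_eq_zero]; exact hF i) hI
  have hE : I = I0 := le_antisymm hI h3
  subst hE
  have hc : p = I.comap (map (algebraMap ℚ ℂ)) := by
    ext f; rw [Ideal.mem_comap, hI2]
  refine ⟨Ideal.quotientMap I (map (algebraMap ℚ ℂ)) hc.le, Ideal.quotientMap_injective' hc.ge, ?_⟩
  intro f
  rw [← mc_eq]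
  exact Ideal.quotientMap_mk

lemma leaf_pick {n k : ℕ} (F : Fin k → MP (Fin n) ℤ)
    (I0 : Ideal (MP (Fin n) ℂ)) [I0.IsPrime] (h0 : ∀ i, mc (F i) ∈ I0)
    {I : Type} (M : I → Ideal (RQ n))
    (hq : ∀ q : Ideal (RQ n), q.IsPrime → (∀ j, pr q (F j) = 0) → ∃ i, M i ≤ q) :
    ∃ i, ∀ f ∈ M i, map (algebraMap ℚ ℂ) f ∈ I0 := by
  obtain ⟨i, hi⟩ := hq (I0.comap (map (algebraMap ℚ ℂ))) inferInstance (fun j => by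
    rw [pr_eq_zero, Ideal.mem_comap, mc_eq]; exact h0 j)
  exact ⟨i, fun f hf => hi hf⟩

end M21

section M22
open MvPolynomial
open Int (castRingHom)

variable {V : Type} [Fintype V] [DecidableEq V]

noncomputable def spc (t0 : V) (c : V → ℂ) : MP V ℂ →+* Polynomial ℂ :=
  eval₂Hom Polynomial.C (sz t0 c)

lemma spc_mc (t0 : V) (c : V → ℤ) (P : MP V ℤ) :
    spc t0 (fun v => (c v : ℂ)) (mc P) = (ev (sz t0 c) P).map (castRingHom ℂ) := by
  rw [← Polynomial.coe_mapRingHom, hom_ev]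
  show eval₂ _ _ (map _ P) = eval₂ _ _ P
  rw [eval₂_map]
  have e : (fun v => Polynomial.mapRingHom (castRingHom ℂ) (sz t0 c v)) = sz t0 (fun v => (c v : ℂ)) := by
    funext v
    simp only [sz]
    split_ifs <;> simp
  rw [e, RingHom.ext_int ((Polynomial.C : ℂ →+* Polynomial ℂ).comp (castRingHom ℂ)) (castRingHom _)]

lemma spc_eval (t0 : V) (c : V → ℂ) (θ : ℂ) (G : MP V ℂ) :
    (spc t0 c G).eval θ = eval (fun v => if v = t0 then θ else c v) G := by
  show Polynomial.eval θ (eval₂ _ _ G) = eval₂ _ _ G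
  rw [← Polynomial.coe_evalRingHom, eval₂_comp_left]
  congr 1
  · ext; simp
  · funext v
    simp only [sz, Function.comp]
    split_ifs <;> simp

lemma spc_deg (t0 : V) (c : V → ℂ) (G : MP V ℂ) :
    (spc t0 c G).natDegree ≤ G.degreeOf t0 := by
  show (eval₂ Polynomial.C (sz t0 c) G).natDegree ≤ _
  rw [eval₂_eq]
  refine Polynomial.natDegree_sum_le_of_forall_le _ _ (fun s hs => ?_)
  refine (Polynomial.natDegree_C_mul_le _ _).trans ?_
  refine (Polynomial.natDegree_prod_le _ _).trans ?_
  refine le_trans (b := s t0) ?_ (monomial_le_degreeOf t0 hs)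
  calc ∑ v ∈ s.support, (sz t0 c v ^ s v).natDegree ≤ ∑ v ∈ s.support, if v = t0 then s v else 0 := by
        refine Finset.sum_le_sum (fun v _ => ?_)
        simp only [sz]
        split_ifs
        · simp
        · rw [← map_pow]; simp
    _ ≤ ∑ v, if v = t0 then s v else 0 := Finset.sum_le_sum_of_subset (Finset.subset_univ _)
    _ = s t0 := by simp

lemma sz_deriv (t0 : V) (c : V → ℤ) (P : MP V ℤ) :
    Polynomial.derivative (ev (sz t0 c) P) = ev (sz t0 c) (pderiv t0 P) := by
  induction P using MvPolynomial.induction_on with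
  | C a => simp [ev]
  | add p q hp hq => simp only [map_add, hp, hq]
  | mul_X p v hp =>
    rw [map_mul, Polynomial.derivative_mul, hp, Derivation.leibniz, pderiv_X]
    simp only [smul_eq_mul, map_add, map_mul]
    have e1 : ev (sz t0 c) (X v) = sz t0 c v := eval₂Hom_X' _ _ _
    rw [e1]
    by_cases h : v = t0
    · subst h; simp [sz]; ring
    · simp [sz, h, Pi.single_apply]; ring

lemma mc_deg (t0 : V) (P : MP V ℤ) : (mc P).degreeOf t0 = P.degreeOf t0 := by
  rw [degreeOf_eq_sup, degreeOf_eq_sup, support_map_of_injective _ (RingHom.injective_int _)]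

lemma gamma_root (t0 : V) (c : V → ℤ) (P : MP V ℤ) (hP : P ≠ 0)
    (hd : (ev (sz t0 c) P).natDegree = P.degreeOf t0) (γ : MP V ℂ) (h1 : γ ∣ mc P)
    (h2 : ¬ γ ∣ mc (pderiv t0 P)) : ∃ θ : ℂ, (spc t0 (fun v => (c v : ℂ)) γ).eval θ = 0 := by
  obtain ⟨h, hh⟩ := h1
  have hP' : mc P ≠ 0 := by
    rw [Ne, map_eq_zero_iff _ (map_injective _ (RingHom.injective_int _))]; exact hP
  have hg0 : γ ≠ 0 := by rintro rfl; rw [zero_mul] at hh; exact hP' hh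
  have hh0 : h ≠ 0 := by rintro rfl; rw [mul_zero] at hh; exact hP' hh
  have d0 : γ.degreeOf t0 ≠ 0 := by
    intro h0
    have : pderiv t0 γ = 0 := pderiv_eq_zero_of_notMem_vars (by
      rw [mem_vars_iff_degreeOf_ne_zero]; simpa using h0)
    apply h2
    rw [mc, ← pderiv_map, show map (castRingHom ℂ) P = mc P from rfl, hh, Derivation.leibniz, this]
    simp
  have hU : (spc t0 (fun v => (c v : ℂ)) (mc P)).natDegree = P.degreeOf t0 := by
    rw [spc_mc, Polynomial.natDegree_map_eq_of_injective (RingHom.injective_int _), hd]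
  have e1 : P.degreeOf t0 = γ.degreeOf t0 + h.degreeOf t0 := by
    rw [← mc_deg, hh, degreeOf_mul_eq hg0 hh0]
  have l1 := spc_deg t0 (fun v => (c v : ℂ)) γ
  have l2 := spc_deg t0 (fun v => (c v : ℂ)) h
  have l3 : (spc t0 (fun v => (c v : ℂ)) (mc P)).natDegree ≤ (spc t0 (fun v => (c v : ℂ)) γ).natDegree + (spc t0 (fun v => (c v : ℂ)) h).natDegree := by
    rw [hh, map_mul]; exact Polynomial.natDegree_mul_le
  have l4 : (spc t0 (fun v => (c v : ℂ)) γ).natDegree ≠ 0 := by omega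
  obtain ⟨θ, hθ⟩ := Complex.exists_root (f := spc t0 (fun v => (c v : ℂ)) γ) (by
    rw [Polynomial.degree_eq_natDegree (by rintro h0; rw [h0] at l4; simp at l4)]
    exact_mod_cast Nat.pos_of_ne_zero l4)
  exact ⟨θ, hθ⟩

lemma gamma_distinct (t0 : V) (c : V → ℤ) (P : MP V ℤ)
    (hs : ((ev (sz t0 c) P).map (castRingHom ℂ)).Separable) (γ γ' : MP V ℂ)
    (hg : Prime γ) (hg' : Prime γ') (h1 : γ ∣ mc P) (h1' : γ' ∣ mc P) (θ : ℂ)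
    (h2 : (spc t0 (fun v => (c v : ℂ)) γ).eval θ = 0) (h2' : (spc t0 (fun v => (c v : ℂ)) γ').eval θ = 0) :
    Associated γ γ' := by
  by_contra hA
  obtain ⟨h, hh⟩ := h1'
  have : γ ∣ h := by
    rw [hh] at h1
    rcases hg.dvd_or_dvd h1 with h3 | h3
    · exact absurd (hg.irreducible.associated_of_dvd hg'.irreducible h3) hA
    · exact h3
  obtain ⟨h3, rfl⟩ := this
  rw [← spc_mc, hh, map_mul, map_mul] at hs
  set a := spc t0 (fun v => (c v : ℂ)) γ
  set b := spc t0 (fun v => (c v : ℂ)) γ'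
  set e := spc t0 (fun v => (c v : ℂ)) h3
  have h4 := hs.eval₂_derivative_ne_zero (RingHom.id ℂ) (x := θ) (by
    simp [Polynomial.eval₂_id, h2, h2'])
  apply h4
  rw [Polynomial.eval₂_id]
  simp [Polynomial.derivative_mul, h2, h2']

end M22

section M23
open MvPolynomial
open Int (castRingHom)

def Good {n k : ℕ} (F : Fin k → MP (Fin n) ℤ) (p : Ideal (RQ n)) (I0 : Ideal (MP (Fin n) ℂ)) : Prop :=
  I0.IsPrime ∧ (∀ f ∈ p, map (algebraMap ℚ ℂ) f ∈ I0) ∧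
    ∀ I : Ideal (MP (Fin n) ℂ), I.IsPrime → (∀ i, mc (F i) ∈ I) → I ≤ I0 → I0 ≤ I

lemma sz_ev {V : Type} [Fintype V] [DecidableEq V] (t0 : V) (c : V → ℤ) (θ : ℂ) (P : MP V ℤ) :
    Polynomial.aeval θ (ev (sz t0 c) P) = ev (fun v => if v = t0 then θ else (c v : ℂ)) P := by
  have := hom_ev (Polynomial.aeval θ : Polynomial ℤ →ₐ[ℤ] ℂ).toRingHom (sz t0 c) P
  refine Eq.trans this ?_
  congr 2
  funext v
  simp only [sz]
  split_ifs <;> simp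

lemma leaf_abs {n k : ℕ} (F : Fin k → MP (Fin n) ℤ) (p : Ideal (RQ n)) [p.IsPrime]
    (hF : ∀ j, pr p (F j) = 0) {V : Type} [Fintype V] [DecidableEq V] (P : MP V ℤ) (hP : P ≠ 0)
    (g : V → MP V (RQ n ⧸ p)) (t0 : V) (ej : Fin n → V)
    (key : ∀ Q, P ∣ Q ↔ ev g Q = 0) (hne : ev g (pderiv t0 P) ≠ 0)
    (hrel : ∀ j, ev g (pderiv (ej j) P) = ev g (pderiv t0 P) * C (pr p (X j)))
    (c : V → ℤ) (hd : (ev (sz t0 c) P).natDegree = P.degreeOf t0)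
    (hs : ((ev (sz t0 c) P).map (castRingHom ℚ)).Separable) :
    ∃ (w : Fin n → Polynomial ℤ) (θ : Ideal (MP (Fin n) ℂ) → ℂ),
      (∀ t : ℂ, Polynomial.aeval t (ev (sz t0 c) P) = 0 → ∀ i,
        ev (fun j => Polynomial.aeval t (w j) / Polynomial.aeval t (Polynomial.derivative (ev (sz t0 c) P))) (F i) = 0) ∧
      (∀ I, Good F p I → Polynomial.aeval (θ I) (ev (sz t0 c) P) = 0 ∧ ∀ f ∈ I,
        eval (fun j => Polynomial.aeval (θ I) (w j) / Polynomial.aeval (θ I) (Polynomial.derivative (ev (sz t0 c) P))) f = 0) ∧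
      ∀ I I', Good F p I → Good F p I' → θ I = θ I' → I = I' := by
  classical
  obtain ⟨Gh, g1, g2, g3⟩ := comp_gamma (pr p) P hP g t0 ej key hne hrel
  have hsC : ((ev (sz t0 c) P).map (castRingHom ℂ)).Separable := by
    have := hs.map (f := algebraMap ℚ ℂ)
    rw [Polynomial.map_map] at this
    rwa [RingHom.ext_int (castRingHom ℂ) ((algebraMap ℚ ℂ).comp (castRingHom ℚ))]
  have hder : ∀ t : ℂ, Polynomial.aeval t (ev (sz t0 c) P) = 0 →
      Polynomial.aeval t (Polynomial.derivative (ev (sz t0 c) P)) ≠ 0 := by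
    intro t ht
    have := hsC.eval₂_derivative_ne_zero (RingHom.id ℂ) (x := t) (by
      rw [Polynomial.eval₂_id, Polynomial.eval_map]; exact ht)
    rw [Polynomial.eval₂_id, Polynomial.derivative_map, Polynomial.eval_map] at this
    exact this
  have hG : ∀ I, Good F p I → ∃ (γ : MP V ℂ) (t : ℂ), Prime γ ∧ γ ∣ mc P ∧
      (spc t0 (fun v => (c v : ℂ)) γ).eval t = 0 ∧ ∀ f, f ∈ I ↔ γ ∣ Gh f := by
    intro I ⟨hI, h1, h2⟩
    obtain ⟨ι, hι, hι2⟩ := leaf_emb F p hF I h1 h2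
    obtain ⟨γ, q1, q2, q3, q4⟩ := g3 _ (Ideal.Quotient.mk I) ι hι hι2 k F hF (by
      rw [Ideal.mk_ker]; exact h2)
    obtain ⟨t, ht⟩ := gamma_root t0 c P hP hd γ q2 q3
    refine ⟨γ, t, q1, q2, ht, fun f => ?_⟩
    rw [← q4, Ideal.Quotient.eq_zero_iff_mem]
  choose! γ θ a1 a2 a3 a4 using hG
  have root : ∀ I, Good F p I → Polynomial.aeval (θ I) (ev (sz t0 c) P) = 0 := by
    intro I hI
    obtain ⟨h, hh⟩ := a2 I hI
    have e1 := congrArg (Polynomial.eval (θ I)) (spc_mc t0 c P)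
    rw [hh, map_mul, Polynomial.eval_mul, a3 I hI, zero_mul, Polynomial.eval_map] at e1
    exact e1.symm
  refine ⟨fun j => ev (sz t0 c) (pderiv (ej j) P), θ, ?_, ?_, ?_⟩
  · intro t ht i
    have h1 := hder t ht
    rw [sz_deriv] at h1 ⊢
    simp only [sz_ev] at ht h1 ⊢
    exact g2 (F i) (hF i) _ ht h1
  · intro I hI
    refine ⟨root I hI, fun f hf => ?_⟩
    have h1 := hder _ (root I hI)
    rw [sz_deriv] at h1 ⊢
    simp only [sz_ev] at h1 ⊢
    refine g1 f _ h1 ?_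
    obtain ⟨h, hh⟩ := (a4 I hI f).1 hf
    rw [hh, map_mul, ← spc_eval, a3 I hI, zero_mul]
  · intro I I' hI hI' h
    have := gamma_distinct t0 c P hsC _ _ (a1 I hI) (a1 I' hI') (a2 I hI) (a2 I' hI') (θ I) (a3 I hI) (by
      rw [h]; exact a3 I' hI')
    ext f
    rw [a4 I hI, a4 I' hI', this.dvd_iff_dvd_left]

lemma leaf_data {n k m : ℕ} (hm : 1 ≤ m) (F : Fin k → MP (Fin n) ℤ) (N : Nd n m)
    (hF : ∀ j, pr N.p.asIdeal (F j) = 0) :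
    ∃ (U : Polynomial ℤ) (w : Fin n → Polynomial ℤ) (θ : Ideal (MP (Fin n) ℂ) → ℂ) (T : ℕ) (S : ℝ),
      U.natDegree ≠ 0 ∧ m ^ N.d * U.natDegree ≤ N.a0 ∧ m ^ N.d * T ≤ N.a0 + N.d * (m * N.a1) ∧ 1 ≤ T ∧ 0 ≤ S ∧
      m ^ N.d * S ≤ lS N.P + Real.log 2 * (N.d * (N.a0 + (N.d + 1) * m * N.a1)) ∧
      (U.map (castRingHom ℚ)).Separable ∧
      (∀ t : ℂ, Polynomial.aeval t U = 0 → ∀ i,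
        ev (fun j => Polynomial.aeval t (w j) / Polynomial.aeval t (Polynomial.derivative U)) (F i) = 0) ∧
      (∀ I, Good F N.p.asIdeal I → Polynomial.aeval (θ I) U = 0 ∧ ∀ f ∈ I,
        eval (fun j => Polynomial.aeval (θ I) (w j) / Polynomial.aeval (θ I) (Polynomial.derivative U)) f = 0) ∧
      (∀ I I', Good F N.p.asIdeal I → Good F N.p.asIdeal I' → θ I = θ I' → I = I') ∧
      (∀ (t : ℂ) (R : ℝ), 1 ≤ R → ‖t‖ ≤ R → 3 * (T : ℝ) ^ 2 ≤ R → ‖Polynomial.aeval t U‖ ≤ R ^ T * Real.exp S) := by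
  classical
  haveI := N.p.isPrime
  obtain ⟨J, hJ⟩ := N.node.basis
  obtain ⟨Q, δ, h1, h2, h3, h4, h5, h6⟩ := chain hm (pr N.p.asIdeal) J hJ N.node
  have hdeg := pd_deg (famc hm J N.d) (famc_z hm J N.d) h1 (famc_hind hm _ N.d 0 J hJ)
  obtain ⟨g, key, hne, hrel⟩ := pd_core hm (famc hm J N.d) (famc_z hm J N.d) (fun j => lin_e hm j) hdeg h1
  have hQ := h1.1
  obtain ⟨c, c1, c2, c3⟩ := sep_point (0, Mon.z) Q hQ hdeg (∑ b, δ b) h2.totalDegree_le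
  obtain ⟨w, θ, r1, r2, r3⟩ := leaf_abs F N.p.asIdeal hF Q hQ.ne_zero g (0, Mon.z) (fun j => (0, Mon.e hm j)) key hne hrel c c2 c3
  have hS1 := one_le_supS Q hQ.ne_zero
  refine ⟨_, w, θ, ∑ b, δ b, lS Q, by rw [c2]; exact hdeg, ?_, ?_, ?_, lS_nonneg Q hQ.ne_zero, h6, c3, r1, r2, r3, ?_⟩
  · rw [c2]
    exact le_trans (Nat.mul_le_mul_left _ (h2.degreeOf_le (0, Mon.z))) h4
  · rw [Fin.sum_univ_succ, mul_add, Finset.mul_sum]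
    refine Nat.add_le_add h4 ((Finset.sum_le_sum (fun i _ => h5 i)).trans ?_)
    simp
  · exact le_trans (h3 0) (Finset.single_le_sum (f := δ) (fun _ _ => Nat.zero_le _) (Finset.mem_univ 0))
  · intro t R hR ht hT
    rw [sz_ev]
    have := bh_bound h2 (fun _ => R) (fun _ => by linarith) (fun v => if v = (0, Mon.z) then t else (c v : ℂ)) (by
      intro v
      split_ifs
      · exact ht
      · obtain ⟨b1, b2⟩ := c1 v
        rw [Complex.norm_intCast, abs_of_nonneg (by exact_mod_cast b1)]
        refine le_trans ?_ hT
        exact_mod_cast b2)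
    rw [Finset.prod_pow_eq_pow_sum] at this
    rwa [lS, Real.exp_log (by linarith)]

end M23

section M24
open Polynomial
open Finset (mem_erase mem_image mem_univ prod_congr prod_eq_zero sum_congr univ)
open Int (castRingHom)

lemma coeff_bd (p : ℤ[X]) (B : ℝ) (h : ∀ t : ℂ, ‖t‖ = 1 → ‖aeval t p‖ ≤ B) (j : ℕ) :
    (|p.coeff j| : ℝ) ≤ B := by
  set q := p.map (castRingHom ℂ)
  have hi : ∀ (j : ℕ), iteratedDeriv j (fun t : ℂ => q.eval t) = fun t => (derivative^[j] q).eval t := by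
    intro j
    induction j with
    | zero => simp [iteratedDeriv_zero]
    | succ j ih =>
      rw [iteratedDeriv_succ, ih]
      funext t
      rw [Polynomial.deriv, Function.iterate_succ_apply']
  have h1 := Complex.norm_iteratedDeriv_le_of_forall_mem_sphere_norm_le (c := 0) (R := 1) (C := B)
    (f := fun t : ℂ => q.eval t) j one_pos (by
      refine Differentiable.diffContOnCl ?_
      exact q.differentiable) (by
      intro z hz
      have := h z (by simpa using hz)
      rw [eval_map]; exact this)
  rw [hi] at h1
  have e : (derivative^[j] q).eval 0 = (j.factorial : ℂ) * (p.coeff j : ℂ) := by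
    rw [← coeff_zero_eq_eval_zero, coeff_iterate_derivative]
    simp [q, Nat.descFactorial_self]
  simp only [e] at h1
  rw [norm_mul, Complex.norm_natCast, Complex.norm_intCast, one_pow, div_one] at h1
  have hf : (0:ℝ) < j.factorial := by exact_mod_cast Nat.factorial_pos j
  exact le_of_mul_le_mul_left h1 hf

lemma shift_one (A B : ℂ[X]) (hA : A ≠ 0) (hB : B ≠ 0) (G : ℕ) (h1 : A.natDegree ≤ G) (h2 : B.natDegree ≤ G) :
    ∃ a : ℕ, a ≤ G ^ 2 ∧ IsCoprime A (B.comp (X - C (a : ℂ))) := by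
  classical
  let S : Finset ℂ := (A.roots.toFinset ×ˢ B.roots.toFinset).image (fun x => x.1 - x.2)
  have hS : S.card ≤ G ^ 2 := by
    refine Finset.card_image_le.trans ?_
    rw [Finset.card_product, sq]
    exact Nat.mul_le_mul ((Multiset.toFinset_card_le _).trans ((card_roots' A).trans h1))
      ((Multiset.toFinset_card_le _).trans ((card_roots' B).trans h2))
  let T : Finset ℂ := (Finset.range (G ^ 2 + 1)).image (fun a : ℕ => (a : ℂ))
  have hT : T.card = G ^ 2 + 1 := by
    rw [Finset.card_image_of_injective _ Nat.cast_injective, Finset.card_range]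
  obtain ⟨z, hz, hzS⟩ := Finset.exists_mem_notMem_of_card_lt_card (s := S) (t := T) (by omega)
  obtain ⟨a, ha, rfl⟩ := mem_image.1 hz
  refine ⟨a, by have := Finset.mem_range.1 ha; omega, ?_⟩
  rw [isCoprime_iff_aeval_ne_zero_of_isAlgClosed ℂ ℂ]
  intro t
  by_contra! hc
  obtain ⟨c1, c2⟩ := hc
  apply hzS
  rw [mem_image]
  simp only [coe_aeval_eq_eval, eval_comp, eval_sub, eval_X, eval_C] at c1 c2
  refine ⟨(t, t - a), ?_, by simp⟩
  simp [hA, hB, c1, c2]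

lemma sep_comp (B : ℂ[X]) (a : ℂ) (h : B.Separable) : (B.comp (X - C a)).Separable := by
  have := IsCoprime.map h (compRingHom (X - C a))
  rw [Separable, derivative_comp]
  simpa using this

lemma shifts {I : Type} [Fintype I] (U : I → ℂ[X]) (hs : ∀ i, (U i).Separable) (G : ℕ)
    (hG : ∑ i, (U i).natDegree ≤ G) :
    ∃ a : I → ℕ, (∀ i, a i ≤ G ^ 2) ∧ (∏ i, (U i).comp (X - C (a i : ℂ))).Separable := by
  classical
  have key : ∀ s : Finset I, ∃ a : I → ℕ, (∀ i, a i ≤ G ^ 2) ∧ (∏ i ∈ s, (U i).comp (X - C (a i : ℂ))).Separable := by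
    intro s
    induction s using Finset.induction_on with
    | empty => exact ⟨fun _ => 0, by simp, by simp [separable_one]⟩
    | insert j s hj ih =>
      obtain ⟨a, ha, hA⟩ := ih
      have hd : (∏ i ∈ s, (U i).comp (X - C (a i : ℂ))).natDegree ≤ G := by
        refine (natDegree_prod_le _ _).trans (le_trans ?_ hG)
        refine le_trans (Finset.sum_le_sum (g := fun i => (U i).natDegree) (fun i _ => ?_)) (Finset.sum_le_sum_of_subset (Finset.subset_univ s))
        rw [natDegree_comp, natDegree_X_sub_C, mul_one]
      obtain ⟨b, hb, hc⟩ := shift_one _ (U j) hA.ne_zero (hs j).ne_zero G hd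
        ((Finset.single_le_sum (f := fun i => (U i).natDegree) (fun _ _ => Nat.zero_le _) (mem_univ j)).trans hG)
      refine ⟨Function.update a j b, fun i => ?_, ?_⟩
      · by_cases h : i = j
        · subst h; simpa using hb
        · simpa [h] using ha i
      · rw [Finset.prod_insert hj, Function.update_self]
        have : ∏ i ∈ s, (U i).comp (X - C ((Function.update a j b i : ℕ) : ℂ)) = ∏ i ∈ s, (U i).comp (X - C (a i : ℂ)) :=
          prod_congr rfl (fun i hi => by rw [Function.update_of_ne (by rintro rfl; exact hj hi)])
        rw [this]
        exact (sep_comp _ _ (hs j)).mul hA hc.symm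
  exact key univ

lemma rur {n : ℕ} (U : ℤ[X]) (hs : (U.map (castRingHom ℚ)).Separable) (N : Fin n → ℤ[X]) :
    ∃ (u : Fin n → ℤ[X]) (r : Fin n → ℕ+), (∀ j, (u j).natDegree ≤ U.natDegree) ∧
      ∀ θ : ℂ, aeval θ U = 0 → ∀ j, aeval θ (u j) / ((r j : ℕ) : ℂ) = aeval θ (N j) / aeval θ (derivative U) := by
  have key : ∀ j, ∃ (u : ℤ[X]) (r : ℕ+), u.natDegree ≤ U.natDegree ∧
      ∀ θ : ℂ, aeval θ U = 0 → aeval θ u / ((r : ℕ) : ℂ) = aeval θ (N j) / aeval θ (derivative U) := by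
    intro j
    obtain ⟨a, b, hab⟩ := hs
    have hU0 : U.map (castRingHom ℚ) ≠ 0 := by
      intro h
      rw [h] at hab; simp at hab
    set v : ℚ[X] := ((N j).map (castRingHom ℚ) * b) % (U.map (castRingHom ℚ)) with hv
    have hvd : v.natDegree ≤ U.natDegree := by
      refine (natDegree_le_natDegree (degree_mod_lt _ hU0).le).trans ?_
      exact natDegree_map_le
    have hmap : ∀ (θ : ℂ) (p : ℤ[X]), aeval θ (p.map (castRingHom ℚ)) = aeval θ p := fun θ p => by
      rw [show castRingHom ℚ = algebraMap ℤ ℚ from rfl, aeval_map_algebraMap]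
    obtain ⟨s, hs1, hs⟩ := IsLocalization.integerNormalization_spec (nonZeroDivisors ℤ) v
    set g := IsLocalization.integerNormalization (nonZeroDivisors ℤ) v
    have hs0 : s ≠ 0 := nonZeroDivisors.ne_zero hs1
    have hgd : g.natDegree ≤ U.natDegree := by
      rw [← natDegree_map_eq_of_injective (f := algebraMap ℤ ℚ) (RingHom.injective_int _), hs]
      exact (natDegree_smul_le _ _).trans hvd
    have hge : ∀ θ : ℂ, aeval θ g = (s : ℂ) * aeval θ v := by
      intro θ
      rw [← aeval_map_algebraMap ℚ θ g, hs, map_zsmul]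
      simp
    refine ⟨C (SignType.sign s : ℤ) * g, ⟨s.natAbs, Int.natAbs_pos.2 hs0⟩, (natDegree_C_mul_le _ _).trans hgd, ?_⟩
    intro θ hθ
    have h1 := congrArg (aeval θ) hab
    rw [derivative_map] at h1
    simp only [map_add, map_mul, hmap, hθ, mul_zero, zero_add, map_one] at h1
    have hd0 : aeval θ (derivative U) ≠ 0 := right_ne_zero_of_mul (by rw [h1]; exact one_ne_zero)
    have h2 : aeval θ v = aeval θ (N j) * aeval θ b := by
      have := congrArg (aeval θ) (EuclideanDomain.mod_add_div ((N j).map (castRingHom ℚ) * b) (U.map (castRingHom ℚ)))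
      rw [← hv] at this
      simpa only [map_add, map_mul, hmap, hθ, zero_mul, add_zero] using this
    have hsa : ((s.natAbs : ℕ) : ℂ) = ((SignType.sign s : ℤ) : ℂ) * (s : ℂ) := by
      have : ((s.natAbs : ℕ) : ℤ) = (SignType.sign s : ℤ) * s := by
        rw [sign_mul_self]; simp
      have h3 := congrArg (Int.cast : ℤ → ℂ) this
      rw [Int.cast_mul, Int.cast_natCast] at h3
      exact h3
    have hsa0 : ((s.natAbs : ℕ) : ℂ) ≠ 0 := by
      simpa using hs0
    show aeval θ (C (SignType.sign s : ℤ) * g) / ((s.natAbs : ℕ) : ℂ) = _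
    rw [div_eq_div_iff hsa0 hd0, map_mul, hge, h2, hsa, aeval_C]
    simp only [algebraMap_int_eq, eq_intCast]
    linear_combination ((SignType.sign s : ℤ) : ℂ) * (s : ℂ) * aeval θ (N j) * h1
  choose u r h1 h2 using key
  exact ⟨u, r, h1, fun θ hθ j => h2 j θ hθ⟩

lemma combine {I : Type} [Fintype I] {n : ℕ} (U : I → ℤ[X]) (w : I → Fin n → ℤ[X])
    (hs : ∀ i, ((U i).map (castRingHom ℚ)).Separable) (G : ℕ) (hG : ∑ i, (U i).natDegree ≤ G) :
    ∃ (a : I → ℕ) (u : Fin n → ℤ[X]) (V : ℤ[X]) (r : Fin n → ℕ+), V ≠ 0 ∧ (∀ i, a i ≤ G ^ 2) ∧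
      V.natDegree = ∑ i, (U i).natDegree ∧ (∀ j, (u j).natDegree ≤ V.natDegree) ∧
      (∀ θ : ℂ, aeval θ V = ∏ i, aeval (θ - a i) (U i)) ∧
      ∀ i (θ : ℂ), aeval (θ - a i) (U i) = 0 → (∀ i', aeval (θ - a i') (U i') = 0 → i' = i) ∧
        ∀ j, aeval θ (u j) / ((r j : ℕ) : ℂ) = aeval (θ - a i) (w i j) / aeval (θ - a i) (derivative (U i)) := by
  classical
  have cast : ∀ p : ℤ[X], (p.map (castRingHom ℚ)).map (algebraMap ℚ ℂ) = p.map (castRingHom ℂ) := by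
    intro p
    rw [Polynomial.map_map]
    congr 1
  have hinj : Function.Injective (castRingHom ℂ) := RingHom.injective_int _
  obtain ⟨a, ha, hsep⟩ := shifts (fun i => (U i).map (castRingHom ℂ)) (fun i => by
    show ((U i).map _).Separable
    rw [← cast]; exact (hs i).map) G (by
    simpa only [natDegree_map_eq_of_injective hinj] using hG)
  set V : ℤ[X] := ∏ i, (U i).comp (X - C (a i : ℤ)) with hV
  have hVm : V.map (castRingHom ℂ) = ∏ i, ((U i).map (castRingHom ℂ)).comp (X - C (a i : ℂ)) := by
    rw [hV, Polynomial.map_prod]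
    refine prod_congr rfl (fun i _ => ?_)
    rw [Polynomial.map_comp]; simp
  have hVs : (V.map (castRingHom ℚ)).Separable := by
    rw [← separable_map (algebraMap ℚ ℂ), cast, hVm]; exact hsep
  have hU0 : ∀ i, U i ≠ 0 := fun i h => by
    have := (hs i).ne_zero
    rw [h] at this; simp at this
  have hsh : ∀ (p : ℤ[X]) (b : ℕ) (θ : ℂ), aeval θ (p.comp (X - C (b : ℤ))) = aeval (θ - b) p := by
    intro p b θ
    rw [aeval_comp]; simp
  obtain ⟨u, r, h1, h2⟩ := rur V hVs (fun j => ∑ i, (w i j).comp (X - C (a i : ℤ)) * ∏ i' ∈ univ.erase i, (U i').comp (X - C (a i' : ℤ)))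
  have hVe : ∀ θ : ℂ, aeval θ V = ∏ i, aeval (θ - a i) (U i) := by
    intro θ
    rw [hV, map_prod]
    exact prod_congr rfl (fun i _ => hsh _ _ _)
  refine ⟨a, u, V, r, (by intro h; apply hVs.ne_zero; rw [h, Polynomial.map_zero]), ha, ?_, h1, hVe, ?_⟩
  · rw [hV, natDegree_prod _ _ (fun i _ => ?_)]
    · refine sum_congr rfl (fun i _ => ?_)
      rw [natDegree_comp, natDegree_X_sub_C, mul_one]
    · intro h
      rw [comp_eq_zero_iff] at h
      rcases h with h | ⟨-, h⟩
      · exact hU0 i h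
      · have := congrArg natDegree h
        rw [natDegree_X_sub_C, natDegree_C] at this
        omega
  · intro i θ hi
    have hVθ : aeval θ V = 0 := by
      rw [hVe]; exact prod_eq_zero (mem_univ i) hi
    have hsp : ∀ f : I → ℂ, ∑ i', f i' * ∏ i'' ∈ univ.erase i', aeval (θ - a i'') (U i'') =
        f i * ∏ i'' ∈ univ.erase i, aeval (θ - a i'') (U i'') := by
      intro f
      refine Finset.sum_eq_single i (fun i' _ hne => ?_) (fun h => absurd (mem_univ i) h)
      rw [prod_eq_zero (mem_erase.2 ⟨hne.symm, mem_univ i⟩) hi, mul_zero]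
    have hder : aeval θ (derivative V) = aeval (θ - a i) (derivative (U i)) * ∏ i' ∈ univ.erase i, aeval (θ - a i') (U i') := by
      rw [← hsp (fun i => aeval (θ - a i) (derivative (U i))), hV, derivative_prod_finset, map_sum]
      refine sum_congr rfl (fun i' _ => ?_)
      rw [map_mul, map_prod, derivative_comp, map_mul, hsh, mul_comm]
      congr 1
      · simp
      · exact prod_congr rfl (fun i _ => hsh _ _ _)
    have hd0 : aeval θ (derivative V) ≠ 0 := by
      have h3 : (V.map (castRingHom ℂ)).Separable := by rw [hVm]; exact hsep
      have := h3.eval₂_derivative_ne_zero (RingHom.id ℂ) (x := θ) (by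
        rw [eval₂_id, eval_map]; exact hVθ)
      rw [eval₂_id, derivative_map, eval_map] at this
      exact this
    rw [hder] at hd0
    refine ⟨fun i' hi' => ?_, fun j => ?_⟩
    · by_contra hne
      exact right_ne_zero_of_mul hd0 (prod_eq_zero (mem_erase.2 ⟨hne, mem_univ i'⟩) hi')
    · rw [h2 θ hVθ j, hder]
      have : aeval θ (∑ i, (w i j).comp (X - C (a i : ℤ)) * ∏ i' ∈ univ.erase i, (U i').comp (X - C (a i' : ℤ))) =
          aeval (θ - a i) (w i j) * ∏ i' ∈ univ.erase i, aeval (θ - a i') (U i') := by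
        rw [← hsp (fun i => aeval (θ - a i) (w i j)), map_sum]
        refine sum_congr rfl (fun i' _ => ?_)
        rw [map_mul, map_prod, hsh]
        congr 1
        exact prod_congr rfl (fun i _ => hsh _ _ _)
      rw [this, mul_div_mul_right _ _ (right_ne_zero_of_mul hd0)]

end M24

section M25
open MvPolynomial

lemma zar_open {n : ℕ} (U : Set (Fin n → ℂ)) (hU : @IsOpen _ (zariskiTop n) U) :
    ∀ z ∈ U, ∃ f : MP (Fin n) ℂ, eval z f ≠ 0 ∧ ∀ y, eval y f ≠ 0 → y ∈ U := by
  induction hU with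
  | basic s hs =>
    obtain ⟨f, rfl⟩ := hs
    intro z hz
    exact ⟨f, hz, fun y hy => hy⟩
  | univ => intro z _; exact ⟨1, by simp, fun y _ => Set.mem_univ y⟩
  | inter s t _ _ hs ht =>
    intro z hz
    obtain ⟨f, f1, f2⟩ := hs z hz.1
    obtain ⟨g, g1, g2⟩ := ht z hz.2
    refine ⟨f * g, by rw [map_mul]; exact mul_ne_zero f1 g1, fun y hy => ?_⟩
    rw [map_mul] at hy
    exact ⟨f2 y (left_ne_zero_of_mul hy), g2 y (right_ne_zero_of_mul hy)⟩
  | sUnion S _ hS =>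
    rintro z ⟨s, hs, hz⟩
    obtain ⟨f, f1, f2⟩ := hS s hs z hz
    exact ⟨f, f1, fun y hy => ⟨s, hs, f2 y hy⟩⟩

lemma sub_open {n : ℕ} (Z : Set (Fin n → ℂ)) (U : Set Z) (hU : @IsOpen _ (zariskiSub n Z) U) :
    ∀ z ∈ U, ∃ f : MP (Fin n) ℂ, eval z.1 f ≠ 0 ∧ ∀ y : Z, eval y.1 f ≠ 0 → y ∈ U := by
  obtain ⟨t, ht, rfl⟩ := (@isOpen_induced_iff _ _ (zariskiTop n) _ _).1 hU
  intro z hz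
  obtain ⟨f, f1, f2⟩ := zar_open t ht z.1 hz
  exact ⟨f, f1, fun y hy => f2 _ hy⟩

lemma open_sub {n : ℕ} (Z : Set (Fin n → ℂ)) (f : MP (Fin n) ℂ) :
    @IsOpen _ (zariskiSub n Z) {z : Z | eval z.1 f ≠ 0} :=
  (@isOpen_induced_iff _ _ (zariskiTop n) _ _).2
    ⟨{x | eval x f ≠ 0}, TopologicalSpace.isOpen_generateFrom_of_mem ⟨f, rfl⟩, rfl⟩

def vI {n : ℕ} {Z : Set (Fin n → ℂ)} (W : Set Z) : Ideal (MP (Fin n) ℂ) where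
  carrier := {f | ∀ z ∈ W, eval z.1 f = 0}
  add_mem' := fun {a b} ha hb z hz => by rw [map_add, ha z hz, hb z hz, add_zero]
  zero_mem' := fun z _ => map_zero _
  smul_mem' := fun c x hx z hz => by rw [smul_eq_mul, map_mul, hx z hz, mul_zero]

lemma exists_pt {n : ℕ} (I : Ideal (MP (Fin n) ℂ)) (hI : I.IsPrime) (f : MP (Fin n) ℂ) (hf : f ∉ I) :
    ∃ z : Fin n → ℂ, (∀ g ∈ I, eval z g = 0) ∧ eval z f ≠ 0 := by
  by_contra! h
  apply hf
  have := MvPolynomial.vanishingIdeal_zeroLocus_eq_radical (k := ℂ) (K := ℂ) I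
  rw [hI.radical] at this
  rw [← this, mem_vanishingIdeal_iff]
  intro x hx
  rw [mem_zeroLocus_iff] at hx
  exact h x hx

lemma mc_eval {n : ℕ} (f : MP (Fin n) ℤ) (z : Fin n → ℂ) : eval z (mc f) = aeval z f := by
  rw [mc, eval_map]; rfl

lemma vI_prime {n : ℕ} {Z : Set (Fin n → ℂ)} (W : Set Z) (hirr : @IsIrreducible Z (zariskiSub n Z) W) :
    (vI W).IsPrime := by
  refine ⟨?_, ?_⟩
  · intro h
    obtain ⟨z, hz⟩ := hirr.1
    have h1 : (1 : MP (Fin n) ℂ) ∈ vI W := by rw [h]; trivial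
    have := h1 z hz
    simp at this
  · intro f g hfg
    by_contra! hc
    obtain ⟨h1, h2⟩ := hc
    have h1' : ¬ ∀ z ∈ W, eval z.1 f = 0 := h1
    have h2' : ¬ ∀ z ∈ W, eval z.1 g = 0 := h2
    push Not at h1' h2'
    obtain ⟨z1, a1, a2⟩ := h1'
    obtain ⟨z2, b1, b2⟩ := h2'
    obtain ⟨z, c1, c2, c3⟩ := hirr.2 {z | eval z.1 f ≠ 0} {z | eval z.1 g ≠ 0} (open_sub _ f) (open_sub _ g) ⟨z1, a1, a2⟩ ⟨z2, b1, b2⟩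
    have := hfg z c1
    rw [map_mul] at this
    exact mul_ne_zero c2 c3 this

lemma zl_irr {n : ℕ} {Z : Set (Fin n → ℂ)} (I : Ideal (MP (Fin n) ℂ)) (hI : I.IsPrime)
    (hZ : ∀ z, (∀ f ∈ I, eval z f = 0) → z ∈ Z) :
    @IsPreirreducible Z (zariskiSub n Z) {z | ∀ f ∈ I, eval z.1 f = 0} := by
  rintro u v hu hv ⟨z1, a1, a2⟩ ⟨z2, b1, b2⟩
  obtain ⟨f, f1, f2⟩ := sub_open _ u hu z1 a2
  obtain ⟨g, g1, g2⟩ := sub_open _ v hv z2 b2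
  have hf : f ∉ I := fun h => f1 (a1 f h)
  have hg : g ∉ I := fun h => g1 (b1 g h)
  obtain ⟨z, z1, z2⟩ := exists_pt I hI (f * g) (fun h => (hI.mem_or_mem h).elim hf hg)
  rw [map_mul] at z2
  exact ⟨⟨z, hZ z z1⟩, z1, f2 _ (left_ne_zero_of_mul z2), g2 _ (right_ne_zero_of_mul z2)⟩

lemma comp_ideal {n k : ℕ} (F : Fin k → MP (Fin n) ℤ) (W : Set (zeroSet F))
    (hW : W ∈ @irreducibleComponents (zeroSet F) (zariskiSub n (zeroSet F))) :
    (vI W).IsPrime ∧ (∀ i, mc (F i) ∈ vI W) ∧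
    (∀ I : Ideal (MP (Fin n) ℂ), I.IsPrime → (∀ i, mc (F i) ∈ I) → I ≤ vI W → vI W ≤ I) ∧
    ∀ z : zeroSet F, (∀ f ∈ vI W, eval z.1 f = 0) ↔ z ∈ W := by
  have hZ : ∀ I : Ideal (MP (Fin n) ℂ), (∀ i, mc (F i) ∈ I) → ∀ z, (∀ f ∈ I, eval z f = 0) → z ∈ zeroSet F :=
    fun I hI z hz i => (mc_eval (F i) z).symm.trans (hz _ (hI i))
  have hirr : @IsIrreducible _ (zariskiSub n (zeroSet F)) W := hW.1
  have hp : (vI W).IsPrime := vI_prime W hirr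
  have hFW : ∀ i, mc (F i) ∈ vI W := fun i z _ => (mc_eval (F i) z.1).trans (z.2 i)
  have main : ∀ I : Ideal (MP (Fin n) ℂ), I.IsPrime → (∀ i, mc (F i) ∈ I) → I ≤ vI W →
      ∀ z : zeroSet F, (∀ f ∈ I, eval z.1 f = 0) → z ∈ W := by
    intro I hI hFI hle z hz
    have hWW : W ⊆ {z | ∀ f ∈ I, eval z.1 f = 0} := fun z hz f hf => hle hf z hz
    have hir : @IsIrreducible _ (zariskiSub n (zeroSet F)) {z | ∀ f ∈ I, eval z.1 f = 0} :=
      ⟨hirr.1.mono hWW, zl_irr I hI (hZ I hFI)⟩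
    have := hW.2 hir hWW
    exact this hz
  refine ⟨hp, hFW, ?_, fun z => ⟨main _ hp hFW le_rfl z, fun hz f hf => hf z hz⟩⟩
  intro I hI hFI hle f hf
  by_contra hfI
  obtain ⟨z, z1, z2⟩ := exists_pt I hI f hfI
  have hf' : ∀ z ∈ W, eval z.1 f = 0 := hf
  have h3 := main I hI hFI hle ⟨z, hZ I hFI z z1⟩ z1
  exact z2 (hf' ⟨z, hZ I hFI z z1⟩ h3)

end M25

section M26
open MvPolynomial
open Real (exp log)
open Int (castRingHom)

lemma post1 {n : ℕ} (u : Fin n → Polynomial ℤ) (U : Polynomial ℤ) (r : Fin n → ℕ+) (hU : U ≠ 0)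
    (hd : U.natDegree ≤ 1) (hu : ∀ j, (u j).natDegree ≤ U.natDegree) :
    ∃ (u' : Fin n → Polynomial ℤ) (U' : Polynomial ℤ) (r' : Fin n → ℕ+), U'.natDegree = U.natDegree ∧
      (∀ j, (u' j).natDegree ≤ U'.natDegree) ∧
      (∀ θ : ℂ, Polynomial.aeval θ U' = 0 → ∃ θ' : ℂ, Polynomial.aeval θ' U = 0 ∧
        (fun j => Polynomial.aeval θ (u' j) / ((r' j : ℕ) : ℂ)) = fun j => Polynomial.aeval θ' (u j) / ((r j : ℕ) : ℂ)) ∧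
      (∀ θ' : ℂ, Polynomial.aeval θ' U = 0 → ∃ θ : ℂ, Polynomial.aeval θ U' = 0 ∧
        (fun j => Polynomial.aeval θ (u' j) / ((r' j : ℕ) : ℂ)) = fun j => Polynomial.aeval θ' (u j) / ((r j : ℕ) : ℂ)) ∧
      ∀ j, (|U'.coeff j| : ℝ) ≤ 1 := by
  classical
  rcases Nat.le_one_iff_eq_zero_or_eq_one.1 hd with h0 | h1
  · have hc := Polynomial.eq_C_of_natDegree_eq_zero h0
    have hr : ∀ θ : ℂ, Polynomial.aeval θ U ≠ 0 := by
      intro θ h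
      rw [hc, Polynomial.aeval_C] at h
      have : U.coeff 0 = 0 := by simpa using h
      apply hU; rw [hc, this, map_zero]
    refine ⟨u, 1, r, by rw [h0]; simp, by rw [h0] at hu; simpa using hu, fun θ h => by simp at h, fun θ h => absurd h (hr θ), fun j => ?_⟩
    rw [Polynomial.coeff_one]; split_ifs <;> simp
  · have hlin := Polynomial.eq_X_add_C_of_natDegree_le_one hd
    have ha : U.coeff 1 ≠ 0 := by
      rw [← h1]; exact Polynomial.leadingCoeff_ne_zero.2 hU
    set t : ℚ := - (U.coeff 0 : ℚ) / (U.coeff 1 : ℚ) with ht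
    have haC : (U.coeff 1 : ℂ) ≠ 0 := by exact_mod_cast ha
    have hroot : ∀ θ : ℂ, Polynomial.aeval θ U = 0 ↔ θ = (t : ℂ) := by
      intro θ
      have hev : Polynomial.aeval θ U = (U.coeff 1 : ℂ) * θ + (U.coeff 0 : ℂ) := by
        conv_lhs => rw [hlin]
        simp
      rw [hev, ht]; push_cast
      rw [eq_div_iff haC]
      constructor <;> intro h <;> linear_combination h
    let q : Fin n → ℚ := fun j => Polynomial.aeval t (u j) / ((r j : ℕ) : ℚ)
    have hq : ∀ j, ((q j).num : ℂ) / ((q j).den : ℂ) = Polynomial.aeval (t : ℂ) (u j) / ((r j : ℕ) : ℂ) := by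
      intro j
      rw [← Rat.cast_def]
      have : Polynomial.aeval (t : ℂ) (u j) = ((Polynomial.aeval t (u j) : ℚ) : ℂ) :=
        Polynomial.aeval_algebraMap_apply ℂ t (u j)
      rw [this]; simp only [q]; push_cast; rfl
    have hpt : ∀ θ : ℂ, (fun j => Polynomial.aeval θ (Polynomial.C (q j).num) / (((⟨(q j).den, (q j).den_pos⟩ : ℕ+) : ℕ) : ℂ)) =
        fun j => Polynomial.aeval (t : ℂ) (u j) / ((r j : ℕ) : ℂ) := by
      intro θ
      funext j
      rw [← hq j, Polynomial.aeval_C]; simp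
    refine ⟨fun j => Polynomial.C (q j).num, Polynomial.X, fun j => ⟨(q j).den, (q j).den_pos⟩, by simp [h1], by simp,
      fun θ _ => ⟨t, (hroot t).2 rfl, hpt θ⟩, fun θ' h => ⟨0, by simp, ?_⟩, fun j => ?_⟩
    · rw [(hroot θ').1 h]; exact hpt 0
    · rw [Polynomial.coeff_X]; split_ifs <;> simp

lemma geo {n k : ℕ} {D : ℕ} (hD : 1 ≤ D) (F : Fin k → MP (Fin n) ℤ)
    (hFD : ∀ j, (F j).totalDegree ≤ D) :
    ∃ (m e : ℕ) (_ : 1 ≤ m) (_ : 1 ≤ e) (_ : m = D * e) (I : Type) (_ : Fintype I) (M : I → Nd n m)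
      (T : I → ℕ) (S : I → ℝ) (u : Fin n → Polynomial ℤ) (U : Polynomial ℤ) (r : Fin n → ℕ+),
      (∑ i, (M i).X e ≤ (D : ℝ) ^ n) ∧ (D * ∑ i, (M i).Y e ≤ (D : ℝ) ^ n) ∧
      (D * ∑ i, (lS (M i).P / (e : ℝ) ^ (M i).d) ≤ (D : ℝ) ^ n * (D * (log (n + 1) + 2 + 2 * (n * log D) + 6 * n) +
        ∑ j, log (1 + L1 (F j)))) ∧
      (∀ i, m ^ (M i).d * T i ≤ (M i).a0 + (M i).d * (m * (M i).a1)) ∧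
      (∀ i, 1 ≤ T i) ∧ (∀ i, 0 ≤ S i) ∧
      (∀ i, m ^ (M i).d * S i ≤ lS (M i).P + log 2 * ((M i).d * ((M i).a0 + ((M i).d + 1) * m * (M i).a1))) ∧
      U ≠ 0 ∧
      ((@irreducibleComponents (zeroSet F) (zariskiSub n (zeroSet F))).Finite ∧
        (@irreducibleComponents (zeroSet F) (zariskiSub n (zeroSet F))).ncard ≤ U.natDegree) ∧
      (∀ i, (u i).natDegree ≤ U.natDegree) ∧ U.natDegree ≤ D ^ n ∧
      (∀ θ : ℂ, Polynomial.aeval θ U = 0 →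
        (fun j => Polynomial.aeval θ (u j) / ((r j : ℕ) : ℂ)) ∈ zeroSet F) ∧
      (∀ W ∈ @irreducibleComponents (zeroSet F) (zariskiSub n (zeroSet F)),
        ∃ θ : ℂ, Polynomial.aeval θ U = 0 ∧ ∃ z : zeroSet F, z ∈ W ∧
          (z : Fin n → ℂ) = fun j => Polynomial.aeval θ (u j) / ((r j : ℕ) : ℂ)) ∧
      ∀ (R : ℝ), 1 + (D : ℝ) ^ (2 * n) ≤ R → (∀ i, 3 * (T i : ℝ) ^ 2 ≤ R) →
        ∀ j, (|U.coeff j| : ℝ) ≤ ∏ i, (R ^ T i * exp (S i)) := by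
  classical
  obtain ⟨m, e, hm, he, hme, I, _, M, l1, l2, l3, l4, l5, l6⟩ := leaves hD F hFD
  choose U w θ T S b1 b2 b3 b4 b5 b6 b7 b8 b9 b10 b11 using fun i => leaf_data hm F (M i) (l1 i)
  have hX : ∀ i, ((U i).natDegree : ℝ) ≤ (M i).X e := by
    intro i
    rw [Nd.X, le_div_iff₀ (by have : (0:ℝ) < e := by exact_mod_cast he
                              exact pow_pos this _), mul_comm]
    refine le_trans (b := ((m ^ (M i).d * (U i).natDegree : ℕ) : ℝ)) ?_ (by exact_mod_cast b2 i)
    have : e ^ (M i).d * (U i).natDegree ≤ m ^ (M i).d * (U i).natDegree :=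
      Nat.mul_le_mul_right _ (Nat.pow_le_pow_left (by rw [hme]; exact Nat.le_mul_of_pos_left _ hD) _)
    exact_mod_cast this
  have hG : ∑ i, (U i).natDegree ≤ D ^ n := by
    have : ((∑ i, (U i).natDegree : ℕ) : ℝ) ≤ ((D ^ n : ℕ) : ℝ) := by
      push_cast
      exact (Finset.sum_le_sum (fun i _ => hX i)).trans l4
    exact_mod_cast this
  obtain ⟨a, u, V, r, c0, c1, c2, c3, c4, c5⟩ := combine U w b7 (D ^ n) hG
  have good : ∀ W ∈ @irreducibleComponents (zeroSet F) (zariskiSub n (zeroSet F)), ∃ i, Good F (M i).p.asIdeal (vI W) := by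
    intro W hW
    obtain ⟨p1, p2, p3, p4⟩ := comp_ideal F W hW
    obtain ⟨i, hi⟩ := leaf_pick F (vI W) p2 (fun i => (M i).p.asIdeal) (fun q hq h => l3 q hq h)
    exact ⟨i, p1, hi, p3⟩
  have hmcF : ∀ (z : Fin n → ℂ) i, aeval z (F i) = ev z (F i) := by
    intro z i
    exact (congrArg (fun h => eval₂ h z (F i)) (RingHom.ext_int (algebraMap ℤ ℂ) (castRingHom ℂ)))
  have hz : ∀ z : ℂ, Polynomial.aeval z V = 0 → (fun j => Polynomial.aeval z (u j) / ((r j : ℕ) : ℂ)) ∈ zeroSet F := by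
    intro z hz
    rw [c4, Finset.prod_eq_zero_iff] at hz
    obtain ⟨i, -, hi⟩ := hz
    intro k
    rw [hmcF, funext ((c5 i z hi).2)]
    exact b8 i _ hi k
  have hcf : ∀ (R : ℝ), 1 + (D : ℝ) ^ (2 * n) ≤ R → (∀ i, 3 * (T i : ℝ) ^ 2 ≤ R) →
        ∀ j, (|V.coeff j| : ℝ) ≤ ∏ i, (R ^ T i * exp (S i)) := by
    intro R hR hT j
    refine coeff_bd V _ (fun t ht => ?_) j
    rw [c4, norm_prod]
    refine Finset.prod_le_prod (fun _ _ => norm_nonneg _) (fun i _ => ?_)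
    refine b11 i _ R ?_ ?_ (hT i)
    · have : (0:ℝ) ≤ (D : ℝ) ^ (2 * n) := by positivity
      linarith
    · refine (norm_sub_le _ _).trans (le_trans ?_ hR)
      rw [ht, Complex.norm_natCast]
      have : (a i : ℝ) ≤ (D : ℝ) ^ (2 * n) := by
        have := c1 i
        rw [← pow_mul, mul_comm n 2] at this
        exact_mod_cast this
      linarith
  rcases isEmpty_or_nonempty I with hI | hI
  · have hno : ∀ W ∈ @irreducibleComponents (zeroSet F) (zariskiSub n (zeroSet F)), False := by
      intro W hW
      obtain ⟨i, _⟩ := good W hW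
      exact hI.elim i
    have hno' := Set.eq_empty_of_forall_notMem hno
    refine ⟨m, e, hm, he, hme, I, inferInstance, M, T, S, u, V, r, l4, l5, l6, b3, b4, b5, b6, c0, ⟨?_, ?_⟩, c3, ?_, hz, ?_, hcf⟩
    · rw [hno']; exact Set.finite_empty
    · rw [hno', Set.ncard_empty]; exact Nat.zero_le _
    · rw [c2]; exact hG
    · intro W hW; exact (hno W hW).elim
  choose! L hL using good
  let Θ : Set (zeroSet F) → ℂ := fun W => θ (L W) (vI W) + a (L W)
  have hsub : ∀ W, Θ W - a (L W) = θ (L W) (vI W) := fun W => by simp [Θ]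
  have hroot : ∀ W ∈ @irreducibleComponents (zeroSet F) (zariskiSub n (zeroSet F)),
      Polynomial.aeval (Θ W - a (L W)) (U (L W)) = 0 := by
    intro W hW
    rw [hsub]
    exact (b9 _ _ (hL W hW)).1
  have hrootV : ∀ W ∈ @irreducibleComponents (zeroSet F) (zariskiSub n (zeroSet F)), Polynomial.aeval (Θ W) V = 0 := by
    intro W hW
    rw [c4]
    exact Finset.prod_eq_zero (Finset.mem_univ (L W)) (hroot W hW)
  have hinj : Set.InjOn Θ (@irreducibleComponents (zeroSet F) (zariskiSub n (zeroSet F))) := by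
    intro W hW W' hW' h
    have h1 : L W' = L W := (c5 (L W) (Θ W) (hroot W hW)).1 (L W') (by rw [h]; exact hroot W' hW')
    have h2 : vI W = vI W' := by
      have g' := hL W' hW'
      rw [h1] at g'
      refine b10 (L W) _ _ (hL W hW) g' ?_
      have e1 := hsub W
      have e2 := hsub W'
      rw [h1] at e2
      rw [← e1, ← e2, h]
    ext z
    rw [← (comp_ideal F W hW).2.2.2 z, h2, (comp_ideal F W' hW').2.2.2 z]
  let RT : Finset ℂ := (V.map (castRingHom ℂ)).roots.toFinset
  have hV0 : V.map (castRingHom ℂ) ≠ 0 := by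
    rwa [Ne, Polynomial.map_eq_zero_iff (RingHom.injective_int _)]
  have hmaps : Set.MapsTo Θ (@irreducibleComponents (zeroSet F) (zariskiSub n (zeroSet F))) (RT : Set ℂ) := by
    intro W hW
    show Θ W ∈ RT
    rw [Multiset.mem_toFinset, Polynomial.mem_roots hV0, Polynomial.IsRoot, Polynomial.eval_map]
    exact hrootV W hW
  have hRT : RT.card ≤ V.natDegree := by
    refine (Multiset.toFinset_card_le _).trans ((Polynomial.card_roots' _).trans ?_)
    exact Polynomial.natDegree_map_le
  refine ⟨m, e, hm, he, hme, I, inferInstance, M, T, S, u, V, r, l4, l5, l6, b3, b4, b5, b6, c0, ⟨?_, ?_⟩, c3, ?_, hz, ?_, hcf⟩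
  · exact Set.Finite.of_injOn hmaps hinj RT.finite_toSet
  · refine le_trans ?_ hRT
    rw [← Set.ncard_coe_finset RT]
    exact Set.ncard_le_ncard_of_injOn Θ hmaps hinj RT.finite_toSet
  · rw [c2]; exact hG
  · intro W hW
    refine ⟨Θ W, hrootV W hW, ⟨_, hz _ (hrootV W hW)⟩, ?_, rfl⟩
    rw [← (comp_ideal F W hW).2.2.2]
    intro f hf
    show eval (fun j => Polynomial.aeval (Θ W) (u j) / ((r j : ℕ) : ℂ)) f = 0
    rw [funext ((c5 (L W) (Θ W) (hroot W hW)).2), hsub]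
    exact (b9 _ _ (hL W hW)).2 f hf

end M26

section M27
open MvPolynomial
open Finset (mul_sum sum_add_distrib sum_insert sum_le_sum)
open Real (exp log log_le_log log_pow)

lemma one_add_L1 {n : ℕ} (f : MP (Fin n) ℤ) : 1 + L1 f ≤ (2 : ℝ) ^ bitSize f := by
  classical
  have h1 : L1 f = ∑ m ∈ f.support, ((f.coeff m).natAbs : ℝ) := by
    rw [L1, l1_eq _ f.support (support_map_subset _ _)]
    refine Finset.sum_congr rfl fun m _ => ?_
    rw [coeff_map, eq_intCast, Complex.norm_intCast, Nat.cast_natAbs, Int.cast_abs]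
  have key : ∀ s : Finset (Fin n →₀ ℕ), 1 + ∑ m ∈ s, ((f.coeff m).natAbs : ℝ) ≤
      (2 : ℝ) ^ (∑ m ∈ s, (Nat.size (f.coeff m).natAbs + ∑ i, Nat.size (m i))) := by
    intro s
    induction s using Finset.induction_on with
    | empty => simp
    | insert a s ha ih =>
      rw [sum_insert ha, sum_insert ha, pow_add]
      have h2 : (1 : ℝ) + ((f.coeff a).natAbs : ℝ) ≤ (2 : ℝ) ^ (Nat.size (f.coeff a).natAbs + ∑ i, Nat.size (a i)) := by
        have h3 : 1 + (f.coeff a).natAbs ≤ 2 ^ Nat.size (f.coeff a).natAbs := by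
          have := Nat.lt_size_self (f.coeff a).natAbs
          omega
        have h4 : 1 + (f.coeff a).natAbs ≤ 2 ^ (Nat.size (f.coeff a).natAbs + ∑ i, Nat.size (a i)) :=
          h3.trans (Nat.pow_le_pow_right (by norm_num) (Nat.le_add_right _ _))
        exact_mod_cast h4
      have h5 : (0 : ℝ) ≤ ((f.coeff a).natAbs : ℝ) := Nat.cast_nonneg _
      have h6 : (0 : ℝ) ≤ ∑ m ∈ s, ((f.coeff m).natAbs : ℝ) := Finset.sum_nonneg fun _ _ => Nat.cast_nonneg _
      have := mul_le_mul h2 ih (by linarith) (by positivity)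
      nlinarith [mul_nonneg h5 h6]
  rw [h1]
  exact key _

lemma sum_log_L1 {n k : ℕ} (F : Fin k → MP (Fin n) ℤ) :
    ∑ j, log (1 + L1 (F j)) ≤ sysBitSize F := by
  rw [sysBitSize, Nat.cast_sum]
  refine sum_le_sum fun j _ => ?_
  have h0 := L1_nonneg (F j)
  refine (log_le_log (by linarith) (one_add_L1 (F j))).trans ?_
  rw [log_pow]
  have := Real.log_two_lt_d9
  have h2 : (0:ℝ) ≤ (bitSize (F j) : ℝ) := Nat.cast_nonneg _
  nlinarith

lemma dpow (d D : ℕ) (hD : 2 ≤ D) : d ≤ D ^ d ∧ d * (d + 1) ≤ 2 * D ^ d := by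
  have h : 2 ^ d ≤ D ^ d := Nat.pow_le_pow_left hD d
  have h1 : d < 2 ^ d := Nat.lt_two_pow_self
  refine ⟨by omega, le_trans ?_ (Nat.mul_le_mul_left 2 h)⟩
  clear h h1
  induction d with
  | zero => simp
  | succ d ih =>
    rw [pow_succ]
    rcases Nat.lt_or_ge d 2 with h | h
    · interval_cases d <;> norm_num
    · nlinarith

set_option maxHeartbeats 1000000 in
lemma height {n k D : ℕ} (hD : 2 ≤ D) (hn : 1 ≤ n) (F : Fin k → MP (Fin n) ℤ) {m e : ℕ} (he : 1 ≤ e)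
    (hme : m = D * e) {I : Type} [Fintype I] (M : I → Nd n m) (T : I → ℕ) (S : I → ℝ) (c : ℝ)
    (l4 : ∑ i, (M i).X e ≤ (D : ℝ) ^ n) (l5 : D * ∑ i, (M i).Y e ≤ (D : ℝ) ^ n)
    (l6 : D * ∑ i, (lS (M i).P / (e : ℝ) ^ (M i).d) ≤ (D : ℝ) ^ n * (D * (log (n + 1) + 2 + 2 * (n * log D) + 6 * n) +
        ∑ j, log (1 + L1 (F j))))
    (hT : ∀ i, m ^ (M i).d * T i ≤ (M i).a0 + (M i).d * (m * (M i).a1))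
    (hS0 : ∀ i, 0 ≤ S i)
    (hS : ∀ i, m ^ (M i).d * S i ≤ lS (M i).P + log 2 * ((M i).d * ((M i).a0 + ((M i).d + 1) * m * (M i).a1)))
    (hc : ∀ (R : ℝ), 1 + (D : ℝ) ^ (2 * n) ≤ R → (∀ i, 3 * (T i : ℝ) ^ 2 ≤ R) → c ≤ ∏ i, (R ^ T i * exp (S i))) :
    c ≤ (2 : ℝ) ^ (100 * (D : ℝ) ^ n * ((sysBitSize F : ℝ) + n * log D)) := by
  have hDr : (2 : ℝ) ≤ D := by exact_mod_cast hD
  have her : (1 : ℝ) ≤ e := by exact_mod_cast he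
  have hnr : (1 : ℝ) ≤ n := by exact_mod_cast hn
  have hmr : (m : ℝ) = D * e := by rw [hme]; push_cast; ring
  have hl2 := Real.log_two_gt_d9
  have hl2' := Real.log_two_lt_d9
  have hLD : log 2 ≤ log D := log_le_log (by norm_num) hDr
  have hep : ∀ d : ℕ, (0 : ℝ) < (e : ℝ) ^ d := fun d => by positivity
  have hX0 : ∀ i, 0 ≤ (M i).X e := fun i => by rw [Nd.X]; positivity
  have hY0 : ∀ i, 0 ≤ (M i).Y e := fun i => by rw [Nd.Y]; positivity
  have hXe : ∀ i, ((M i).a0 : ℝ) = (M i).X e * (e : ℝ) ^ (M i).d := fun i => by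
    rw [Nd.X, div_mul_cancel₀ _ (hep _).ne']
  have hYe : ∀ i, (e : ℝ) * ((M i).a1 : ℝ) = (M i).Y e * (e : ℝ) ^ (M i).d := fun i => by
    rw [Nd.Y, div_mul_cancel₀ _ (hep _).ne']
  have hd1 : ∀ d : ℕ, (d : ℝ) ≤ (D : ℝ) ^ d := fun d => by exact_mod_cast (dpow d D hD).1
  have hd2 : ∀ d : ℕ, (d : ℝ) * (d + 1) ≤ 2 * (D : ℝ) ^ d := fun d => by exact_mod_cast (dpow d D hD).2
  have hTle : ∀ i, (T i : ℝ) ≤ (M i).X e + D * (M i).Y e := by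
    intro i
    have h : (m : ℝ) ^ (M i).d * T i ≤ (M i).a0 + (M i).d * (m * (M i).a1) := by exact_mod_cast hT i
    rw [hmr, mul_pow, mul_assoc (D : ℝ) e, hYe, hXe] at h
    have h1 := hd1 (M i).d
    have h2 : (1 : ℝ) ≤ (D : ℝ) ^ (M i).d := one_le_pow₀ (by linarith)
    have h3 : (D : ℝ) ^ (M i).d * T i ≤ (M i).X e + (M i).d * (D * (M i).Y e) := by
      have := hep (M i).d
      refine le_of_mul_le_mul_right ?_ this
      linarith
    have h4 : 0 ≤ D * (M i).Y e := mul_nonneg (by linarith) (hY0 i)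
    have h5 : (D : ℝ) ^ (M i).d * T i ≤ (D : ℝ) ^ (M i).d * ((M i).X e + D * (M i).Y e) := by
      nlinarith [mul_le_mul_of_nonneg_right h1 h4, mul_le_mul_of_nonneg_right h2 (hX0 i)]
    exact le_of_mul_le_mul_left h5 (by linarith)
  have hSle : ∀ i, S i ≤ lS (M i).P / (e : ℝ) ^ (M i).d + ((M i).X e + 2 * (D * (M i).Y e)) := by
    intro i
    have h := hS i
    set A := lS (M i).P / (e : ℝ) ^ (M i).d with hA
    have hAe : lS (M i).P = A * (e : ℝ) ^ (M i).d := by rw [hA, div_mul_cancel₀ _ (hep _).ne']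
    have hA0 : 0 ≤ A := by
      rw [hA]
      exact div_nonneg (lS_nonneg (M i).P (M i).node.isGen.1.ne_zero) (hep _).le
    have h0 : ((M i).d : ℝ) * ((M i).a0 + ((M i).d + 1) * m * (M i).a1) =
        ((M i).d * (M i).X e + (M i).d * ((M i).d + 1) * (D * (M i).Y e)) * (e : ℝ) ^ (M i).d := by
      rw [hXe, hmr]
      linear_combination (((M i).d : ℝ) * ((M i).d + 1) * D) * hYe i
    rw [h0, hAe, hmr, mul_pow] at h
    have h1 := hd1 (M i).d
    have h1' := hd2 (M i).d
    have h2 : (1 : ℝ) ≤ (D : ℝ) ^ (M i).d := one_le_pow₀ (by linarith)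
    have h4 : 0 ≤ D * (M i).Y e := mul_nonneg (by linarith) (hY0 i)
    have h3 : (D : ℝ) ^ (M i).d * S i ≤ A + log 2 * ((M i).d * (M i).X e + (M i).d * ((M i).d + 1) * (D * (M i).Y e)) := by
      refine le_of_mul_le_mul_right ?_ (hep (M i).d)
      linarith
    have h6 : 0 ≤ (M i).d * (M i).X e + (M i).d * ((M i).d + 1) * (D * (M i).Y e) := by
      have := hX0 i
      positivity
    have h7 : log 2 * ((M i).d * (M i).X e + (M i).d * ((M i).d + 1) * (D * (M i).Y e)) ≤
        (M i).d * (M i).X e + (M i).d * ((M i).d + 1) * (D * (M i).Y e) :=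
      mul_le_of_le_one_left h6 (by linarith)
    have h5 : (D : ℝ) ^ (M i).d * S i ≤ (D : ℝ) ^ (M i).d * (A + ((M i).X e + 2 * (D * (M i).Y e))) := by
      have a1 := mul_le_mul_of_nonneg_right h1' h4
      have a2 := mul_le_mul_of_nonneg_right h1 (hX0 i)
      have a3 := mul_le_mul_of_nonneg_right h2 hA0
      linarith
    exact le_of_mul_le_mul_left h5 (by linarith)
  set G : ℝ := (D : ℝ) ^ n with hG
  have hG1 : 1 ≤ G := one_le_pow₀ (by linarith)
  rw [mul_sum] at l5
  have hTs : ∑ i, (T i : ℝ) ≤ 2 * G := by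
    refine (sum_le_sum fun i _ => hTle i).trans ?_
    rw [sum_add_distrib]; linarith
  have hTi : ∀ i, (T i : ℝ) ≤ 2 * G := fun i =>
    (Finset.single_le_sum (f := fun i => (T i : ℝ)) (fun _ _ => Nat.cast_nonneg _) (Finset.mem_univ i)).trans hTs
  have hGG : (D : ℝ) ^ (2 * n) = G ^ 2 := by rw [hG, ← pow_mul, mul_comm]
  have hc1 := hc (12 * G ^ 2) (by rw [hGG]; nlinarith) (fun i => by
    have := hTi i
    have h0 : (0:ℝ) ≤ T i := Nat.cast_nonneg _
    nlinarith)
  refine hc1.trans ?_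
  have hR0 : (0:ℝ) < 12 * G ^ 2 := by positivity
  have hprod : ∏ i, ((12 * G ^ 2) ^ T i * exp (S i)) =
      exp (∑ i, ((T i : ℝ) * log (12 * G ^ 2) + S i)) := by
    rw [Real.exp_sum]
    refine Finset.prod_congr rfl fun i _ => ?_
    rw [Real.exp_add, mul_comm (T i : ℝ), Real.exp_mul, Real.exp_log hR0, Real.rpow_natCast]
  rw [hprod, Real.rpow_def_of_pos (by norm_num), Real.exp_le_exp, sum_add_distrib, ← Finset.sum_mul]
  have hlG : log (12 * G ^ 2) ≤ 4 + 2 * (n * log D) := by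
    rw [Real.log_mul (by norm_num) (by positivity), log_pow, hG, log_pow]
    have : log 12 ≤ log (2 ^ 4) := log_le_log (by norm_num) (by norm_num)
    rw [log_pow] at this
    push_cast at this ⊢
    linarith
  have hlG0 : 0 ≤ log (12 * G ^ 2) := Real.log_nonneg (by nlinarith)
  have hA : ∑ i, (lS (M i).P / (e : ℝ) ^ (M i).d) ≤ G * ((log (n + 1) + 2 + 2 * (n * log D) + 6 * n) + sysBitSize F) := by
    have hs := sum_log_L1 F
    have hs0 : (0:ℝ) ≤ sysBitSize F := Nat.cast_nonneg _
    refine le_of_mul_le_mul_left (l6.trans ?_) (show (0:ℝ) < D by linarith)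
    rw [mul_left_comm (D : ℝ) G]
    refine mul_le_mul_of_nonneg_left ?_ (show (0:ℝ) ≤ G by linarith)
    rw [mul_add (D : ℝ) _ (sysBitSize F : ℝ)]
    nlinarith
  have hSs : ∑ i, S i ≤ G * ((log (n + 1) + 2 + 2 * (n * log D) + 6 * n) + sysBitSize F) + 3 * G := by
    refine (sum_le_sum fun i _ => hSle i).trans ?_
    rw [sum_add_distrib, sum_add_distrib, ← mul_sum]
    linarith
  have hln : log (n + 1) ≤ n := by
    have := Real.log_le_sub_one_of_pos (show (0:ℝ) < n + 1 by linarith)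
    linarith
  have hnL : (n : ℝ) ≤ 2 * (n * log D) := by nlinarith
  have hTT : (∑ i, (T i : ℝ)) * log (12 * G ^ 2) ≤ G * (8 + 4 * (n * log D)) := by
    refine (mul_le_mul_of_nonneg_right hTs hlG0).trans ?_
    nlinarith
  have hs0 : (0:ℝ) ≤ sysBitSize F := Nat.cast_nonneg _
  have hfin : (8 + 4 * (n * log D)) + ((log (n + 1) + 2 + 2 * (n * log D) + 6 * n) + sysBitSize F) + 3 ≤
      50 * ((sysBitSize F : ℝ) + n * log D) := by linarith
  have hfin2 := mul_le_mul_of_nonneg_left hfin (show (0:ℝ) ≤ G by linarith)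
  have hW : 0 ≤ G * ((sysBitSize F : ℝ) + n * log D) := mul_nonneg (by linarith) (by linarith)
  have : 50 * (G * ((sysBitSize F : ℝ) + n * log D)) ≤ log 2 * (100 * G * ((sysBitSize F : ℝ) + n * log D)) := by
    have := mul_le_mul_of_nonneg_right (show (1/2 : ℝ) ≤ log 2 by linarith) hW
    linarith
  linarith

end M27

open scoped Classical
noncomputable section

/-- Rational univariate reduction with effective height bounds. -/
theorem rational_univariate_reduction :
    ∃ c : ℝ, 0 < c ∧
      ∀ (n k : ℕ) (F : Fin k → MvPolynomial (Fin n) ℤ), (∀ i, F i ≠ 0) →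
        ∀ D : ℕ, D = Finset.univ.sup (fun i => (F i).totalDegree) → 1 ≤ D →
          ∃ (u : Fin n → Polynomial ℤ) (U : Polynomial ℤ) (r : Fin n → ℕ+),
            -- (1) number of irreducible components, and degree bounds
            ((@irreducibleComponents (zeroSet F) (zariskiSub n (zeroSet F))).Finite ∧
              (@irreducibleComponents (zeroSet F) (zariskiSub n (zeroSet F))).ncard ≤
                U.natDegree) ∧
            (∀ i, (u i).natDegree ≤ U.natDegree) ∧ U.natDegree ≤ D ^ n ∧
            -- (2) every root of `U` gives a common zero of `F` ...
            (∀ θ : ℂ, Polynomial.aeval θ U = 0 →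
              (fun j => Polynomial.aeval θ (u j) / ((r j : ℕ) : ℂ)) ∈ zeroSet F) ∧
            -- ... and every irreducible component of the zero set contains such a point
            (∀ W ∈ @irreducibleComponents (zeroSet F) (zariskiSub n (zeroSet F)),
              ∃ θ : ℂ, Polynomial.aeval θ U = 0 ∧
                ∃ z : zeroSet F, z ∈ W ∧
                  (z : Fin n → ℂ) =
                    fun j => Polynomial.aeval θ (u j) / ((r j : ℕ) : ℂ)) ∧
            -- (3) height bound on the coefficients of `U`
            (∀ j : ℕ, (|U.coeff j| : ℝ) ≤
              (2 : ℝ) ^ (c * (D : ℝ) ^ n * ((sysBitSize F : ℝ) + n * Real.log D))) := by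
  refine ⟨100, by norm_num, ?_⟩
  intro n k F hF0 D hDs hD
  have hFD : ∀ j, (F j).totalDegree ≤ D := by
    intro j
    rw [hDs]
    exact Finset.le_sup (f := fun i => (F i).totalDegree) (Finset.mem_univ j)
  obtain ⟨m, e, hm, he, hme, I, _, M, T, S, u, U, r, l4, l5, l6, g1, g2, g3, g4, hU, h1, h2, h3, h4, h5, h6⟩ := geo hD F hFD
  rcases Nat.lt_or_ge D 2 with hD2 | hD2
  · have hD1 : D = 1 := by omega
    have hU1 : U.natDegree ≤ 1 := by rw [hD1, one_pow] at h3; exact h3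
    obtain ⟨u', U', r', p1, p2, p3, p4, p5⟩ := post1 u U r hU hU1 h2
    refine ⟨u', U', r', by rw [p1]; exact h1, p2, by rw [p1]; exact h3, ?_, ?_, ?_⟩
    · intro θ hθ
      obtain ⟨θ', q1, q2⟩ := p3 θ hθ
      rw [q2]; exact h4 θ' q1
    · intro W hW
      obtain ⟨θ', q1, z, q2, q3⟩ := h5 W hW
      obtain ⟨θ, q4, q5⟩ := p4 θ' q1
      exact ⟨θ, q4, z, q2, by rw [q3, q5]⟩
    · intro j
      refine (p5 j).trans (Real.one_le_rpow (by norm_num) ?_)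
      rw [hD1]
      simp
  · have hn : 1 ≤ n := by
      by_contra hn
      have hn0 : n = 0 := by omega
      subst hn0
      have : D = 0 := by
        rw [hDs]
        refine Nat.le_zero.1 (Finset.sup_le fun j _ => ?_)
        rw [MvPolynomial.eq_C_of_isEmpty (F j), MvPolynomial.totalDegree_C]
      omega
    refine ⟨u, U, r, h1, h2, h3, h4, h5, fun j => ?_⟩
    exact height hD2 hn F he hme M T S _ l4 l5 l6 g1 g3 g4 (fun R hR hT => h6 R hR hT j)

end
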